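/- arXiv:2504.14599 — 2 statements merged into one kernel-verified Lean document; each statement's English description precedes it below -/
import Mathlib

section
/- Let a be a positive integer and let r be a real number. Then there exists ε > 0 such that for all real u with |u| < ε, one has Σ_{k > n ≥ 1} ((1−2r)^{k−n−1} 2^{n−1} Σ_{k∈I₀(k,n)} t^r_{2a,a}(k)) u^{k−2} = a^{−2} 2^{2u/a} t(2) exp(Σ_{n=2}^∞ (4(2^{n−1}−1) t(n)/(n aⁿ (2ⁿ−1))) uⁿ), where both series converge absolutely. -/
/-- All groupings of an index obtained by replacing each box in
`k₁ □ k₂ □ ⋯ □ kₙ` by a comma (new block) or a plus (merge). -/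
def groupings : List ℕ → List (List ℕ)
  | [] => [[]]
  | [x] => [[x]]
  | x :: y :: rest => ((groupings (y :: rest)).map (x :: ·)) ++ groupings ((x + y) :: rest)
termination_by l => l.length

/-- Multiple t-value of level `N` with residue `a`:
`t_{N,a}(k) = Σ_{m₁ > ⋯ > mₙ > 0, mᵢ ≡ a (mod N)} 1/(m₁^{k₁} ⋯ mₙ^{kₙ})`. -/
noncomputable def tv (N a : ℕ) (k : List ℕ) : ℝ :=
  ∑' m : {f : Fin k.length → ℕ // StrictAnti f ∧ ∀ i, 0 < f i ∧ f i % N = a % N},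
    ∏ i : Fin k.length, ((m.1 i : ℝ) ^ k.get i)⁻¹

/-- Interpolated multiple t-value of level `N`:
`t^r_{N,a}(k) = Σ_p r^{n - dep(p)} t_{N,a}(p)` over all groupings `p` of `k`. -/
noncomputable def itv (N a : ℕ) (r : ℝ) (k : List ℕ) : ℝ :=
  ((groupings k).map (fun p => r ^ (k.length - p.length) * tv N a p)).sum

/-- An index is admissible if all entries are positive and the first entry is at least `2`. -/
def IsAdmissible (k : List ℕ) : Prop := (∀ i ∈ k, 1 ≤ i) ∧ 2 ≤ k.headI

/-- The height of an index: the number of entries that are at least `2`. -/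
def height (k : List ℕ) : ℕ := k.countP (fun i => 2 ≤ i)

/-- `X₀^r(k,n)` at level `2a` with residue `a`: the sum of interpolated multiple
t-values over all admissible indices of weight `k` and depth `n`. -/
noncomputable def X0d (a : ℕ) (r : ℝ) (k n : ℕ) : ℝ :=
  ∑' l : {l : List ℕ // IsAdmissible l ∧ l.sum = k ∧ l.length = n},
    itv (2 * a) a r l.1


/-- The integral `∫₀^{π/2} sin^p`, for a real exponent `p`. -/
noncomputable def sinIntegral (p : ℝ) : ℝ := ∫ θ in (0 : ℝ)..(Real.pi / 2), Real.sin θ ^ p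

theorem intervalIntegrable_sin_rpow_mul {p : ℝ} (hp : -1 < p) {h : ℝ → ℝ} (hh : Continuous h) :
    IntervalIntegrable (fun θ => Real.sin θ ^ p * h θ) MeasureTheory.volume 0 (Real.pi / 2) := by
  have h1 : IntervalIntegrable (fun θ : ℝ => θ ^ p) MeasureTheory.volume 0 (Real.pi / 2) :=
    intervalIntegral.intervalIntegrable_rpow' hp
  have h2 : ContinuousOn (fun θ => Real.sinc θ ^ p * h θ) (Set.uIcc 0 (Real.pi / 2)) := by
    refine ContinuousOn.mul (ContinuousOn.rpow_const Real.continuous_sinc.continuousOn ?_)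
      hh.continuousOn
    intro x hx
    rw [Set.uIcc_of_le (by positivity)] at hx
    left
    rcases eq_or_lt_of_le hx.1 with h0 | h0
    · simp [← h0]
    · rw [Real.sinc_of_ne_zero h0.ne']
      have := Real.sin_pos_of_pos_of_lt_pi h0 (by linarith [hx.2, Real.pi_pos])
      positivity
  refine (h1.mul_continuousOn h2).congr ?_
  intro x hx
  rw [Set.uIoc_of_le (by positivity)] at hx
  have hs := Real.sin_pos_of_pos_of_lt_pi hx.1 (by linarith [hx.2, Real.pi_pos])
  have hx0 := hx.1
  simp only
  rw [Real.sinc_of_ne_zero hx0.ne', ← mul_assoc, ← Real.mul_rpow hx0.le (by positivity)]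
  congr 2
  field_simp

theorem intervalIntegrable_sin_rpow {p : ℝ} (hp : -1 < p) :
    IntervalIntegrable (fun θ => Real.sin θ ^ p) MeasureTheory.volume 0 (Real.pi / 2) := by
  simpa using intervalIntegrable_sin_rpow_mul hp (continuous_const (y := (1 : ℝ)))

theorem sinIntegral_pos {p : ℝ} (hp : -1 < p) : 0 < sinIntegral p := by
  refine intervalIntegral.intervalIntegral_pos_of_pos_on (intervalIntegrable_sin_rpow hp) ?_
    (by positivity)
  intro x hx
  have := Real.sin_pos_of_pos_of_lt_pi hx.1 (by linarith [hx.2, Real.pi_pos])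
  positivity

theorem sinIntegral_anti {p q : ℝ} (hp : -1 < p) (hpq : p ≤ q) :
    sinIntegral q ≤ sinIntegral p := by
  refine intervalIntegral.integral_mono_on_of_le_Ioo (by positivity)
    (intervalIntegrable_sin_rpow (hp.trans_le hpq)) (intervalIntegrable_sin_rpow hp) ?_
  intro x hx
  have := Real.sin_pos_of_pos_of_lt_pi hx.1 (by linarith [hx.2, Real.pi_pos])
  exact Real.rpow_le_rpow_of_exponent_ge this (Real.sin_le_one x) hpq

/-- Integration of the derivative of `sin^{p+1} · g` over `[0, π/2]`, when `g (π/2) = 0`. -/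
theorem integral_deriv_sin_rpow_mul {p : ℝ} (hp : -1 < p) {g g' : ℝ → ℝ}
    (hg : ∀ x, HasDerivAt g (g' x) x) (hg' : Continuous g') (hend : g (Real.pi / 2) = 0) :
    ∫ θ in (0 : ℝ)..(Real.pi / 2),
      Real.sin θ ^ p * ((p + 1) * Real.cos θ * g θ + Real.sin θ * g' θ) = 0 := by
  have hgc : Continuous g := continuous_iff_continuousAt.2 fun x => (hg x).continuousAt
  rw [intervalIntegral.integral_eq_sub_of_hasDerivAt_of_le
    (f := fun θ => Real.sin θ ^ (p + 1) * g θ) (by positivity)]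
  · simp [hend, Real.zero_rpow (by linarith : p + 1 ≠ 0)]
  · exact ((Real.continuous_sin.rpow_const fun x => Or.inr (by linarith)).mul hgc).continuousOn
  · intro x hx
    have hs := Real.sin_pos_of_pos_of_lt_pi hx.1 (by linarith [hx.2, Real.pi_pos])
    have h1 := ((Real.hasDerivAt_sin x).rpow_const (p := p + 1) (Or.inl hs.ne')).mul (hg x)
    refine h1.congr_deriv ?_
    rw [add_sub_cancel_right, Real.rpow_add_one hs.ne']
    ring
  · exact intervalIntegrable_sin_rpow_mul hp (by fun_prop)

theorem sinIntegral_add_two {p : ℝ} (hp : -1 < p) :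
    (p + 2) * sinIntegral (p + 2) = (p + 1) * sinIntegral p := by
  have h := integral_deriv_sin_rpow_mul hp (g := Real.cos) (g' := fun x => -Real.sin x)
    Real.hasDerivAt_cos (by fun_prop) Real.cos_pi_div_two
  have h2 : ∫ θ in (0 : ℝ)..(Real.pi / 2),
      Real.sin θ ^ p * ((p + 1) * Real.cos θ * Real.cos θ + Real.sin θ * -Real.sin θ) =
      ∫ θ in (0 : ℝ)..(Real.pi / 2),
        ((p + 1) * Real.sin θ ^ p - (p + 2) * Real.sin θ ^ (p + 2)) := by
    refine intervalIntegral.integral_congr ?_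
    intro x hx
    rw [Set.uIcc_of_le (by positivity)] at hx
    simp only
    rcases eq_or_lt_of_le hx.1 with h0 | h0
    · simp [← h0, Real.zero_rpow (by linarith : p + 2 ≠ 0), mul_comm]
    have hs := Real.sin_pos_of_pos_of_lt_pi h0 (by linarith [hx.2, Real.pi_pos])
    rw [Real.rpow_add hs, Real.rpow_two]
    have := Real.sin_sq_add_cos_sq x
    have hc : Real.cos x ^ 2 = 1 - Real.sin x ^ 2 := by linarith
    linear_combination (p + 1) * Real.sin x ^ p * hc
  rw [h2, intervalIntegral.integral_sub
    ((intervalIntegrable_sin_rpow hp).const_mul _)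
    ((intervalIntegrable_sin_rpow (by linarith)).const_mul _),
    intervalIntegral.integral_const_mul, intervalIntegral.integral_const_mul] at h
  unfold sinIntegral
  linarith

theorem sinIntegral_zero : sinIntegral 0 = Real.pi / 2 := by
  simp [sinIntegral]

theorem sinIntegral_one : sinIntegral 1 = 1 := by
  simp [sinIntegral]

open Filter Topology in
theorem tendsto_sinIntegral_ratio {p : ℝ} (hp : |p| ≤ 2) :
    Tendsto (fun M : ℕ => sinIntegral (p + 2 * M) / sinIntegral (2 * M)) atTop (𝓝 1) := by
  obtain ⟨h1, h2⟩ := abs_le.1 hp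
  have e1 : Tendsto (fun M : ℕ => ((M : ℝ) + 1 / 2) / (M + 1)) atTop (𝓝 1) := by
    have := tendsto_add_mul_div_add_mul_atTop_nhds (𝕜 := ℝ) (1 / 2) 1 1 (d := 1) one_ne_zero
    simpa [add_comm] using this
  have e2 : Tendsto (fun M : ℕ => ((M : ℝ)) / (M - 1 / 2)) atTop (𝓝 1) := by
    have := tendsto_add_mul_div_add_mul_atTop_nhds (𝕜 := ℝ) 0 (-1 / 2) 1 (d := 1) one_ne_zero
    refine Tendsto.congr (fun M => ?_) (by simpa using this)
    congr 1; ring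
  refine tendsto_of_tendsto_of_tendsto_of_le_of_le' e1 e2 ?_ ?_
  · filter_upwards [eventually_ge_atTop 1] with M hM
    have hM' : (1 : ℝ) ≤ M := by exact_mod_cast hM
    have hpos := sinIntegral_pos (p := 2 * (M : ℝ)) (by linarith)
    have h3 := sinIntegral_add_two (p := 2 * (M : ℝ)) (by linarith)
    have h4 := sinIntegral_anti (p := p + 2 * M) (q := 2 * M + 2) (by linarith) (by linarith)
    rw [div_le_div_iff₀ (by linarith) hpos]
    nlinarith
  · filter_upwards [eventually_ge_atTop 1] with M hM
    have hM' : (1 : ℝ) ≤ M := by exact_mod_cast hM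
    have hpos := sinIntegral_pos (p := 2 * (M : ℝ)) (by linarith)
    have h3 := sinIntegral_add_two (p := 2 * (M : ℝ) - 2) (by linarith)
    have h4 := sinIntegral_anti (p := 2 * M - 2) (q := p + 2 * M) (by linarith) (by linarith)
    rw [sub_add_cancel] at h3
    rw [div_le_div_iff₀ hpos (by linarith)]
    nlinarith

open Filter Topology in
theorem sinIntegral_mul_sinIntegral_add_one {p : ℝ} (hp : -1 < p) (hp' : p ≤ 1) :
    (p + 1) * sinIntegral p * sinIntegral (p + 1) = Real.pi / 2 := by
  have key : ∀ q : ℝ, -1 < q → ∀ M : ℕ, (q + 2 * M + 1) * sinIntegral (q + 2 * M) *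
      sinIntegral (q + 1 + 2 * M) = (q + 1) * sinIntegral q * sinIntegral (q + 1) := by
    intro q hq M
    induction M with
    | zero => simp
    | succ M ih =>
      have hM : (0 : ℝ) ≤ M := by positivity
      have h1 := sinIntegral_add_two (p := q + 2 * M) (by linarith)
      have h2 := sinIntegral_add_two (p := q + 1 + 2 * M) (by linarith)
      have e1 : q + 2 * ((M + 1 : ℕ) : ℝ) = q + 2 * M + 2 := by push_cast; ring
      have e2 : q + 1 + 2 * ((M + 1 : ℕ) : ℝ) = q + 1 + 2 * M + 2 := by push_cast; ring
      rw [e1, e2, ← ih]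
      have h3 : q + 2 * M + 2 ≠ 0 := by linarith
      apply mul_left_cancel₀ h3
      linear_combination (q + 2 * M + 2) * sinIntegral (q + 2 * M + 2) * h2 +
        (q + 2 * M + 2) * sinIntegral (q + 1 + 2 * M) * h1
  have h0 := key 0 (by norm_num)
  simp only [zero_add, sinIntegral_zero, sinIntegral_one, one_mul, mul_one] at h0
  have l1 := tendsto_sinIntegral_ratio (p := p) (abs_le.2 ⟨by linarith, by linarith⟩)
  have l2 := tendsto_sinIntegral_ratio (p := p + 1) (abs_le.2 ⟨by linarith, by linarith⟩)
  have l3 := tendsto_sinIntegral_ratio (p := 1) (by norm_num)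
  have l4 : Tendsto (fun M : ℕ => (p + 2 * M + 1) / (2 * M + 1 : ℝ)) atTop (𝓝 1) := by
    have := tendsto_add_mul_div_add_mul_atTop_nhds (𝕜 := ℝ) (p + 1) 1 2 (d := 2) two_ne_zero
    refine Tendsto.congr (fun M => ?_) (by simpa using this)
    congr 1 <;> ring
  have l5 := ((l4.mul l1).mul l2).div l3 one_ne_zero
  have l6 : Tendsto (fun _ : ℕ => (p + 1) * sinIntegral p * sinIntegral (p + 1) / (Real.pi / 2))
      atTop (𝓝 1) := by
    refine Tendsto.congr (fun M => ?_) (by simpa using l5)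
    have hM : (0 : ℝ) ≤ M := by positivity
    have p1 := sinIntegral_pos (p := 2 * (M : ℝ)) (by linarith)
    have p2 := sinIntegral_pos (p := 1 + 2 * (M : ℝ)) (by linarith)
    rw [← key p hp M, ← h0 M, Pi.div_apply]
    field_simp
  have l7 := tendsto_nhds_unique l6 tendsto_const_nhds
  field_simp at l7 ⊢
  linarith

open Filter Topology in
/-- A Wallis-type product for `∫₀^{π/2} sin^{-v}`. -/
theorem tendsto_prod_sinIntegral {v : ℝ} (hv : |v| < 1) :
    Tendsto (fun M : ℕ => ∏ i ∈ Finset.range M,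
      ((1 - v / (2 * i + 2)) / (1 - v / (2 * i + 1)))) atTop
      (𝓝 (2 / Real.pi * sinIntegral (-v))) := by
  obtain ⟨hv1, hv2⟩ := abs_lt.1 hv
  have key : ∀ M : ℕ, sinIntegral (-v + 2 * M) * (∏ i ∈ Finset.range M,
      ((1 - v / (2 * i + 2)) / (1 - v / (2 * i + 1)))) =
      sinIntegral (2 * M) * (2 / Real.pi * sinIntegral (-v)) := by
    intro M
    induction M with
    | zero =>
      simp only [Nat.cast_zero, mul_zero, add_zero, Finset.range_zero, Finset.prod_empty,
        sinIntegral_zero]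
      field_simp
    | succ M ih =>
      have hM : (0 : ℝ) ≤ M := by positivity
      have h1 := sinIntegral_add_two (p := -v + 2 * M) (by linarith)
      have h2 := sinIntegral_add_two (p := 2 * (M : ℝ)) (by linarith)
      have e1 : -v + 2 * ((M + 1 : ℕ) : ℝ) = -v + 2 * M + 2 := by push_cast; ring
      have e2 : 2 * ((M + 1 : ℕ) : ℝ) = 2 * M + 2 := by push_cast; ring
      rw [e1, e2, Finset.prod_range_succ]
      have h3 : -v + 2 * M + 2 ≠ 0 := by linarith
      have h4 : (2 : ℝ) * M + 2 ≠ 0 := by linarith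
      have h5 : (2 : ℝ) * M + 1 ≠ 0 := by linarith
      have h6 : (2 : ℝ) * M + 1 - v ≠ 0 := by linarith
      have e3 : sinIntegral (-v + 2 * M + 2) =
          (-v + 2 * M + 1) * sinIntegral (-v + 2 * M) / (-v + 2 * M + 2) := by
        rw [← h1]; field_simp
      have e4 : sinIntegral (2 * M + 2) =
          (2 * M + 1) * sinIntegral (2 * M) / (2 * M + 2) := by
        rw [← h2]; field_simp
      have e5 : (1 - v / (2 * M + 2)) / (1 - v / (2 * M + 1)) =
          (-v + 2 * M + 2) * (2 * M + 1) / ((2 * M + 2) * (-v + 2 * M + 1)) := by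
        have : -v + 2 * (M : ℝ) + 1 ≠ 0 := by linarith
        have : 1 - v / (2 * M + 1) ≠ 0 := by
          rw [one_sub_div h5]
          exact div_ne_zero h6 h5
        field_simp
        ring
      have h7 : -v + 2 * (M : ℝ) + 1 ≠ 0 := by linarith
      rw [e3, e4, e5]
      have h8 : (2 * (M : ℝ) + 1) * sinIntegral (2 * M) / (2 * M + 2) *
          (2 / Real.pi * sinIntegral (-v)) =
          (2 * (M : ℝ) + 1) / (2 * M + 2) * (sinIntegral (2 * M) *
          (2 / Real.pi * sinIntegral (-v))) := by ring
      rw [h8, ← ih]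
      field_simp
  have l1 := tendsto_sinIntegral_ratio (p := -v) (abs_le.2 ⟨by linarith, by linarith⟩)
  have l2 := (tendsto_const_nhds (x := 2 / Real.pi * sinIntegral (-v))).div l1 one_ne_zero
  refine Tendsto.congr (fun M => ?_) (by simpa using l2)
  have hM : (0 : ℝ) ≤ M := by positivity
  have p1 := sinIntegral_pos (p := 2 * (M : ℝ)) (by linarith)
  have p2 := sinIntegral_pos (p := -v + 2 * (M : ℝ)) (by linarith)
  have k := key M
  simp only [Pi.div_apply]
  rw [eq_comm, eq_div_iff (by positivity), ← mul_div_assoc, div_eq_iff p1.ne']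
  linarith


theorem hasSum_rpow_mul_sin_div {ρ : ℝ} (h0 : 0 ≤ ρ) (h1 : ρ < 1) (θ : ℝ) :
    HasSum (fun j : ℕ => ρ ^ (2 * j + 1) / (2 * j + 1) * Real.sin ((2 * j + 1) * θ))
      ((Complex.arg (1 + ρ * Complex.exp (θ * Complex.I)) -
        Complex.arg (1 - ρ * Complex.exp (θ * Complex.I))) / 2) := by
  set z : ℂ := ρ * Complex.exp (θ * Complex.I) with hz
  have hn : ‖z‖ < 1 := by
    rw [hz, norm_mul, Complex.norm_exp_ofReal_mul_I, mul_one, Complex.norm_real,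
      Real.norm_of_nonneg h0]
    exact h1
  have s := (Complex.hasSum_taylorSeries_log hn).add (Complex.hasSum_taylorSeries_neg_log hn)
  have s2 := (Complex.hasSum_im s).div_const 2
  have e : (Complex.log (1 + z) + -Complex.log (1 - z)).im / 2 =
      (Complex.arg (1 + z) - Complex.arg (1 - z)) / 2 := by
    simp [Complex.log_im, sub_eq_add_neg]
  rw [e] at s2
  have inj : Function.Injective (fun j : ℕ => 2 * j + 1) := fun a b h => by simpa using h
  rw [← inj.hasSum_iff] at s2
  · refine s2.congr_fun ?_
    intro j
    have hzp : z ^ (2 * j + 1) = ((ρ ^ (2 * j + 1) : ℝ) : ℂ) *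
        Complex.exp (((2 * j + 1) * θ : ℝ) * Complex.I) := by
      rw [hz, mul_pow, ← Complex.exp_nat_mul]
      push_cast
      ring_nf
    have e3 : (-1 : ℂ) ^ (2 * j + 1 + 1) = 1 := by
      rw [show 2 * j + 1 + 1 = 2 * (j + 1) by ring, pow_mul]; simp
    simp only [Function.comp]
    rw [e3, one_mul, hzp, ← two_mul, mul_div_assoc']
    have e4 : (2 * (((ρ ^ (2 * j + 1) : ℝ) : ℂ) *
        Complex.exp (((2 * j + 1) * θ : ℝ) * Complex.I)) / ((2 * j + 1 : ℕ) : ℂ)) =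
        ((2 * ρ ^ (2 * j + 1) / (2 * j + 1) : ℝ) : ℂ) *
          Complex.exp (((2 * j + 1) * θ : ℝ) * Complex.I) := by
      push_cast; ring
    rw [e4, Complex.im_ofReal_mul, Complex.exp_ofReal_mul_I_im]
    ring
  · intro n hn
    have he : Even n := by
      by_contra ho
      rw [Nat.not_even_iff_odd] at ho
      obtain ⟨k, hk⟩ := ho
      exact hn ⟨k, hk.symm⟩
    have : (-1 : ℂ) ^ (n + 1) = -1 := he.add_one.neg_one_pow
    rw [this]
    simp [neg_div]

open Filter Topology in
theorem tendsto_arg_sub_arg {θ : ℝ} (h0 : 0 < θ) (h1 : θ ≤ Real.pi / 2) :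
    Tendsto (fun ρ : ℝ => (Complex.arg (1 + ρ * Complex.exp (θ * Complex.I)) -
        Complex.arg (1 - ρ * Complex.exp (θ * Complex.I))) / 2) (𝓝 1) (𝓝 (Real.pi / 4)) := by
  have hpi := Real.pi_pos
  have hc : 0 < Real.cos (θ / 2) := Real.cos_pos_of_mem_Ioo ⟨by linarith, by linarith⟩
  have hs : 0 < Real.sin (θ / 2) := Real.sin_pos_of_pos_of_lt_pi (by linarith) (by linarith)
  have eθ : θ = 2 * (θ / 2) := by ring
  have c2 : Real.cos θ = 1 - 2 * Real.sin (θ / 2) ^ 2 := by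
    have := Real.cos_sq_add_sin_sq (θ / 2)
    have h := Real.cos_two_mul (θ / 2)
    rw [← eθ] at h
    linarith
  have c3 : Real.cos θ = 2 * Real.cos (θ / 2) ^ 2 - 1 := by
    have h := Real.cos_two_mul (θ / 2)
    rwa [← eθ] at h
  have s2 : Real.sin θ = 2 * Real.sin (θ / 2) * Real.cos (θ / 2) := by
    have h := Real.sin_two_mul (θ / 2)
    rwa [← eθ] at h
  have a1 : Complex.arg (1 + Complex.exp (θ * Complex.I)) = θ / 2 := by
    have : 1 + Complex.exp (θ * Complex.I) = ((2 * Real.cos (θ / 2) : ℝ) : ℂ) *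
        (Complex.cos (θ / 2 : ℝ) + Complex.sin (θ / 2 : ℝ) * Complex.I) := by
      rw [Complex.exp_mul_I, ← Complex.ofReal_cos, ← Complex.ofReal_sin, ← Complex.ofReal_cos,
        ← Complex.ofReal_sin, c3, s2]
      push_cast; ring
    rw [this, Complex.arg_mul_cos_add_sin_mul_I (by positivity) ⟨by linarith, by linarith⟩]
  have a2 : Complex.arg (1 - Complex.exp (θ * Complex.I)) = θ / 2 - Real.pi / 2 := by
    have : 1 - Complex.exp (θ * Complex.I) = ((2 * Real.sin (θ / 2) : ℝ) : ℂ) *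
        (Complex.cos (θ / 2 - Real.pi / 2 : ℝ) +
          Complex.sin (θ / 2 - Real.pi / 2 : ℝ) * Complex.I) := by
      rw [Complex.exp_mul_I, ← Complex.ofReal_cos, ← Complex.ofReal_sin, ← Complex.ofReal_cos,
        ← Complex.ofReal_sin, c2, s2, Real.cos_sub_pi_div_two, Real.sin_sub_pi_div_two]
      push_cast; ring
    rw [this, Complex.arg_mul_cos_add_sin_mul_I (by positivity) ⟨by linarith, by linarith⟩]
  have m1 : (1 + ((1 : ℝ) : ℂ) * Complex.exp (θ * Complex.I)) ∈ Complex.slitPlane := by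
    left
    simp only [Complex.ofReal_one, one_mul, Complex.add_re, Complex.one_re,
      Complex.exp_ofReal_mul_I_re]
    rw [c3]; nlinarith [sq_pos_of_pos hc]
  have m2 : (1 - ((1 : ℝ) : ℂ) * Complex.exp (θ * Complex.I)) ∈ Complex.slitPlane := by
    left
    simp only [Complex.ofReal_one, one_mul, Complex.sub_re, Complex.one_re,
      Complex.exp_ofReal_mul_I_re]
    rw [c2]; nlinarith [sq_pos_of_pos hs]
  have t1 : Tendsto (fun ρ : ℝ => 1 + (ρ : ℂ) * Complex.exp (θ * Complex.I)) (𝓝 1)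
      (𝓝 (1 + ((1 : ℝ) : ℂ) * Complex.exp (θ * Complex.I))) :=
    Continuous.tendsto (by fun_prop) 1
  have t2 : Tendsto (fun ρ : ℝ => 1 - (ρ : ℂ) * Complex.exp (θ * Complex.I)) (𝓝 1)
      (𝓝 (1 - ((1 : ℝ) : ℂ) * Complex.exp (θ * Complex.I))) :=
    Continuous.tendsto (by fun_prop) 1
  have := (((Complex.continuousAt_arg m1).tendsto.comp t1).sub
    ((Complex.continuousAt_arg m2).tendsto.comp t2)).div_const 2
  simp only [Complex.ofReal_one, one_mul, a1, a2] at this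
  have e : (θ / 2 - (θ / 2 - Real.pi / 2)) / 2 = Real.pi / 4 := by ring
  rwa [e] at this

/-- The sine moments `∫₀^{π/2} sin^p θ sin((2j+1)θ) dθ`. -/
noncomputable def sinMoment (p : ℝ) (j : ℕ) : ℝ :=
  ∫ θ in (0 : ℝ)..(Real.pi / 2), Real.sin θ ^ p * Real.sin ((2 * j + 1) * θ)

theorem sinMoment_zero {p : ℝ} : sinMoment p 0 = sinIntegral (p + 1) := by
  refine intervalIntegral.integral_congr_Ioo_of_le (by positivity) ?_
  intro x hx
  have hs := Real.sin_pos_of_pos_of_lt_pi hx.1 (by linarith [hx.2, Real.pi_pos])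
  simp [Real.rpow_add_one hs.ne']

theorem sinMoment_succ {p : ℝ} (hp : -1 < p) (j : ℕ) :
    (2 * j + 3 + p) * sinMoment p (j + 1) = (2 * j + 1 - p) * sinMoment p j := by
  have h := integral_deriv_sin_rpow_mul hp (g := fun x => Real.sin ((2 * j + 2) * x))
    (g' := fun x => Real.cos ((2 * j + 2) * x) * (2 * j + 2))
    (fun x => by simpa using ((hasDerivAt_id x).const_mul ((2 : ℝ) * j + 2)).sin)
    (by fun_prop) (by
      have : (2 * (j : ℝ) + 2) * (Real.pi / 2) = ((j + 1 : ℕ) : ℝ) * Real.pi := by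
        push_cast; ring
      simp only [this, Real.sin_nat_mul_pi])
  have h2 : ∫ θ in (0 : ℝ)..(Real.pi / 2),
      Real.sin θ ^ p * ((p + 1) * Real.cos θ * Real.sin ((2 * j + 2) * θ) +
        Real.sin θ * (Real.cos ((2 * j + 2) * θ) * (2 * j + 2))) =
      ∫ θ in (0 : ℝ)..(Real.pi / 2),
        ((2 * j + 3 + p) / 2 * (Real.sin θ ^ p * Real.sin ((2 * (j + 1 : ℕ) + 1) * θ)) -
        (2 * j + 1 - p) / 2 * (Real.sin θ ^ p * Real.sin ((2 * j + 1) * θ))) := by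
    refine intervalIntegral.integral_congr ?_
    intro x _
    have e1 : (2 * ((j + 1 : ℕ) : ℝ) + 1) * x = (2 * j + 2) * x + x := by push_cast; ring
    have e2 : (2 * (j : ℝ) + 1) * x = (2 * j + 2) * x - x := by ring
    simp only
    rw [e1, e2, Real.sin_add, Real.sin_sub]
    ring
  rw [h2, intervalIntegral.integral_sub
    ((intervalIntegrable_sin_rpow_mul hp (by fun_prop)).const_mul _)
    ((intervalIntegrable_sin_rpow_mul hp (by fun_prop)).const_mul _),
    intervalIntegral.integral_const_mul, intervalIntegral.integral_const_mul] at h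
  unfold sinMoment
  linarith

theorem sinMoment_eq {v : ℝ} (hv : |v| < 1) (j : ℕ) :
    sinMoment (-v) j = (1 - v) * sinIntegral (-v + 1) *
      (1 / (2 * j + 1 - v) * ∏ i ∈ Finset.range j, (2 * i + 1 + v) / (2 * i + 1 - v)) := by
  obtain ⟨hv1, hv2⟩ := abs_lt.1 hv
  induction j with
  | zero =>
    have : (1 - v) ≠ 0 := by linarith
    simp [sinMoment_zero]
    field_simp
  | succ j ih =>
    have hj : (0 : ℝ) ≤ j := by positivity
    have h := sinMoment_succ (p := -v) (by linarith) j
    have h1 : 2 * (j : ℝ) + 3 + -v ≠ 0 := by linarith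
    have h2 : 2 * (j : ℝ) + 1 - v ≠ 0 := by linarith
    rw [← mul_right_inj' h1, h, ih, Finset.prod_range_succ]
    push_cast
    have h3 : 2 * ((j : ℝ) + 1) + 1 - v ≠ 0 := by linarith
    field_simp
    ring

theorem sinMoment_nonneg {v : ℝ} (hv : |v| < 1) (j : ℕ) : 0 ≤ sinMoment (-v) j := by
  obtain ⟨hv1, hv2⟩ := abs_lt.1 hv
  rw [sinMoment_eq hv]
  have := sinIntegral_pos (p := -v + 1) (by linarith)
  have h1 : 0 ≤ ∏ i ∈ Finset.range j, (2 * (i : ℝ) + 1 + v) / (2 * i + 1 - v) := by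
    refine Finset.prod_nonneg fun i _ => ?_
    have hi : (0 : ℝ) ≤ i := by positivity
    exact div_nonneg (by linarith) (by linarith)
  have hj : (0 : ℝ) ≤ j := by positivity
  have h2 : 0 < 2 * (j : ℝ) + 1 - v := by linarith
  have h3 : 0 < 1 - v := by linarith
  positivity

theorem measurable_arg_sub_arg (ρ : ℝ) :
    Measurable (fun θ : ℝ => (Complex.arg (1 + ρ * Complex.exp (θ * Complex.I)) -
        Complex.arg (1 - ρ * Complex.exp (θ * Complex.I))) / 2) := by
  have h1 : Measurable (fun θ : ℝ => 1 + (ρ : ℂ) * Complex.exp (θ * Complex.I)) :=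
    Continuous.measurable (by fun_prop)
  have h2 : Measurable (fun θ : ℝ => 1 - (ρ : ℂ) * Complex.exp (θ * Complex.I)) :=
    Continuous.measurable (by fun_prop)
  exact ((Complex.measurable_arg.comp h1).sub (Complex.measurable_arg.comp h2)).div_const 2

theorem abs_arg_sub_arg_le (z w : ℂ) : |(Complex.arg z - Complex.arg w) / 2| ≤ Real.pi := by
  have h1 := abs_le.1 (Complex.abs_arg_le_pi z)
  have h2 := abs_le.1 (Complex.abs_arg_le_pi w)
  exact abs_le.2 ⟨by linarith [h1.1, h2.2], by linarith [h1.2, h2.1]⟩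

open MeasureTheory in
theorem hasSum_sinMoment_mul_pow {p ρ : ℝ} (hp : -1 < p) (h0 : 0 ≤ ρ) (h1 : ρ < 1) :
    HasSum (fun j : ℕ => ρ ^ (2 * j + 1) / (2 * j + 1) * sinMoment p j)
      (∫ θ in (0 : ℝ)..(Real.pi / 2), Real.sin θ ^ p *
        ((Complex.arg (1 + ρ * Complex.exp (θ * Complex.I)) -
          Complex.arg (1 - ρ * Complex.exp (θ * Complex.I))) / 2)) := by
  have key := intervalIntegral.hasSum_integral_of_dominated_convergence (μ := volume)
    (a := 0) (b := Real.pi / 2)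
    (F := fun (j : ℕ) (θ : ℝ) => Real.sin θ ^ p *
      (ρ ^ (2 * j + 1) / (2 * j + 1) * Real.sin ((2 * j + 1) * θ)))
    (f := fun θ : ℝ => Real.sin θ ^ p *
        ((Complex.arg (1 + ρ * Complex.exp (θ * Complex.I)) -
          Complex.arg (1 - ρ * Complex.exp (θ * Complex.I))) / 2))
    (fun j θ => ρ ^ j * |Real.sin θ ^ p|) ?_ ?_ ?_ ?_ ?_
  · refine key.congr_fun fun j => ?_
    unfold sinMoment
    rw [← intervalIntegral.integral_const_mul]
    congr 1; ext θ; ring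
  · intro j
    have := (intervalIntegrable_sin_rpow_mul hp (h := fun θ =>
      (ρ ^ (2 * j + 1) / (2 * j + 1) * Real.sin ((2 * j + 1) * θ))) (by fun_prop))
    exact this.def'.aestronglyMeasurable
  · intro j
    refine ae_of_all _ fun θ _ => ?_
    rw [norm_mul, mul_comm, Real.norm_eq_abs, Real.norm_eq_abs]
    refine mul_le_mul_of_nonneg_right ?_ (abs_nonneg _)
    rw [abs_mul, abs_of_nonneg (by positivity)]
    have a1 : ρ ^ (2 * j + 1) / (2 * j + 1) ≤ ρ ^ j := by
      rw [div_le_iff₀ (by positivity)]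
      have b1 : ρ ^ (2 * j + 1) ≤ ρ ^ j := pow_le_pow_of_le_one h0 h1.le (by omega)
      have b2 : 0 ≤ ρ ^ j := by positivity
      have b3 : (0 : ℝ) ≤ j := by positivity
      nlinarith [mul_nonneg b2 b3]
    calc _ ≤ ρ ^ (2 * j + 1) / (2 * j + 1) * 1 :=
          mul_le_mul_of_nonneg_left (Real.abs_sin_le_one _) (by positivity)
      _ ≤ _ := by rw [mul_one]; exact a1
  · exact ae_of_all _ fun θ _ => (summable_geometric_of_lt_one h0 h1).mul_right _
  · simp_rw [tsum_mul_right]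
    exact (intervalIntegrable_sin_rpow hp).abs.const_mul _
  · exact ae_of_all _ fun θ _ => (hasSum_rpow_mul_sin_div h0 h1 θ).mul_left _

open Filter Topology MeasureTheory in
theorem hasSum_sinMoment_div {v : ℝ} (hv : |v| < 1) :
    HasSum (fun j : ℕ => sinMoment (-v) j / (2 * j + 1))
      (Real.pi / 4 * sinIntegral (-v)) := by
  obtain ⟨hv1, hv2⟩ := abs_lt.1 hv
  have hp : -1 < -v := by linarith
  set I : ℝ → ℝ := fun ρ => ∫ θ in (0 : ℝ)..(Real.pi / 2), Real.sin θ ^ (-v) *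
        ((Complex.arg (1 + ρ * Complex.exp (θ * Complex.I)) -
          Complex.arg (1 - ρ * Complex.exp (θ * Complex.I))) / 2) with hI
  have hlim : Tendsto I (𝓝[<] 1) (𝓝 (Real.pi / 4 * sinIntegral (-v))) := by
    have e : Real.pi / 4 * sinIntegral (-v) =
        ∫ θ in (0 : ℝ)..(Real.pi / 2), Real.sin θ ^ (-v) * (Real.pi / 4) := by
      rw [intervalIntegral.integral_mul_const, mul_comm]; rfl
    rw [e]
    refine intervalIntegral.tendsto_integral_filter_of_dominated_convergence
      (fun θ => |Real.sin θ ^ (-v)| * Real.pi) ?_ ?_ ?_ ?_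
    · refine Eventually.of_forall fun ρ => ?_
      exact (intervalIntegrable_sin_rpow hp).def'.aestronglyMeasurable.mul
        (measurable_arg_sub_arg ρ).aestronglyMeasurable
    · refine Eventually.of_forall fun ρ => ae_of_all _ fun θ _ => ?_
      rw [Real.norm_eq_abs, abs_mul]
      exact mul_le_mul_of_nonneg_left (abs_arg_sub_arg_le _ _) (abs_nonneg _)
    · exact (intervalIntegrable_sin_rpow hp).abs.mul_const _
    · refine ae_of_all _ fun θ hθ => ?_
      rw [Set.uIoc_of_le (by positivity)] at hθ
      exact ((tendsto_arg_sub_arg hθ.1 hθ.2).mono_left nhdsWithin_le_nhds).const_mul _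
  have hev : ∀ᶠ ρ : ℝ in 𝓝[<] 1, 0 ≤ ρ ∧ ρ < 1 := by
    have h1 : ∀ᶠ ρ : ℝ in 𝓝[<] 1, (0 : ℝ) ≤ ρ :=
      (eventually_ge_nhds (by norm_num)).filter_mono nhdsWithin_le_nhds
    exact h1.and self_mem_nhdsWithin
  have hnn : ∀ j : ℕ, 0 ≤ sinMoment (-v) j / (2 * j + 1) := fun j =>
    div_nonneg (sinMoment_nonneg hv j) (by positivity)
  have hpt : ∀ j : ℕ, Tendsto (fun ρ : ℝ => ρ ^ (2 * j + 1) / (2 * j + 1) * sinMoment (-v) j)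
      (𝓝[<] 1) (𝓝 (sinMoment (-v) j / (2 * j + 1))) := by
    intro j
    have : Tendsto (fun ρ : ℝ => ρ ^ (2 * j + 1) / (2 * j + 1) * sinMoment (-v) j)
      (𝓝 1) (𝓝 ((1 : ℝ) ^ (2 * j + 1) / (2 * j + 1) * sinMoment (-v) j)) :=
      Continuous.tendsto (by fun_prop) 1
    refine (this.mono_left nhdsWithin_le_nhds).congr' (by rfl) |>.trans (le_of_eq ?_)
    rw [one_pow]; congr 1; ring
  have hsum : Summable (fun j : ℕ => sinMoment (-v) j / (2 * j + 1)) := by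
    refine summable_of_sum_range_le (c := Real.pi / 4 * sinIntegral (-v)) hnn fun n => ?_
    refine le_of_tendsto_of_tendsto (tendsto_finsetSum (Finset.range n) fun j _ => hpt j) hlim ?_
    filter_upwards [hev] with ρ hρ
    have hs := hasSum_sinMoment_mul_pow hp hρ.1 hρ.2
    refine sum_le_hasSum _ (fun j _ => ?_) hs
    exact mul_nonneg (div_nonneg (pow_nonneg hρ.1 _) (by positivity)) (sinMoment_nonneg hv j)
  have hd := tendsto_tsum_of_dominated_convergence (𝓕 := 𝓝[<] (1 : ℝ)) hsum hpt (by
    filter_upwards [hev] with ρ hρ j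
    have a1 := sinMoment_nonneg hv j
    have a2 : 0 ≤ ρ ^ (2 * j + 1) := pow_nonneg hρ.1 _
    rw [Real.norm_of_nonneg (by positivity), div_mul_eq_mul_div]
    gcongr
    exact mul_le_of_le_one_left a1 (pow_le_one₀ hρ.1 hρ.2.le))
  have : Tendsto I (𝓝[<] 1) (𝓝 (∑' j : ℕ, sinMoment (-v) j / (2 * j + 1))) := by
    refine hd.congr' ?_
    filter_upwards [hev] with ρ hρ
    exact (hasSum_sinMoment_mul_pow hp hρ.1 hρ.2).tsum_eq
  rw [← tendsto_nhds_unique this hlim]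
  exact hsum.hasSum

/-- A special case of Dixon's summation of a well-poised `₃F₂`. -/
theorem hasSum_wellPoised {v : ℝ} (hv : |v| < 1) :
    HasSum (fun j : ℕ => 1 / ((2 * j + 1) * (2 * j + 1 - v)) *
      ∏ i ∈ Finset.range j, (2 * i + 1 + v) / (2 * i + 1 - v))
      (sinIntegral (-v) ^ 2 / 2) := by
  obtain ⟨hv1, hv2⟩ := abs_lt.1 hv
  have h := hasSum_sinMoment_div hv
  have hJ := sinIntegral_pos (p := -v + 1) (by linarith)
  have hm := sinIntegral_mul_sinIntegral_add_one (p := -v) (by linarith) (by linarith)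
  have hv' : 1 - v ≠ 0 := by linarith
  have hC : (1 - v) * sinIntegral (-v + 1) ≠ 0 := mul_ne_zero hv' hJ.ne'
  have h2 := h.div_const ((1 - v) * sinIntegral (-v + 1))
  have e : Real.pi / 4 * sinIntegral (-v) / ((1 - v) * sinIntegral (-v + 1)) =
      sinIntegral (-v) ^ 2 / 2 := by
    rw [div_eq_iff hC]
    linear_combination (-sinIntegral (-v) / 2) * hm
  rw [e] at h2
  refine h2.congr_fun fun j => ?_
  have hj : (0 : ℝ) ≤ j := by positivity
  have : 2 * (j : ℝ) + 1 - v ≠ 0 := by linarith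
  rw [sinMoment_eq hv]
  field_simp


open Filter Topology in
theorem tendsto_prod_one_sub_div_ratio {v : ℝ} (hv : |v| < 1) :
    Tendsto (fun M : ℕ => (∏ i ∈ Finset.range (2 * M), (1 - v / (i + 1))) /
      ∏ i ∈ Finset.range M, (1 - v / (i + 1))) atTop (𝓝 ((2 : ℝ) ^ (-v))) := by
  obtain ⟨hv1, hv2⟩ := abs_lt.1 hv
  have hprod : ∀ n : ℕ, ∏ j ∈ Finset.range n, (1 - v + j) =
      n.factorial * ∏ i ∈ Finset.range n, (1 - v / (i + 1)) := by
    intro n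
    rw [← Finset.prod_range_add_one_eq_factorial]
    push_cast
    rw [← Finset.prod_mul_distrib]
    refine Finset.prod_congr rfl fun i _ => ?_
    have : (i : ℝ) + 1 ≠ 0 := by positivity
    field_simp
    ring
  have hpos : ∀ n : ℕ, 0 < ∏ i ∈ Finset.range n, (1 - v / (i + 1)) := by
    intro n
    refine Finset.prod_pos fun i _ => ?_
    have hi : (0 : ℝ) ≤ i := by positivity
    rw [sub_pos, div_lt_one (by positivity)]
    linarith
  have hG : ∀ n : ℕ, 1 ≤ n → Real.GammaSeq (1 - v) n =
      (n : ℝ) ^ (1 - v) / ((n + 1) * ∏ i ∈ Finset.range (n + 1), (1 - v / (i + 1))) := by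
    intro n _
    rw [Real.GammaSeq, hprod, Nat.factorial_succ]
    have := hpos (n + 1)
    have h2 : (n.factorial : ℝ) ≠ 0 := by positivity
    push_cast
    field_simp
  have hΓ : Real.Gamma (1 - v) ≠ 0 := (Real.Gamma_pos_of_pos (by linarith)).ne'
  have t1 := Real.GammaSeq_tendsto_Gamma (1 - v)
  have t2 : Tendsto (fun n : ℕ => Real.GammaSeq (1 - v) (2 * n + 1)) atTop
      (𝓝 (Real.Gamma (1 - v))) :=
    t1.comp (tendsto_atTop_mono (fun n => by omega : ∀ n : ℕ, n ≤ 2 * n + 1) tendsto_id)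
  have t3 := t1.div t2 hΓ
  rw [div_self hΓ] at t3
  have t4 : Tendsto (fun n : ℕ => ((2 * n + 1 : ℝ) / n) ^ (1 - v) / 2) atTop
      (𝓝 ((2 : ℝ) ^ (1 - v) / 2)) := by
    have h := tendsto_add_mul_div_add_mul_atTop_nhds (𝕜 := ℝ) 1 0 2 (d := 1) one_ne_zero
    have h' : Tendsto (fun n : ℕ => ((2 * n + 1 : ℝ) / n)) atTop (𝓝 2) := by
      refine Tendsto.congr (fun M => ?_) (by simpa using h)
      congr 1; ring
    exact (h'.rpow_const (Or.inl two_ne_zero)).div_const 2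
  have t5 := t4.mul t3
  have e : (2 : ℝ) ^ (1 - v) / 2 * 1 = 2 ^ (-v) := by
    rw [sub_eq_add_neg, Real.rpow_add two_pos, Real.rpow_one]; ring
  rw [e] at t5
  rw [← tendsto_add_atTop_iff_nat 1]
  refine t5.congr' ?_
  filter_upwards [eventually_ge_atTop 1] with n hn
  have hn' : (0 : ℝ) < n := by exact_mod_cast hn
  rw [Pi.div_apply, hG n hn, hG (2 * n + 1) (by omega)]
  have p1 := hpos (n + 1)
  have p2 := hpos (2 * n + 1 + 1)
  have e2 : 2 * (n + 1) = 2 * n + 1 + 1 := by ring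
  rw [e2, Real.div_rpow (by positivity) hn'.le]
  push_cast
  have r1 : 0 < (n : ℝ) ^ (1 - v) := by positivity
  have r2 : 0 < (2 * n + 1 : ℝ) ^ (1 - v) := by positivity
  field_simp
  ring

theorem prod_range_two_mul_one_sub_div (v : ℝ) (M : ℕ) :
    ∏ i ∈ Finset.range (2 * M), (1 - v / (i + 1)) =
      (∏ i ∈ Finset.range M, (1 - v / (2 * i + 2))) *
        ∏ i ∈ Finset.range M, (1 - v / (2 * i + 1)) := by
  induction M with
  | zero => simp
  | succ M ih =>
    rw [show 2 * (M + 1) = 2 * M + 1 + 1 by ring, Finset.prod_range_succ, Finset.prod_range_succ,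
      ih, Finset.prod_range_succ, Finset.prod_range_succ]
    push_cast
    ring_nf

theorem hasSum_pow_div_neg_log {x : ℝ} (hx : |x| < 1) :
    HasSum (fun n : ℕ => x ^ n / n) (-Real.log (1 - x)) := by
  have := (hasSum_nat_add_iff (f := fun n : ℕ => x ^ n / n) 1).1
    (by simpa using Real.hasSum_pow_div_log_of_abs_lt_one hx)
  simpa using this

theorem tsum_odd_inv_pow {n : ℕ} (hn : 2 ≤ n) :
    (∑' j : ℕ, ((2 * j + 1 : ℝ) ^ n)⁻¹) = (1 - 1 / 2 ^ n) * ∑' m : ℕ, ((m : ℝ) ^ n)⁻¹ := by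
  have hs : Summable (fun m : ℕ => ((m : ℝ) ^ n)⁻¹) := Real.summable_nat_pow_inv.2 hn
  have h := tsum_even_add_odd (f := fun m : ℕ => ((m : ℝ) ^ n)⁻¹)
    (hs.comp_injective (i := fun k => 2 * k) fun a b h => by simpa using h)
    (hs.comp_injective (i := fun k => 2 * k + 1) fun a b h => by simpa using h)
  have e : (∑' k : ℕ, (((2 * k : ℕ) : ℝ) ^ n)⁻¹) = 1 / 2 ^ n * ∑' m : ℕ, ((m : ℝ) ^ n)⁻¹ := by
    rw [← tsum_mul_left]
    congr 1; ext k
    push_cast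
    rw [mul_pow, mul_inv, one_div]
  rw [e] at h
  push_cast at h
  linarith

theorem summable_logCoeff {v : ℝ} (hv : |v| < 1) :
    Summable (fun q : ℕ × ℕ => (2 - 4 / (2 : ℝ) ^ q.1) / q.1 * (v / q.2) ^ q.1) := by
  have hs : Summable (fun q : ℕ × ℕ => (2 * |v| ^ q.1) * ((q.2 : ℝ) ^ 2)⁻¹) := by
    refine Summable.mul_of_nonneg ((summable_geometric_of_lt_one (abs_nonneg v) hv).mul_left 2)
      (Real.summable_nat_pow_inv.2 (by norm_num)) (fun n => ?_) (fun m => ?_)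
    · simp only [Pi.zero_apply]; positivity
    · simp only [Pi.zero_apply]; positivity
  refine Summable.of_norm_bounded hs ?_
  rintro ⟨n, m⟩
  simp only
  rcases Nat.lt_or_ge n 2 with hn | hn
  · have : (2 - 4 / (2 : ℝ) ^ n) / n = 0 := by
      interval_cases n <;> norm_num
    rw [this, zero_mul, norm_zero]
    positivity
  · rw [norm_mul, div_pow, norm_div, norm_div, norm_pow, Real.norm_eq_abs v, norm_pow]
    have a1 : ‖(2 - 4 / (2 : ℝ) ^ n)‖ ≤ 2 := by
      have h4 : (4 : ℝ) ≤ 2 ^ n := by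
        calc (4 : ℝ) = 2 ^ 2 := by norm_num
          _ ≤ 2 ^ n := pow_le_pow_right₀ (by norm_num) hn
      have : 4 / (2 : ℝ) ^ n ≤ 1 := (div_le_one (by positivity)).2 h4
      have h0 : 0 ≤ 4 / (2 : ℝ) ^ n := by positivity
      rw [Real.norm_eq_abs, abs_le]
      constructor <;> linarith
    have a2 : ‖(2 - 4 / (2 : ℝ) ^ n)‖ / ‖(n : ℝ)‖ ≤ 2 := by
      have : (1 : ℝ) ≤ ‖(n : ℝ)‖ := by
        rw [Real.norm_natCast]; exact_mod_cast (by omega : 1 ≤ n)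
      exact (div_le_self (norm_nonneg _) this).trans a1
    have a3 : |v| ^ n / ‖(m : ℝ)‖ ^ n ≤ |v| ^ n * ((m : ℝ) ^ 2)⁻¹ := by
      rw [div_eq_mul_inv, Real.norm_natCast]
      refine mul_le_mul_of_nonneg_left ?_ (by positivity)
      rcases Nat.eq_zero_or_pos m with h0 | h0
      · subst h0; simp [zero_pow (by omega : n ≠ 0)]
      · have : (1 : ℝ) ≤ m := by exact_mod_cast h0
        gcongr
    calc _ ≤ 2 * (|v| ^ n * ((m : ℝ) ^ 2)⁻¹) := by gcongr
      _ = _ := by ring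

theorem hasSum_logCoeff {v : ℝ} (hv : |v| < 1) (m : ℕ) :
    HasSum (fun n : ℕ => (2 - 4 / (2 : ℝ) ^ n) / n * (v / m) ^ n)
      (4 * Real.log (1 - v / (2 * m)) - 2 * Real.log (1 - v / m)) := by
  have h1 : |v / m| < 1 := by
    rcases Nat.eq_zero_or_pos m with h0 | h0
    · subst h0; simp
    · have : (1 : ℝ) ≤ m := by exact_mod_cast h0
      rw [abs_div, Nat.abs_cast, div_lt_one (by positivity)]
      linarith
  have h2 : |v / (2 * m)| < 1 := by
    have : v / (2 * m) = v / m / 2 := by ring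
    rw [this, abs_div, abs_two]
    linarith [abs_nonneg (v / m)]
  have h := ((hasSum_pow_div_neg_log h1).mul_left 2).sub ((hasSum_pow_div_neg_log h2).mul_left 4)
  have e : 2 * -Real.log (1 - v / m) - 4 * -Real.log (1 - v / (2 * m)) =
      4 * Real.log (1 - v / (2 * m)) - 2 * Real.log (1 - v / m) := by ring
  rw [e] at h
  refine h.congr_fun fun n => ?_
  have : v / (2 * m) = v / m / 2 := by ring
  rw [this, div_pow (v / m) 2]
  ring

open Filter Topology in
/-- The exponential generating series of the classical t-values, as a squared Wallis product. -/
theorem exp_tsum_tvalue {v : ℝ} (hv : |v| < 1) :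
    Summable (fun n : ℕ => if 2 ≤ n then 4 * ((2 : ℝ) ^ (n - 1) - 1) *
      (∑' j : ℕ, ((2 * j + 1 : ℝ) ^ n)⁻¹) / (n * ((2 : ℝ) ^ n - 1)) * v ^ n else 0) ∧
    (2 : ℝ) ^ (2 * v) * Real.exp (∑' n : ℕ, if 2 ≤ n then 4 * ((2 : ℝ) ^ (n - 1) - 1) *
      (∑' j : ℕ, ((2 * j + 1 : ℝ) ^ n)⁻¹) / (n * ((2 : ℝ) ^ n - 1)) * v ^ n else 0) =
      (2 / Real.pi * sinIntegral (-v)) ^ 2 := by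
  obtain ⟨hv1, hv2⟩ := abs_lt.1 hv
  have hs := summable_logCoeff hv
  have hcoef : ∀ n : ℕ, (∑' m : ℕ, (2 - 4 / (2 : ℝ) ^ n) / n * (v / m) ^ n) =
      if 2 ≤ n then 4 * ((2 : ℝ) ^ (n - 1) - 1) *
      (∑' j : ℕ, ((2 * j + 1 : ℝ) ^ n)⁻¹) / (n * ((2 : ℝ) ^ n - 1)) * v ^ n else 0 := by
    intro n
    split_ifs with hn
    · rw [tsum_mul_left]
      simp_rw [div_pow, div_eq_mul_inv (v ^ n)]
      rw [tsum_mul_left, tsum_odd_inv_pow hn]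
      obtain ⟨k, rfl⟩ : ∃ k, n = k + 1 := ⟨n - 1, by omega⟩
      have h1 : (1 : ℝ) < 2 ^ (k + 1) := one_lt_pow₀ (by norm_num) (by omega)
      have h2 : (2 : ℝ) ^ (k + 1) - 1 ≠ 0 := by linarith
      rw [Nat.add_sub_cancel]
      field_simp
      rw [pow_succ]
      ring
    · have : (2 - 4 / (2 : ℝ) ^ n) / n = 0 := by
        have : n < 2 := by omega
        interval_cases n <;> norm_num
      simp [this]
  simp_rw [← hcoef]
  refine ⟨hs.prod, ?_⟩
  have hswap : HasSum (fun m : ℕ => 4 * Real.log (1 - v / (2 * m)) - 2 * Real.log (1 - v / m))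
      (∑' n : ℕ, ∑' m : ℕ, (2 - 4 / (2 : ℝ) ^ n) / n * (v / m) ^ n) := by
    rw [← hs.tsum_prod]
    have := (Equiv.prodComm ℕ ℕ).hasSum_iff.2 hs.hasSum
    exact this.prod_fiberwise fun m => hasSum_logCoeff hv m
  set S := ∑' n : ℕ, ∑' m : ℕ, (2 - 4 / (2 : ℝ) ^ n) / n * (v / m) ^ n
  have hexp : Tendsto (fun M : ℕ => ∏ i ∈ Finset.range M,
      ((1 - v / (2 * i + 2)) ^ 2 / (1 - v / (i + 1))) ^ 2) atTop (𝓝 (Real.exp S)) := by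
    have h1 := (Real.continuous_exp.tendsto S).comp
      (hswap.tendsto_sum_nat.comp (tendsto_add_atTop_nat 1))
    refine h1.congr fun M => ?_
    simp only [Function.comp]
    rw [Finset.sum_range_succ']
    simp only [Nat.cast_zero, mul_zero, div_zero, sub_zero, Real.log_one, add_zero]
    rw [Real.exp_sum]
    refine Finset.prod_congr rfl fun i _ => ?_
    have hi : (0 : ℝ) ≤ i := by positivity
    have p1 : 0 < 1 - v / (i + 1) := by
      rw [sub_pos, div_lt_one (by positivity)]; linarith
    have p2 : 0 < 1 - v / (2 * i + 2) := by
      rw [sub_pos, div_lt_one (by positivity)]; linarith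
    have e : 4 * Real.log (1 - v / (2 * ((i + 1 : ℕ) : ℝ))) -
        2 * Real.log (1 - v / ((i + 1 : ℕ) : ℝ)) =
        Real.log (((1 - v / (2 * i + 2)) ^ 2 / (1 - v / (i + 1))) ^ 2) := by
      rw [Real.log_pow, Real.log_div (by positivity) p1.ne', Real.log_pow]
      push_cast
      rw [mul_add, mul_one]
      ring
    rw [e, Real.exp_log (by positivity)]
  have h2 := ((tendsto_prod_sinIntegral hv).mul (tendsto_prod_one_sub_div_ratio hv)).pow 2
  have h3 := tendsto_nhds_unique hexp (h2.congr fun M => ?_)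
  · have e : (2 : ℝ) ^ (2 * v) * ((2 : ℝ) ^ (-v)) ^ 2 = 1 := by
      rw [← Real.rpow_mul_natCast (by norm_num), ← Real.rpow_add two_pos]
      push_cast
      ring_nf
      simp
    rw [h3, mul_pow]
    linear_combination (2 / Real.pi * sinIntegral (-v)) ^ 2 * e
  · rw [Finset.prod_pow, Finset.prod_div_distrib, Finset.prod_div_distrib, Finset.prod_pow,
      prod_range_two_mul_one_sub_div]
    have q1 : ∏ i ∈ Finset.range M, (1 - v / (2 * (i : ℝ) + 1)) ≠ 0 := by
      refine Finset.prod_ne_zero_iff.2 fun i _ => ?_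
      have hi : (0 : ℝ) ≤ i := by positivity
      have : 0 < 1 - v / (2 * (i : ℝ) + 1) := by
        rw [sub_pos, div_lt_one (by positivity)]; linarith
      exact this.ne'
    generalize ∏ i ∈ Finset.range M, (1 - v / (2 * (i : ℝ) + 1)) = A at q1 ⊢
    generalize ∏ i ∈ Finset.range M, (1 - v / (2 * (i : ℝ) + 2)) = B
    generalize ∏ i ∈ Finset.range M, (1 - v / ((i : ℝ) + 1)) = C
    field_simp

/-- The `j`-th positive integer congruent to `a` modulo `2a`, as a real number. -/
def oddMul (a j : ℕ) : ℝ := a * (2 * j + 1)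

/-- The multiple t-sum of level `2a` truncated to the first `M` admissible values. -/
noncomputable def truncSum (a : ℕ) : List ℕ → ℕ → ℝ
  | [], _ => 1
  | k :: l, M => ∑ m ∈ Finset.range M, (oddMul a m ^ k)⁻¹ * truncSum a l m

/-- The part of a multiple t-value of level `2a` whose largest summation variable is the `m`-th. -/
noncomputable def leadSum (a : ℕ) (p : List ℕ) (m : ℕ) : ℝ :=
  (oddMul a m ^ p.headI)⁻¹ * truncSum a p.tail m

/-- The interpolated tail sum with leading variable fixed to be the `m`-th. -/
noncomputable def interpTail (a : ℕ) (r : ℝ) : List ℕ → ℕ → ℝ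
  | [], _ => 1
  | k :: l, m => r * (oddMul a m ^ k)⁻¹ * interpTail a r l m +
      ∑ i ∈ Finset.range m, (oddMul a i ^ k)⁻¹ * interpTail a r l i

theorem oddMul_ge {a : ℕ} (ha : 1 ≤ a) (j : ℕ) : (j : ℝ) + 1 ≤ oddMul a j := by
  have h : (1 : ℝ) ≤ a := by exact_mod_cast ha
  have hj : (0 : ℝ) ≤ j := by positivity
  unfold oddMul
  nlinarith

theorem oddMul_pos {a : ℕ} (ha : 1 ≤ a) (j : ℕ) : 0 < oddMul a j :=
  lt_of_lt_of_le (by positivity) (oddMul_ge ha j)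

theorem truncSum_nonneg {a : ℕ} (ha : 1 ≤ a) (l : List ℕ) (m : ℕ) : 0 ≤ truncSum a l m := by
  induction l generalizing m with
  | nil => simp [truncSum]
  | cons k l ih =>
    refine Finset.sum_nonneg fun i _ => ?_
    have := oddMul_pos ha i
    have := ih i
    positivity

theorem interpTail_nonneg {a : ℕ} (ha : 1 ≤ a) {r : ℝ} (hr : 0 ≤ r) (l : List ℕ) (m : ℕ) :
    0 ≤ interpTail a r l m := by
  induction l generalizing m with
  | nil => simp [interpTail]
  | cons k l ih =>
    refine add_nonneg ?_ (Finset.sum_nonneg fun i _ => ?_)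
    · have := oddMul_pos ha m
      have := ih m
      positivity
    · have := oddMul_pos ha i
      have := ih i
      positivity

theorem abs_interpTail_le {a : ℕ} (ha : 1 ≤ a) (r : ℝ) (l : List ℕ) (m : ℕ) :
    |interpTail a r l m| ≤ interpTail a |r| l m := by
  induction l generalizing m with
  | nil => simp [interpTail]
  | cons k l ih =>
    refine (abs_add_le _ _).trans (add_le_add ?_ ((Finset.abs_sum_le_sum_abs _ _).trans
      (Finset.sum_le_sum fun i _ => ?_)))
    · have := oddMul_pos ha m
      rw [abs_mul, abs_mul, abs_of_pos (a := (oddMul a m ^ k)⁻¹) (by positivity)]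
      exact mul_le_mul_of_nonneg_left (ih m) (by positivity)
    · have := oddMul_pos ha i
      rw [abs_mul, abs_of_pos (a := (oddMul a i ^ k)⁻¹) (by positivity)]
      exact mul_le_mul_of_nonneg_left (ih i) (by positivity)

/-- Splitting off the largest entry of a strictly decreasing tuple. -/
def strictAntiEquiv (n : ℕ) (s : ℕ → Prop) (hs : ∀ i j, i < j → s j → s i) :
    {g : Fin (n + 1) → ℕ // StrictAnti g ∧ ∀ i, s (g i)} ≃
      Σ m : {m // s m}, {g : Fin n → ℕ // StrictAnti g ∧ ∀ i, g i ∈ Finset.range m} where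
  toFun g := ⟨⟨g.1 0, g.2.2 0⟩, ⟨fun i => g.1 i.succ,
    fun _ _ h => g.2.1 (Fin.succ_lt_succ_iff.2 h),
    fun i => Finset.mem_range.2 (g.2.1 (Fin.succ_pos i))⟩⟩
  invFun q := ⟨Fin.cons q.1.1 q.2.1, by
    intro i j h
    induction i using Fin.cases with
    | zero =>
      induction j using Fin.cases with
      | zero => exact absurd h (lt_irrefl _)
      | succ j => simpa using q.2.2.2 j
    | succ i =>
      induction j using Fin.cases with
      | zero => exact absurd h (by simp)
      | succ j => simpa using q.2.2.1 (Fin.succ_lt_succ_iff.1 h), by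
    intro i
    induction i using Fin.cases with
    | zero => simpa using q.1.2
    | succ i => simpa using hs _ _ (Finset.mem_range.1 (q.2.2.2 i)) q.1.2⟩
  left_inv g := by
    ext i
    induction i using Fin.cases with
    | zero => simp
    | succ i => simp
  right_inv q := by
    obtain ⟨⟨m, hm⟩, ⟨g, hg⟩⟩ := q
    rfl

theorem hasSum_strictAnti_cons {a : ℕ} (ha : 1 ≤ a) (k : ℕ) (l : List ℕ) (s : ℕ → Prop)
    (hs : ∀ i j, i < j → s j → s i)
    (hl : ∀ m, HasSum (fun g : {g : Fin l.length → ℕ // StrictAnti g ∧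
      ∀ i, g i ∈ Finset.range m} => ∏ i, (oddMul a (g.1 i) ^ l.get i)⁻¹) (truncSum a l m))
    {c : ℝ} (hc : HasSum (fun m : {m // s m} => (oddMul a m ^ k)⁻¹ * truncSum a l m) c) :
    HasSum (fun g : {g : Fin (k :: l).length → ℕ // StrictAnti g ∧ ∀ i, s (g i)} =>
      ∏ i, (oddMul a (g.1 i) ^ (k :: l).get i)⁻¹) c := by
  refine (Equiv.hasSum_iff (strictAntiEquiv l.length s hs).symm
    (f := fun g : {g : Fin (l.length + 1) → ℕ // StrictAnti g ∧ ∀ i, s (g i)} =>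
      ∏ i, (oddMul a (g.1 i) ^ (k :: l).get i)⁻¹)).1 ?_
  have hfib : ∀ m : {m // s m}, HasSum (fun g : {g : Fin l.length → ℕ // StrictAnti g ∧
      ∀ i, g i ∈ Finset.range m} => (oddMul a m ^ k)⁻¹ *
        ∏ i, (oddMul a (g.1 i) ^ l.get i)⁻¹) ((oddMul a m ^ k)⁻¹ * truncSum a l m) :=
    fun m => (hl m).mul_left _
  have key : HasSum (fun q : Σ m : {m // s m}, {g : Fin l.length → ℕ // StrictAnti g ∧
      ∀ i, g i ∈ Finset.range m} => (oddMul a q.1 ^ k)⁻¹ *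
        ∏ i, (oddMul a (q.2.1 i) ^ l.get i)⁻¹) c := by
    refine HasSum.sigma_of_hasSum hc hfib ?_
    rw [summable_sigma_of_nonneg]
    · refine ⟨fun m => (hfib m).summable, ?_⟩
      simp_rw [fun m => (hfib m).tsum_eq]
      exact hc.summable
    · intro q
      have := oddMul_pos ha q.1
      refine mul_nonneg (by positivity) (Finset.prod_nonneg fun i _ => ?_)
      have := oddMul_pos ha (q.2.1 i)
      positivity
  refine key.congr_fun fun q => ?_
  exact Fin.prod_univ_succ (n := l.length)
    (fun i => (oddMul a ((Fin.cons q.1.1 q.2.1 : Fin (l.length + 1) → ℕ) i) ^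
      (k :: l).get i)⁻¹)

theorem hasSum_truncSum {a : ℕ} (ha : 1 ≤ a) (l : List ℕ) (M : ℕ) :
    HasSum (fun g : {g : Fin l.length → ℕ // StrictAnti g ∧
      ∀ i, g i ∈ Finset.range M} => ∏ i, (oddMul a (g.1 i) ^ l.get i)⁻¹) (truncSum a l M) := by
  induction l generalizing M with
  | nil =>
    have : Unique {g : Fin ([] : List ℕ).length → ℕ // StrictAnti g ∧
      ∀ i, g i ∈ Finset.range M} :=
      { default := ⟨fun i => i.elim0, fun i => i.elim0, fun i => i.elim0⟩
        uniq := fun g => Subtype.ext (funext fun i => i.elim0) }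
    simp [truncSum]
  | cons k l ih =>
    refine hasSum_strictAnti_cons ha k l (· ∈ Finset.range M) ?_ ih ?_
    · intro i j h hj
      exact Finset.mem_range.2 (h.trans (Finset.mem_range.1 hj))
    · exact Finset.hasSum (Finset.range M) fun m => (oddMul a m ^ k)⁻¹ * truncSum a l m

theorem tv_cons {a : ℕ} (ha : 1 ≤ a) (k : ℕ) (l : List ℕ)
    (hs : Summable (leadSum a (k :: l))) :
    HasSum (leadSum a (k :: l)) (tv (2 * a) a (k :: l)) := by
  have h1 : HasSum (fun m : {m : ℕ // True} => (oddMul a m ^ k)⁻¹ * truncSum a l m)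
      (∑' m, leadSum a (k :: l) m) :=
    (Equiv.subtypeUnivEquiv (fun _ => trivial)).hasSum_iff.2 hs.hasSum
  have h2 := hasSum_strictAnti_cons ha k l (fun _ => True) (fun _ _ _ _ => trivial)
    (hasSum_truncSum ha l) h1
  let φ : {g : Fin (k :: l).length → ℕ // StrictAnti g ∧ ∀ _ : Fin (k :: l).length, True} →
      {f : Fin (k :: l).length → ℕ // StrictAnti f ∧
        ∀ i, 0 < f i ∧ f i % (2 * a) = a % (2 * a)} := fun g =>
    ⟨fun i => a * (2 * g.1 i + 1), fun i j h => by
      have := g.2.1 h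
      exact Nat.mul_lt_mul_of_pos_left (by omega) ha, fun i => ⟨by positivity, by
        have : a * (2 * g.1 i + 1) = a + 2 * a * g.1 i := by ring
        simp only [this, Nat.add_mul_mod_self_left]⟩⟩
  have hφ : Function.Bijective φ := by
    constructor
    · intro g g' h
      ext i
      have := congrFun (congrArg Subtype.val h) i
      have := Nat.eq_of_mul_eq_mul_left ha this
      omega
    · rintro ⟨f, hf, hf'⟩
      have hrep : ∀ i, f i = a * (2 * (f i / (2 * a)) + 1) := by
        intro i
        have e := Nat.div_add_mod (f i) (2 * a)
        rw [(hf' i).2, Nat.mod_eq_of_lt (by omega : a < 2 * a)] at e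
        conv_lhs => rw [← e]
        ring
      refine ⟨⟨fun i => f i / (2 * a), fun i j h => ?_, fun _ => trivial⟩, ?_⟩
      · have h3 := hf h
        rw [hrep i, hrep j] at h3
        have := Nat.lt_of_mul_lt_mul_left h3
        simp only
        omega
      · exact Subtype.ext (funext fun i => (hrep i).symm)
  have h3 : tv (2 * a) a (k :: l) = ∑' m, leadSum a (k :: l) m := by
    rw [tv, ← (Equiv.ofBijective φ hφ).tsum_eq]
    rw [← h2.tsum_eq]
    refine tsum_congr fun g => Finset.prod_congr rfl fun i _ => ?_
    simp only [Equiv.ofBijective_apply, φ, oddMul]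
    push_cast
    rfl
  rw [h3]
  exact hs.hasSum

theorem sum_sqrt_div_le (m : ℕ) :
    ∑ i ∈ Finset.range m, 1 / ((i : ℝ) + 1) * √((i : ℝ) + 1) ≤ 2 * √((m : ℝ) + 1) := by
  suffices h : ∑ i ∈ Finset.range m, 1 / ((i : ℝ) + 1) * √((i : ℝ) + 1) ≤ 2 * √(m : ℝ) from
    h.trans (by gcongr; linarith)
  induction m with
  | zero => simp
  | succ m ih =>
    rw [Finset.sum_range_succ]
    refine (add_le_add_left ih _).trans ?_
    push_cast
    have hm : (0 : ℝ) ≤ m := by positivity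
    have hs := Real.sq_sqrt hm
    have ht := Real.sq_sqrt (by linarith : (0 : ℝ) ≤ m + 1)
    have ht0 : 0 < √((m : ℝ) + 1) := Real.sqrt_pos.2 (by linarith)
    generalize √(m : ℝ) = s at *
    generalize √((m : ℝ) + 1) = t at *
    rw [← ht]
    have : 1 / t ^ 2 * t = 1 / t := by field_simp
    rw [this, ← le_sub_iff_add_le', div_le_iff₀ ht0]
    nlinarith [sq_nonneg (t - s)]

theorem summable_inv_sq_mul_sqrt :
    Summable (fun m : ℕ => (((m : ℝ) + 1) ^ 2)⁻¹ * √((m : ℝ) + 1)) := by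
  have h := (summable_nat_add_iff 1).2
    (Real.summable_nat_rpow_inv.2 (by norm_num : (1 : ℝ) < 3 / 2))
  refine h.congr fun m => ?_
  have hm : (0 : ℝ) < (m : ℝ) + 1 := by positivity
  push_cast
  rw [Real.sqrt_eq_rpow, ← Real.rpow_natCast, ← Real.rpow_neg hm.le, ← Real.rpow_neg hm.le,
    ← Real.rpow_add hm]
  norm_num

theorem inv_oddMul_pow_le {a : ℕ} (ha : 1 ≤ a) (j : ℕ) {k n : ℕ} (h : n ≤ k) :
    (oddMul a j ^ k)⁻¹ ≤ (((j : ℝ) + 1) ^ n)⁻¹ := by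
  have h1 := oddMul_ge ha j
  have hj : (0 : ℝ) ≤ j := by positivity
  refine inv_anti₀ (by positivity) ?_
  calc ((j : ℝ) + 1) ^ n ≤ ((j : ℝ) + 1) ^ k := pow_le_pow_right₀ (by linarith) h
    _ ≤ _ := by gcongr

theorem exists_truncSum_le {a : ℕ} (ha : 1 ≤ a) {l : List ℕ} (hl : ∀ i ∈ l, 1 ≤ i) :
    ∃ C : ℝ, 0 ≤ C ∧ ∀ m, truncSum a l m ≤ C * √((m : ℝ) + 1) := by
  induction l with
  | nil =>
    refine ⟨1, zero_le_one, fun m => ?_⟩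
    rw [truncSum, one_mul, Real.one_le_sqrt]
    have : (0 : ℝ) ≤ m := by positivity
    linarith
  | cons k l ih =>
    obtain ⟨C, hC, h⟩ := ih fun i hi => hl i (List.mem_cons_of_mem _ hi)
    refine ⟨2 * C, by positivity, fun m => ?_⟩
    rw [truncSum]
    calc _ ≤ ∑ i ∈ Finset.range m, C * (1 / ((i : ℝ) + 1) * √((i : ℝ) + 1)) := by
          refine Finset.sum_le_sum fun i _ => ?_
          have h1 := inv_oddMul_pow_le ha i (hl k List.mem_cons_self)
          rw [pow_one] at h1
          calc _ ≤ ((i : ℝ) + 1)⁻¹ * (C * √((i : ℝ) + 1)) :=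
                mul_le_mul h1 (h i) (truncSum_nonneg ha l i) (by positivity)
            _ = _ := by ring
      _ ≤ C * (2 * √((m : ℝ) + 1)) := by
          rw [← Finset.mul_sum]
          exact mul_le_mul_of_nonneg_left (sum_sqrt_div_le m) hC
      _ = _ := by ring

theorem summable_leadSum {a : ℕ} (ha : 1 ≤ a) {k : ℕ} {l : List ℕ} (hk : 2 ≤ k)
    (hl : ∀ i ∈ l, 1 ≤ i) : Summable (leadSum a (k :: l)) := by
  obtain ⟨C, hC, h⟩ := exists_truncSum_le ha hl
  refine Summable.of_nonneg_of_le (fun m => ?_) (fun m => ?_)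
    (summable_inv_sq_mul_sqrt.mul_left C)
  · have := oddMul_pos ha m
    exact mul_nonneg (by positivity) (truncSum_nonneg ha l m)
  · calc _ ≤ (((m : ℝ) + 1) ^ 2)⁻¹ * (C * √((m : ℝ) + 1)) :=
          mul_le_mul (inv_oddMul_pow_le ha m hk) (h m) (truncSum_nonneg ha l m) (by positivity)
      _ = _ := by ring

theorem mem_groupings_cons {x : ℕ} {l p : List ℕ} (hl : ∀ i ∈ l, 1 ≤ i)
    (hp : p ∈ groupings (x :: l)) :
    ∃ y q, p = y :: q ∧ x ≤ y ∧ (∀ i ∈ q, 1 ≤ i) ∧ q.length ≤ l.length := by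
  induction l generalizing x p with
  | nil =>
    rw [groupings, List.mem_singleton] at hp
    exact ⟨x, [], hp, le_rfl, by simp, le_rfl⟩
  | cons y l ih =>
    have hl' : ∀ i ∈ l, 1 ≤ i := fun i hi => hl i (List.mem_cons_of_mem _ hi)
    rw [groupings, List.mem_append, List.mem_map] at hp
    rcases hp with ⟨q, hq, rfl⟩ | hp
    · obtain ⟨z, q', rfl, h1, h2, h3⟩ := ih hl' hq
      refine ⟨x, z :: q', rfl, le_rfl, ?_, by simpa using h3⟩
      intro i hi
      rcases List.mem_cons.1 hi with rfl | hi
      · exact (hl y List.mem_cons_self).trans h1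
      · exact h2 i hi
    · obtain ⟨z, q', rfl, h1, h2, h3⟩ := ih hl' hp
      exact ⟨z, q', rfl, by omega, h2, by simp; omega⟩

theorem sum_groupings_leadSum (a : ℕ) (r : ℝ) (x : ℕ) (l : List ℕ)
    (hl : ∀ i ∈ l, 1 ≤ i) (m : ℕ) :
    ((groupings (x :: l)).map fun p => r ^ ((x :: l).length - p.length) * leadSum a p m).sum =
      (oddMul a m ^ x)⁻¹ * interpTail a r l m := by
  induction l generalizing x m with
  | nil => simp [groupings, leadSum, truncSum, interpTail]
  | cons y l ih =>
    have hl' : ∀ i ∈ l, 1 ≤ i := fun i hi => hl i (List.mem_cons_of_mem _ hi)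
    rw [groupings, List.map_append, List.sum_append, List.map_map, interpTail, mul_add, add_comm]
    congr 1
    · have e : ((groupings ((x + y) :: l)).map fun p =>
          r ^ ((x :: y :: l).length - p.length) * leadSum a p m) =
          (groupings ((x + y) :: l)).map fun p =>
          r * (r ^ (((x + y) :: l).length - p.length) * leadSum a p m) := by
        refine List.map_congr_left fun p hp => ?_
        obtain ⟨z, q, rfl, -, -, h3⟩ := mem_groupings_cons hl' hp
        have : (x :: y :: l).length - (z :: q).length =
            (((x + y) :: l).length - (z :: q).length) + 1 := by
          simp only [List.length_cons]; omega
        rw [this, pow_succ]; ring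
      rw [e, List.sum_map_mul_left, ih (x + y) hl' m, pow_add, mul_inv]
      ring
    · have e : (groupings (y :: l)).map ((fun p =>
          r ^ ((x :: y :: l).length - p.length) * leadSum a p m) ∘ fun p => x :: p) =
          (groupings (y :: l)).map fun p => (oddMul a m ^ x)⁻¹ *
            ∑ i ∈ Finset.range m, r ^ ((y :: l).length - p.length) * leadSum a p i := by
        refine List.map_congr_left fun p hp => ?_
        obtain ⟨z, q, rfl, -, -, h3⟩ := mem_groupings_cons hl' hp
        have : (x :: y :: l).length - (x :: z :: q).length =
            (y :: l).length - (z :: q).length := by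
          simp only [List.length_cons]; omega
        simp only [Function.comp, this, ← Finset.mul_sum]
        simp only [leadSum, List.headI_cons, List.tail_cons, truncSum]
        ring
      rw [e, List.sum_map_mul_left]
      congr 1
      rw [← Finset.sum_congr rfl fun i _ => ih y hl' i]
      generalize groupings (y :: l) = L
      induction L with
      | nil => simp
      | cons p L ihL => simp only [List.map_cons, List.sum_cons, ihL, Finset.sum_add_distrib]

theorem hasSum_list_sum {α : Type*} (L : List α) (f : α → ℕ → ℝ) (s : α → ℝ)
    (h : ∀ p ∈ L, HasSum (f p) (s p)) :
    HasSum (fun m => (L.map fun p => f p m).sum) (L.map s).sum := by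
  induction L with
  | nil => simp
  | cons p L ih =>
    simp only [List.map_cons, List.sum_cons]
    exact (h p List.mem_cons_self).add (ih fun q hq => h q (List.mem_cons_of_mem _ hq))

theorem hasSum_itv_cons {a : ℕ} (ha : 1 ≤ a) (r : ℝ) {k : ℕ} {l : List ℕ} (hk : 2 ≤ k)
    (hl : ∀ i ∈ l, 1 ≤ i) :
    HasSum (fun m => (oddMul a m ^ k)⁻¹ * interpTail a r l m) (itv (2 * a) a r (k :: l)) := by
  simp_rw [← sum_groupings_leadSum a r k l hl]
  refine hasSum_list_sum _ _ _ fun p hp => ?_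
  obtain ⟨z, q, rfl, h1, h2, -⟩ := mem_groupings_cons hl hp
  exact (tv_cons ha z q (summable_leadSum ha (hk.trans h1) h2)).mul_left _

theorem tv_two_one_singleton {n : ℕ} (hn : 2 ≤ n) :
    tv 2 1 [n] = ∑' j : ℕ, ((2 * j + 1 : ℝ) ^ n)⁻¹ := by
  have h := tv_cons le_rfl n [] (summable_leadSum le_rfl hn (by simp))
  rw [mul_one] at h
  rw [← h.tsum_eq]
  simp [leadSum, truncSum, oddMul]

theorem hasSum_list_of_hasSum_cons {f : List ℕ → ℝ} {s : ℝ}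
    (h : HasSum (fun q : ℕ × List ℕ => f (q.1 :: q.2)) s) : HasSum f (f [] + s) := by
  have hinj : Function.Injective (fun q : ℕ × List ℕ => q.1 :: q.2) := by
    rintro ⟨e, l⟩ ⟨e', l'⟩ h
    simpa using h
  have h1 : HasSum (fun l : List ℕ => if l = [] then 0 else f l) s := by
    refine (hinj.hasSum_iff ?_).1 ?_
    · rintro (_ | ⟨e, l⟩) hl
      · simp
      · exact absurd ⟨(e, l), rfl⟩ hl
    · exact h.congr_fun fun q => by simp
  refine ((hasSum_ite_eq [] (f [])).add h1).congr_fun fun l => ?_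
  by_cases hl : l = [] <;> simp [hl]

theorem hasSum_pow_mul_inv_pow {A x : ℝ} (hA : 1 ≤ A) (hx : |x| < 1) (k : ℕ) :
    HasSum (fun e : ℕ => x ^ e * (A ^ (e + (k + 1)))⁻¹) ((A ^ k * (A - x))⁻¹) := by
  have hA0 : 0 < A := by linarith
  have hxA : x < A := (le_abs_self x).trans_lt (hx.trans_le hA)
  have h : |x / A| < 1 := by
    rw [abs_div, abs_of_pos hA0, div_lt_one hA0]
    exact hx.trans_le hA
  have h1 := (hasSum_geometric_of_abs_lt_one h).mul_right ((A ^ (k + 1))⁻¹)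
  have h2 : (1 - x / A)⁻¹ * (A ^ (k + 1))⁻¹ = (A ^ k * (A - x))⁻¹ := by
    have : A - x ≠ 0 := by linarith
    have : 1 - x / A = (A - x) / A := by field_simp
    rw [this]
    field_simp
    ring
  rw [← h2]
  refine h1.congr_fun fun e => ?_
  rw [div_pow, pow_add]
  field_simp

theorem hasSum_pow_mul_inv_pow_mul {A x p : ℝ} (hA : 1 ≤ A) (hx : |x| < 1) (k : ℕ)
    {f : List ℕ → ℝ} (hf : HasSum f p) :
    HasSum (fun q : ℕ × List ℕ => x ^ q.1 * (A ^ (q.1 + (k + 1)))⁻¹ * f q.2)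
      ((A ^ k * (A - x))⁻¹ * p) := by
  have h := hasSum_pow_mul_inv_pow hA hx k
  exact h.mul hf (summable_mul_of_summable_norm h.summable.norm hf.summable.norm)

theorem one_le_oddMul {a : ℕ} (ha : 1 ≤ a) (j : ℕ) : 1 ≤ oddMul a j := by
  have := oddMul_ge ha j
  have : (0 : ℝ) ≤ j := by positivity
  linarith

/-- The weighted interpolated tail attached to the exponent list `l`. -/
noncomputable def genTerm (a : ℕ) (r x y : ℝ) (l : List ℕ) (m : ℕ) : ℝ :=
  x ^ l.sum * y ^ l.length * interpTail a r (l.map (· + 1)) m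

/-- One step of the recursion defining `genTerm`. -/
noncomputable def consStep (a : ℕ) (r x y : ℝ) (F : List ℕ → ℕ → ℝ) (m : ℕ)
    (q : ℕ × List ℕ) : ℝ :=
  y * (r * (x ^ q.1 * (oddMul a m ^ (q.1 + 1))⁻¹ * F q.2 m) +
    ∑ i ∈ Finset.range m, x ^ q.1 * (oddMul a i ^ (q.1 + 1))⁻¹ * F q.2 i)

theorem genTerm_cons (a : ℕ) (r x y : ℝ) (q : ℕ × List ℕ) (m : ℕ) :
    genTerm a r x y (q.1 :: q.2) m = consStep a r x y (genTerm a r x y) m q := by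
  simp only [genTerm, consStep, List.sum_cons, List.length_cons, List.map_cons, interpTail,
    mul_add, Finset.mul_sum]
  congr 1
  · ring
  · exact Finset.sum_congr rfl fun i _ => by ring

theorem genTerm_nonneg {a : ℕ} (ha : 1 ≤ a) {r x y : ℝ} (hr : 0 ≤ r) (hx : 0 ≤ x) (hy : 0 ≤ y)
    (l : List ℕ) (m : ℕ) : 0 ≤ genTerm a r x y l m :=
  mul_nonneg (by positivity) (interpTail_nonneg ha hr _ m)

theorem abs_genTerm_le {a : ℕ} (ha : 1 ≤ a) (r x y : ℝ) (l : List ℕ) (m : ℕ) :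
    |genTerm a r x y l m| ≤ genTerm a |r| |x| |y| l m := by
  rw [genTerm, genTerm, abs_mul, abs_mul, abs_pow, abs_pow]
  exact mul_le_mul_of_nonneg_left (abs_interpTail_le ha r _ m) (by positivity)

theorem hasSum_consStep {a : ℕ} (ha : 1 ≤ a) (r y : ℝ) {x : ℝ} (hx : |x| < 1)
    {F : List ℕ → ℕ → ℝ} {P : ℕ → ℝ} (hF : ∀ m, HasSum (fun l => F l m) (P m)) (m : ℕ) :
    HasSum (consStep a r x y F m)
      (y * (r * ((oddMul a m - x)⁻¹ * P m) +
        ∑ i ∈ Finset.range m, (oddMul a i - x)⁻¹ * P i)) := by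
  have h : ∀ i, HasSum (fun q : ℕ × List ℕ => x ^ q.1 * (oddMul a i ^ (q.1 + 1))⁻¹ * F q.2 i)
      ((oddMul a i - x)⁻¹ * P i) := fun i => by
    simpa using hasSum_pow_mul_inv_pow_mul (one_le_oddMul ha i) hx 0 (hF i)
  exact (((h m).mul_left r).add (hasSum_sum fun i _ => h i)).mul_left y

theorem inv_oddMul_sub_le {a : ℕ} (ha : 1 ≤ a) {x : ℝ} (hx : x ≤ 1 / 2) (j : ℕ) :
    (oddMul a j - x)⁻¹ ≤ 2 * (1 / ((j : ℝ) + 1)) := by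
  have h := oddMul_ge ha j
  have hj : (0 : ℝ) ≤ j := by positivity
  rw [mul_one_div, inv_eq_one_div, div_le_div_iff₀ (by linarith) (by positivity)]
  linarith

theorem exists_hasSum_genTerm_length_lt {a : ℕ} (ha : 1 ≤ a) {r x y : ℝ} (hr : 0 ≤ r)
    (hx : 0 ≤ x) (hx' : x ≤ 1 / 2) (hy : 0 ≤ y) (h : 4 * y * r + 8 * y ≤ 1) (n : ℕ) :
    ∃ P : ℕ → ℝ, (∀ m, HasSum (fun l => if l.length < n then genTerm a r x y l m else 0) (P m)) ∧
      ∀ m, P m ≤ 2 * √((m : ℝ) + 1) := by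
  induction n with
  | zero => exact ⟨fun _ => 0, fun m => by simp, fun m => by positivity⟩
  | succ n ih =>
    obtain ⟨P, hP, hb⟩ := ih
    have hx1 : |x| < 1 := by rw [abs_of_nonneg hx]; linarith
    have h5 : ∀ m, genTerm a r x y [] m = 1 := by simp [genTerm, interpTail]
    refine ⟨fun m => 1 + y * (r * ((oddMul a m - x)⁻¹ * P m) +
        ∑ i ∈ Finset.range m, (oddMul a i - x)⁻¹ * P i), fun m => ?_, fun m => ?_⟩
    · have h6 := hasSum_list_of_hasSum_cons
        (f := fun l => if l.length < n + 1 then genTerm a r x y l m else 0)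
        (s := y * (r * ((oddMul a m - x)⁻¹ * P m) +
          ∑ i ∈ Finset.range m, (oddMul a i - x)⁻¹ * P i)) ?_
      · simpa only [List.length_nil, Nat.succ_pos, if_true, h5] using h6
      refine (hasSum_consStep ha r y hx1 hP m).congr_fun fun q => ?_
      by_cases hq : q.2.length < n
      · simp [genTerm_cons, consStep, hq]
      · simp [consStep, hq]
    · have hstep : ∀ i : ℕ, (oddMul a i - x)⁻¹ * P i ≤
          4 * (1 / ((i : ℝ) + 1) * √((i : ℝ) + 1)) := fun i => by
        have h0 : 0 ≤ (oddMul a i - x)⁻¹ := by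
          have := one_le_oddMul ha i
          rw [inv_nonneg]; linarith
        calc _ ≤ (oddMul a i - x)⁻¹ * (2 * √((i : ℝ) + 1)) :=
              mul_le_mul_of_nonneg_left (hb i) h0
          _ ≤ 2 * (1 / ((i : ℝ) + 1)) * (2 * √((i : ℝ) + 1)) :=
              mul_le_mul_of_nonneg_right (inv_oddMul_sub_le ha hx' i) (by positivity)
          _ = _ := by ring
      have hm : (0 : ℝ) ≤ m := by positivity
      have h1 : 1 ≤ √((m : ℝ) + 1) := by rw [Real.one_le_sqrt]; linarith
      have h2 : (oddMul a m - x)⁻¹ * P m ≤ 4 * √((m : ℝ) + 1) := by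
        refine (hstep m).trans ?_
        have : 1 / ((m : ℝ) + 1) ≤ 1 := by rw [div_le_one (by positivity)]; linarith
        nlinarith
      have h3 : ∑ i ∈ Finset.range m, (oddMul a i - x)⁻¹ * P i ≤ 8 * √((m : ℝ) + 1) := by
        refine (Finset.sum_le_sum fun i _ => hstep i).trans ?_
        rw [← Finset.mul_sum]
        linarith [sum_sqrt_div_le m]
      have h4 : y * (r * ((oddMul a m - x)⁻¹ * P m) +
          ∑ i ∈ Finset.range m, (oddMul a i - x)⁻¹ * P i) ≤
          y * (r * (4 * √((m : ℝ) + 1)) + 8 * √((m : ℝ) + 1)) := by gcongr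
      nlinarith [mul_le_mul_of_nonneg_right h (zero_le_one.trans h1)]

theorem summable_genTerm_of_nonneg {a : ℕ} (ha : 1 ≤ a) {r x y : ℝ} (hr : 0 ≤ r)
    (hx : 0 ≤ x) (hx' : x ≤ 1 / 2) (hy : 0 ≤ y) (h : 4 * y * r + 8 * y ≤ 1) (m : ℕ) :
    Summable (fun l => genTerm a r x y l m) ∧
      ∑' l, genTerm a r x y l m ≤ 2 * √((m : ℝ) + 1) := by
  have hb : ∀ s : Finset (List ℕ), ∑ l ∈ s, genTerm a r x y l m ≤ 2 * √((m : ℝ) + 1) := by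
    intro s
    obtain ⟨P, hP, hPb⟩ := exists_hasSum_genTerm_length_lt ha hr hx hx' hy h (s.sup List.length + 1)
    refine le_trans ?_ ((sum_le_hasSum s (fun l _ => ?_) (hP m)).trans (hPb m))
    · refine Finset.sum_le_sum fun l hl => ?_
      rw [if_pos (Nat.lt_succ_of_le (Finset.le_sup (f := List.length) hl))]
    · split_ifs
      · exact genTerm_nonneg ha hr hx hy l m
      · exact le_rfl
  have hs := summable_of_sum_le (fun l => genTerm_nonneg ha hr hx hy l m) hb
  exact ⟨hs, hs.tsum_le_of_sum_le hb⟩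

theorem summable_genTerm {a : ℕ} (ha : 1 ≤ a) {r x y : ℝ} (hx : |x| ≤ 1 / 2)
    (h : 4 * |y| * |r| + 8 * |y| ≤ 1) (m : ℕ) : Summable (fun l => genTerm a r x y l m) :=
  Summable.of_norm_bounded
    (summable_genTerm_of_nonneg ha (abs_nonneg r) (abs_nonneg x) hx (abs_nonneg y) h m).1
    fun l => abs_genTerm_le ha r x y l m

theorem tsum_genTerm {a : ℕ} (ha : 1 ≤ a) {r x y : ℝ} (hx : |x| ≤ 1 / 2)
    (h : 4 * |y| * |r| + 8 * |y| ≤ 1) (hu : |x + r * y| ≤ 1 / 2) (hxy : y = 2 * (x + r * y))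
    (m : ℕ) :
    ∑' l, genTerm a r x y l m = (oddMul a m - x) / (oddMul a m - (x + r * y)) *
      ∏ i ∈ Finset.range m, (oddMul a i + (x + r * y)) / (oddMul a i - (x + r * y)) := by
  set u := x + r * y with hu_def
  set P : ℕ → ℝ := fun m => ∑' l, genTerm a r x y l m with hPdef
  have hP : ∀ m, HasSum (fun l => genTerm a r x y l m) (P m) :=
    fun m => (summable_genTerm ha hx h m).hasSum
  have hA : ∀ j, 1 ≤ oddMul a j := one_le_oddMul ha
  have hx2 := abs_le.1 hx
  have hu2 := abs_le.1 hu
  have hrec : ∀ m, P m = 1 + y * (r * ((oddMul a m - x)⁻¹ * P m) +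
      ∑ i ∈ Finset.range m, (oddMul a i - x)⁻¹ * P i) := fun m => by
    have h1 := (hasSum_consStep ha r y (lt_of_le_of_lt hx (by norm_num)) hP m)
    have h2 := hasSum_list_of_hasSum_cons (f := fun l => genTerm a r x y l m)
      (h1.congr_fun fun q => genTerm_cons a r x y q m)
    refine ((hP m).unique h2).trans ?_
    simp [genTerm, interpTail]
  have hsolve : ∀ m Q, 1 + y * ∑ i ∈ Finset.range m, (oddMul a i - x)⁻¹ * P i = Q →
      P m = (oddMul a m - x) / (oddMul a m - u) * Q := fun m Q hQ => by
    have h1 : oddMul a m - x ≠ 0 := by linarith [hA m]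
    have h2 : oddMul a m - u ≠ 0 := by linarith [hA m]
    have h3 := hrec m
    have h4 : P m - y * (r * ((oddMul a m - x)⁻¹ * P m)) = Q := by linarith
    rw [← h4, hu_def]
    rw [hu_def] at h2
    field_simp
    ring
  have hQ : ∀ m, 1 + y * ∑ i ∈ Finset.range m, (oddMul a i - x)⁻¹ * P i =
      ∏ i ∈ Finset.range m, (oddMul a i + u) / (oddMul a i - u) := by
    intro m
    induction m with
    | zero => simp
    | succ m ih =>
      rw [Finset.sum_range_succ, Finset.prod_range_succ, mul_add, ← add_assoc, ih, hsolve m _ ih]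
      have h1 : oddMul a m - x ≠ 0 := by linarith [hA m]
      have h2 : oddMul a m - u ≠ 0 := by linarith [hA m]
      rw [hxy]
      field_simp
      ring
  exact hsolve m _ (hQ m)

/-- The summand indexed by the leading variable `m`, the leading exponent `q.1 + 2` and the
remaining exponents, encoded by `q.2`. -/
noncomputable def fullTerm (a : ℕ) (r x y : ℝ) (p : ℕ × ℕ × List ℕ) : ℝ :=
  x ^ p.2.1 * (oddMul a p.1 ^ (p.2.1 + 2))⁻¹ * genTerm a r x y p.2.2 p.1

theorem hasSum_fullTerm_fiber {a : ℕ} (ha : 1 ≤ a) {r x y : ℝ} (hx : |x| ≤ 1 / 2)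
    (h : 4 * |y| * |r| + 8 * |y| ≤ 1) (m : ℕ) :
    HasSum (fun q : ℕ × List ℕ => fullTerm a r x y (m, q))
      ((oddMul a m * (oddMul a m - x))⁻¹ * ∑' l, genTerm a r x y l m) := by
  have h1 := hasSum_pow_mul_inv_pow_mul (one_le_oddMul ha m) (hx.trans_lt (by norm_num)) 1
    (summable_genTerm ha hx h m).hasSum
  rwa [pow_one] at h1

theorem summable_fullTerm_of_nonneg {a : ℕ} (ha : 1 ≤ a) {r x y : ℝ} (hr : 0 ≤ r)
    (hx : 0 ≤ x) (hx' : x ≤ 1 / 2) (hy : 0 ≤ y) (h : 4 * y * r + 8 * y ≤ 1) :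
    Summable (fullTerm a r x y) := by
  have hfib := hasSum_fullTerm_fiber ha (r := r) (x := x) (y := y)
    (by rwa [abs_of_nonneg hx]) (by rwa [abs_of_nonneg hy, abs_of_nonneg hr])
  have hA := one_le_oddMul ha
  rw [summable_prod_of_nonneg]
  · refine ⟨fun m => (hfib m).summable, ?_⟩
    simp_rw [fun m => (hfib m).tsum_eq]
    refine Summable.of_nonneg_of_le (fun m => ?_) (fun m => ?_)
      (summable_inv_sq_mul_sqrt.mul_left 4)
    · have : 0 < oddMul a m * (oddMul a m - x) := by
        have := hA m
        exact mul_pos (by linarith) (by linarith)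
      exact mul_nonneg (inv_nonneg.2 this.le)
        (tsum_nonneg fun l => genTerm_nonneg ha hr hx hy l m)
    · have h1 : 0 ≤ (oddMul a m - x)⁻¹ := by
        have := hA m
        rw [inv_nonneg]; linarith
      have h2 : (oddMul a m)⁻¹ ≤ ((m : ℝ) + 1)⁻¹ :=
        inv_anti₀ (by positivity) (oddMul_ge ha m)
      rw [mul_inv]
      calc _ ≤ ((m : ℝ) + 1)⁻¹ * (2 * (1 / ((m : ℝ) + 1))) * (2 * √((m : ℝ) + 1)) := by
            refine mul_le_mul (mul_le_mul h2 (inv_oddMul_sub_le ha hx' m) h1 (by positivity))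
              (summable_genTerm_of_nonneg ha hr hx hx' hy h m).2
              (tsum_nonneg fun l => genTerm_nonneg ha hr hx hy l m) (by positivity)
        _ = _ := by field_simp; ring
  · intro p
    have := hA p.1
    exact mul_nonneg (by positivity) (genTerm_nonneg ha hr hx hy _ _)

theorem summable_fullTerm {a : ℕ} (ha : 1 ≤ a) {r x y : ℝ} (hx : |x| ≤ 1 / 2)
    (h : 4 * |y| * |r| + 8 * |y| ≤ 1) : Summable (fullTerm a r x y) := by
  refine Summable.of_norm_bounded (summable_fullTerm_of_nonneg ha (abs_nonneg r) (abs_nonneg x) hx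
    (abs_nonneg y) h) fun p => ?_
  have := oddMul_pos ha p.1
  rw [fullTerm, fullTerm, Real.norm_eq_abs, abs_mul, abs_mul, abs_pow,
    abs_of_pos (a := (oddMul a p.1 ^ (p.2.1 + 2))⁻¹) (by positivity)]
  exact mul_le_mul_of_nonneg_left (abs_genTerm_le ha r x y _ _) (by positivity)

theorem hasSum_weighted_itv {a : ℕ} (ha : 1 ≤ a) {r u : ℝ} (hu : 16 * (1 + |r|) * |u| ≤ 1) :
    HasSum (fun q : ℕ × List ℕ => ((1 - 2 * r) * u) ^ (q.1 + q.2.sum) * (2 * u) ^ q.2.length *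
        itv (2 * a) a r ((q.1 + 2) :: q.2.map (· + 1)))
      (((a : ℝ) ^ 2)⁻¹ * (sinIntegral (-(u / a)) ^ 2 / 2)) := by
  have hr := abs_nonneg r
  have hu0 := abs_nonneg u
  have hru : 0 ≤ |r| * |u| := mul_nonneg hr hu0
  have ha' : (1 : ℝ) ≤ a := by exact_mod_cast ha
  have hu1 : |u| ≤ 1 / 2 := by nlinarith
  have hu2 := abs_le.1 hu1
  have hx : |(1 - 2 * r) * u| ≤ 1 / 2 := by
    rw [abs_mul]
    have : |1 - 2 * r| ≤ 1 + 2 * |r| := by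
      refine (abs_sub _ _).trans ?_
      rw [abs_mul, abs_one, abs_two]
    nlinarith [mul_le_mul_of_nonneg_right this hu0]
  have hy : 4 * |2 * u| * |r| + 8 * |2 * u| ≤ 1 := by
    rw [abs_mul, abs_two]
    nlinarith
  have hv : |u / a| < 1 := by
    rw [abs_div, abs_of_pos (by linarith : (0 : ℝ) < a), div_lt_one (by linarith)]
    linarith
  have hxy : (1 - 2 * r) * u + r * (2 * u) = u := by ring
  have hsum := summable_fullTerm ha hx hy
  have hS : HasSum (fullTerm a r ((1 - 2 * r) * u) (2 * u))
      (((a : ℝ) ^ 2)⁻¹ * (sinIntegral (-(u / a)) ^ 2 / 2)) := by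
    have h1 := hsum.hasSum
    have h2 := h1.prod_fiberwise (hasSum_fullTerm_fiber ha hx hy)
    have h3 := (hasSum_wellPoised hv).mul_left ((a : ℝ) ^ 2)⁻¹
    have h4 := h2.unique (h3.congr_fun fun m => ?_)
    · rwa [h4] at h1
    · rw [tsum_genTerm ha hx hy (by rwa [hxy]) (by rw [hxy]), hxy]
      have hx2 := abs_le.1 hx
      have hm := one_le_oddMul ha m
      have e1 : oddMul a m - (1 - 2 * r) * u ≠ 0 := by linarith
      have e2 : ∀ i, oddMul a i - u = a * (2 * i + 1 - u / a) := fun i => by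
        rw [oddMul]; field_simp
      have e3 : ∀ i, oddMul a i + u = a * (2 * i + 1 + u / a) := fun i => by
        rw [oddMul]; field_simp
      have e4 : oddMul a m - u ≠ 0 := by linarith
      have e5 : ∀ i : ℕ, (oddMul a i + u) / (oddMul a i - u) =
          (2 * i + 1 + u / a) / (2 * i + 1 - u / a) := fun i => by
        rw [e2, e3, mul_div_mul_left _ _ (by linarith)]
      rw [Finset.prod_congr rfl fun i _ => e5 i, ← mul_assoc, ← mul_assoc]
      congr 1
      have e6 : (oddMul a m * (oddMul a m - (1 - 2 * r) * u))⁻¹ *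
          ((oddMul a m - (1 - 2 * r) * u) / (oddMul a m - u)) =
          (oddMul a m * (oddMul a m - u))⁻¹ := by
        have : oddMul a m ≠ 0 := by linarith
        field_simp
      rw [e6, e2, oddMul, one_div, ← mul_inv]
      congr 1
      ring
  have hswap := (Equiv.prodComm (ℕ × List ℕ) ℕ).hasSum_iff.2 hS
  refine hswap.prod_fiberwise fun q => ?_
  have hl : ∀ i ∈ q.2.map (· + 1), 1 ≤ i := by
    intro i hi
    obtain ⟨j, -, rfl⟩ := List.mem_map.1 hi
    omega
  have h := (hasSum_itv_cons ha r (k := q.1 + 2) (by omega) hl).mul_left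
    (((1 - 2 * r) * u) ^ (q.1 + q.2.sum) * (2 * u) ^ q.2.length)
  refine h.congr_fun fun m => ?_
  simp only [Function.comp, Equiv.prodComm_apply, Prod.swap, fullTerm, genTerm]
  ring

theorem tsum_weight_depth_fiber (a : ℕ) (r u : ℝ) (p : ℕ × ℕ) :
    ∑' q : (fun q : ℕ × List ℕ => (q.1 + 2 + q.2.sum + q.2.length, q.2.length + 1)) ⁻¹' {p},
      ((1 - 2 * r) * u) ^ (q.1.1 + q.1.2.sum) * (2 * u) ^ q.1.2.length *
        itv (2 * a) a r ((q.1.1 + 2) :: q.1.2.map (· + 1)) =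
    if p.2 + 1 ≤ p.1 ∧ 1 ≤ p.2 then
      (1 - 2 * r) ^ (p.1 - p.2 - 1) * 2 ^ (p.2 - 1) * X0d a r p.1 p.2 * u ^ (p.1 - 2)
    else 0 := by
  obtain ⟨k, n⟩ := p
  split_ifs with hkn
  · have hsum : ∀ l : List ℕ, (l.map (· + 1)).sum = l.sum + l.length := fun l => by
      induction l with
      | nil => rfl
      | cons e l ih => simp only [List.map_cons, List.sum_cons, List.length_cons, ih]; omega
    let φ : (fun q : ℕ × List ℕ => (q.1 + 2 + q.2.sum + q.2.length, q.2.length + 1)) ⁻¹' {(k, n)} →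
        {l : List ℕ // IsAdmissible l ∧ l.sum = k ∧ l.length = n} := fun q =>
      ⟨(q.1.1 + 2) :: q.1.2.map (· + 1), by
        have h := q.2
        simp only [Set.mem_preimage, Set.mem_singleton_iff, Prod.mk.injEq] at h
        refine ⟨⟨?_, by simp⟩, ?_, by simpa using h.2⟩
        · intro i hi
          rcases List.mem_cons.1 hi with rfl | hi
          · omega
          · obtain ⟨j, -, rfl⟩ := List.mem_map.1 hi
            omega
        · rw [List.sum_cons, hsum]
          omega⟩
    have hφ : Function.Bijective φ := by
      constructor
      · rintro ⟨⟨e, l⟩, h⟩ ⟨⟨e', l'⟩, h'⟩ hh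
        have := congrArg Subtype.val hh
        simp only [φ, List.cons.injEq, add_left_inj] at this
        have h2 := List.map_injective_iff.2 (add_left_injective 1) this.2
        simp [this.1, h2]
      · rintro ⟨_ | ⟨k', l⟩, ⟨h1, h2⟩, h3, h4⟩
        · simp at h2
        · have hl : (l.map (· - 1)).map (· + 1) = l := by
            rw [List.map_map]
            conv_rhs => rw [← List.map_id l]
            refine List.map_congr_left fun i hi => ?_
            have := h1 i (List.mem_cons_of_mem _ hi)
            simp only [Function.comp, id]
            omega
          have hs := hsum (l.map (· - 1))
          rw [hl, List.length_map] at hs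
          simp only [List.headI_cons] at h2
          simp only [List.sum_cons, List.length_cons] at h3 h4
          refine ⟨⟨(k' - 2, l.map (· - 1)), ?_⟩, Subtype.ext ?_⟩
          · simp only [Set.mem_preimage, Set.mem_singleton_iff, Prod.mk.injEq, List.length_map]
            omega
          · simp only [φ, hl]
            rw [Nat.sub_add_cancel h2]
    rw [X0d, ← (Equiv.ofBijective φ hφ).tsum_eq, ← tsum_mul_left, ← tsum_mul_right]
    refine tsum_congr fun q => ?_
    have h := q.2
    simp only [Set.mem_preimage, Set.mem_singleton_iff, Prod.mk.injEq] at h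
    have e1 : k - n - 1 = q.1.1 + q.1.2.sum := by omega
    have e2 : n - 1 = q.1.2.length := by omega
    have e3 : k - 2 = q.1.1 + q.1.2.sum + q.1.2.length := by omega
    simp only [Equiv.ofBijective_apply, φ, e1, e2, e3]
    rw [mul_pow, mul_pow, pow_add u (q.1.1 + q.1.2.sum)]
    ring
  · have : IsEmpty ((fun q : ℕ × List ℕ =>
        (q.1 + 2 + q.2.sum + q.2.length, q.2.length + 1)) ⁻¹' {(k, n)}) := by
      refine ⟨fun q => hkn ?_⟩
      have h := q.2
      simp only [Set.mem_preimage, Set.mem_singleton_iff, Prod.mk.injEq] at h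
      constructor <;> simp only <;> omega
    exact tsum_empty

/-- Generating function of weighted sums of interpolated multiple t-values of level `2a`:
`Σ_{k>n≥1} (1-2r)^{k-n-1} 2^{n-1} (Σ_{k ∈ I₀(k,n)} t^r_{2a,a}(k)) u^{k-2}
  = a⁻² 2^{2u/a} t(2) exp(Σ_{n≥2} 4(2^{n-1}-1)t(n)/(n aⁿ (2ⁿ-1)) · uⁿ)`,
where `t(n) = t_{2,1}(n)` is the classical t-value. -/
theorem stmt7 (a : ℕ) (ha : 1 ≤ a) (r : ℝ) :
    ∃ ε > (0 : ℝ), ∀ u : ℝ, |u| < ε →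
      Summable (fun p : ℕ × ℕ =>
        if p.2 + 1 ≤ p.1 ∧ 1 ≤ p.2 then
          (1 - 2 * r) ^ (p.1 - p.2 - 1) * 2 ^ (p.2 - 1) * X0d a r p.1 p.2 * u ^ (p.1 - 2)
        else 0) ∧
      Summable (fun n : ℕ =>
        if 2 ≤ n then
          4 * ((2 : ℝ) ^ (n - 1) - 1) * tv 2 1 [n] / (n * (a : ℝ) ^ n * ((2 : ℝ) ^ n - 1))
            * u ^ n
        else 0) ∧
      (∑' p : ℕ × ℕ,
        if p.2 + 1 ≤ p.1 ∧ 1 ≤ p.2 then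
          (1 - 2 * r) ^ (p.1 - p.2 - 1) * 2 ^ (p.2 - 1) * X0d a r p.1 p.2 * u ^ (p.1 - 2)
        else 0) =
        ((a : ℝ) ^ 2)⁻¹ * (2 : ℝ) ^ (2 * u / (a : ℝ)) * tv 2 1 [2] *
          Real.exp (∑' n : ℕ,
            if 2 ≤ n then
              4 * ((2 : ℝ) ^ (n - 1) - 1) * tv 2 1 [n]
                / (n * (a : ℝ) ^ n * ((2 : ℝ) ^ n - 1)) * u ^ n
            else 0) := by
  have ha' : (0 : ℝ) < a := by exact_mod_cast ha
  have ha1 : (1 : ℝ) ≤ a := by exact_mod_cast ha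
  have hr : 0 < 16 * (1 + |r|) := by positivity
  refine ⟨1 / (16 * (1 + |r|)), by positivity, fun u hu => ?_⟩
  have hu' : 16 * (1 + |r|) * |u| ≤ 1 := by
    rw [lt_div_iff₀ hr] at hu
    linarith
  have hv : |u / a| < 1 := by
    rw [abs_div, abs_of_pos ha', div_lt_one ha']
    nlinarith [abs_nonneg r, abs_nonneg u, mul_nonneg (abs_nonneg r) (abs_nonneg u)]
  have hL := (hasSum_weighted_itv ha hu').tsum_fiberwise
    (fun q : ℕ × List ℕ => (q.1 + 2 + q.2.sum + q.2.length, q.2.length + 1))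
  simp only [tsum_weight_depth_fiber a r u] at hL
  have hR : (fun n : ℕ => if 2 ≤ n then
      4 * ((2 : ℝ) ^ (n - 1) - 1) * tv 2 1 [n] / (n * (a : ℝ) ^ n * ((2 : ℝ) ^ n - 1)) * u ^ n
      else 0) = fun n : ℕ => if 2 ≤ n then
      4 * ((2 : ℝ) ^ (n - 1) - 1) * (∑' j : ℕ, ((2 * j + 1 : ℝ) ^ n)⁻¹) /
        (n * ((2 : ℝ) ^ n - 1)) * (u / a) ^ n else 0 := by
    funext n
    refine if_ctx_congr Iff.rfl (fun hn => ?_) fun _ => rfl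
    rw [tv_two_one_singleton hn, div_pow, div_mul_div_comm, div_mul_eq_mul_div]
    congr 1
    ring
  obtain ⟨hs, he⟩ := exp_tsum_tvalue hv
  have ht : tv 2 1 [2] = Real.pi ^ 2 / 8 := by
    have h := hasSum_wellPoised (v := 0) (by simp)
    rw [neg_zero, sinIntegral_zero] at h
    rw [tv_two_one_singleton le_rfl,
      show Real.pi ^ 2 / 8 = (Real.pi / 2) ^ 2 / 2 by ring, ← h.tsum_eq]
    refine tsum_congr fun j => ?_
    rw [Finset.prod_eq_one fun i _ => ?_]
    · rw [sub_zero, mul_one, one_div, pow_two]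
    · rw [add_zero, sub_zero, div_self (by positivity)]
  refine ⟨hL.summable, ?_, ?_⟩
  · rw [hR]
    exact hs
  · rw [hL.tsum_eq, hR, ht]
    rw [show 2 * u / (a : ℝ) = 2 * (u / a) by ring]
    have hpi := Real.pi_ne_zero
    calc _ = ((a : ℝ) ^ 2)⁻¹ * (Real.pi ^ 2 / 8) *
          (2 / Real.pi * sinIntegral (-(u / a))) ^ 2 := by field_simp; ring
      _ = _ := by rw [← he]; ring
end

section
/- Let a be a positive integer, let r be a real number, and let k ≥ 2 be an integer. Then Σ_{n=1}^{k−1} ((1−2r)^{k−n−1} 2^{n−1} Σ_{k∈I₀(k,n)} t^r_{2a,a}(k)) = Σ (2^{n+2m}(2^{n_1−1}−1)⋯(2^{n_m−1}−1)/(a^k n! m! n_1⋯n_m (2^{n_1}−1)⋯(2^{n_m}−1))) t(2) t(n_1)⋯t(n_m) logⁿ(2), where the sum on the right runs over all integers n ≥ 0, m ≥ 0 and n_1,…,n_m ≥ 2 with n + n_1 + ⋯ + n_m = k − 2. -/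
namespace TSum

open Filter Topology Finset

/-- Quotient of consecutive summands of the well-poised hypergeometric series
`₃F₂(2N+1, 1/2, (1+x)/2; 2N+3/2, 2N+(3-x)/2; 1)`. -/
noncomputable def wpRatio (x : ℝ) (N j : ℕ) : ℝ :=
  (2 * N + 1 + j) * (2 * j + 1) * (2 * j + 1 + x) /
    ((j + 1) * (2 * j + 4 * N + 3) * (2 * j + 4 * N + 3 - x))

/-- Summand of the well-poised hypergeometric series
`₃F₂(2N+1, 1/2, (1+x)/2; 2N+3/2, 2N+(3-x)/2; 1)`. -/
noncomputable def wpTerm (x : ℝ) (N j : ℕ) : ℝ := ∏ i ∈ range j, wpRatio x N i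

/-- Quotient of the values of the well-poised series at `N` and `N + 1`. -/
noncomputable def wpShift (x : ℝ) (N : ℕ) : ℝ :=
  16 * (N + 1) ^ 2 * (2 * N + 2 - x) * (4 * N + 2 - x) * (4 * N + 4 - x) /
    ((4 * N + 3) * (4 * N + 5) * (4 * N + 3 - x) * (4 * N + 5 - x) * (2 * N + 1 - x))

/-- Quotient of the telescoping certificate by the summand. -/
noncomputable def wpCert (x : ℝ) (N j : ℕ) : ℝ :=
  4 * j * ((1 - x) / (4 * (2 * N + 1)) - (1 + 1 / (2 * N + 1 - x)) * (2 * N + 1 + j)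
    - (2 * N + 1 + j) ^ 2 / (2 * N + 1 - x)) / ((2 * j + 4 * N + 3) * (2 * j + 4 * N + 3 - x))

variable {x : ℝ}

lemma wpTerm_succ_right (x : ℝ) (N j : ℕ) :
    wpTerm x N (j + 1) = wpTerm x N j * wpRatio x N j := prod_range_succ _ _

lemma wpRatio_nonneg (h0 : 0 ≤ x) (h1 : x ≤ 1 / 2) (N j : ℕ) : 0 ≤ wpRatio x N j := by
  have : 0 ≤ 2 * (j : ℝ) + 4 * N + 3 - x := by
    have := j.cast_nonneg (α := ℝ); have := N.cast_nonneg (α := ℝ); linarith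
  unfold wpRatio
  positivity

lemma wpTerm_nonneg (h0 : 0 ≤ x) (h1 : x ≤ 1 / 2) (N j : ℕ) : 0 ≤ wpTerm x N j :=
  prod_nonneg fun i _ => wpRatio_nonneg h0 h1 N i

lemma wpTerm_succ_left (h1 : x ≤ 1 / 2) (N j : ℕ) :
    wpTerm x (N + 1) j = wpTerm x N j *
      ((2 * N + 1 + j) * (2 * N + 2 + j) * (4 * N + 3) * (4 * N + 5) * (4 * N + 3 - x)
          * (4 * N + 5 - x) /
        ((2 * N + 1) * (2 * N + 2) * (4 * N + 3 + 2 * j) * (4 * N + 5 + 2 * j)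
          * (4 * N + 3 - x + 2 * j) * (4 * N + 5 - x + 2 * j))) := by
  have hN := N.cast_nonneg (α := ℝ)
  have a1 : 0 < (4 * N + 3 - x) := by linarith
  have a2 : 0 < (4 * N + 5 - x) := by linarith
  induction j with
  | zero =>
    simp only [wpTerm, range_zero, prod_empty, Nat.cast_zero, mul_zero, add_zero, one_mul]
    exact (div_self (by positivity)).symm
  | succ j ih =>
    have hj := j.cast_nonneg (α := ℝ)
    rw [wpTerm_succ_right, wpTerm_succ_right, ih]
    simp only [mul_assoc]
    congr 1
    unfold wpRatio
    push_cast
    have b1 : (4 * N + 3 - x + 2 * j) ≠ 0 := by linarith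
    have b2 : (4 * N + 5 - x + 2 * j) ≠ 0 := by linarith
    have b3 : (4 * N + 3 - x + 2 * (j + 1)) ≠ 0 := by linarith
    have b4 : (4 * N + 5 - x + 2 * (j + 1)) ≠ 0 := by linarith
    have b5 : (2 * j + 4 * N + 3 - x) ≠ 0 := by linarith
    have b6 : (2 * j + 4 * (N + 1) + 3 - x) ≠ 0 := by linarith
    field_simp
    ring

set_option maxRecDepth 4000 in
lemma wpTerm_sub (h1 : x ≤ 1 / 2) (N j : ℕ) :
    wpTerm x N j - wpShift x N * wpTerm x (N + 1) j =
      wpCert x N (j + 1) * wpTerm x N (j + 1) - wpCert x N j * wpTerm x N j := by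
  rw [wpTerm_succ_left h1, wpTerm_succ_right]
  have hN := N.cast_nonneg (α := ℝ)
  have hj := j.cast_nonneg (α := ℝ)
  have key : 1 - wpShift x N *
      ((2 * N + 1 + j) * (2 * N + 2 + j) * (4 * N + 3) * (4 * N + 5) * (4 * N + 3 - x)
          * (4 * N + 5 - x) /
        ((2 * N + 1) * (2 * N + 2) * (4 * N + 3 + 2 * j) * (4 * N + 5 + 2 * j)
          * (4 * N + 3 - x + 2 * j) * (4 * N + 5 - x + 2 * j))) =
      wpCert x N (j + 1) * wpRatio x N j - wpCert x N j := by
    obtain ⟨y, rfl⟩ : ∃ y, x = 2 * N + 1 - y := ⟨2 * N + 1 - x, by ring⟩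
    have hy : 0 < y := by linarith
    unfold wpCert wpRatio wpShift
    push_cast
    rw [show (2 * N + 1 - (2 * N + 1 - y)) = y by ring,
      show (4 * N + 3 - (2 * N + 1 - y)) = 2 * N + 2 + y by ring,
      show (4 * N + 5 - (2 * N + 1 - y)) = 2 * N + 4 + y by ring,
      show (2 * (j + 1) + 4 * N + 3 - (2 * N + 1 - y)) = 2 * j + 2 * N + 4 + y by ring,
      show (2 * j + 4 * N + 3 - (2 * N + 1 - y)) = 2 * j + 2 * N + 2 + y by ring]
    field_simp
    ring
  linear_combination wpTerm x N j * key

lemma wpRatio_le_zero (h0 : 0 ≤ x) (h1 : x ≤ 1 / 2) (N j : ℕ) :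
    wpRatio x N j ≤ wpRatio x 0 j := by
  have hN := N.cast_nonneg (α := ℝ)
  have hj := j.cast_nonneg (α := ℝ)
  have b1 : 0 < (2 * j + 4 * N + 3 - x) := by linarith
  have b2 : 0 < (2 * (j : ℝ) + 4 * (0 : ℕ) + 3 - x) := by push_cast; linarith
  unfold wpRatio
  rw [div_le_div_iff₀ (by positivity) (by positivity)]
  push_cast at b2 ⊢
  have main : (2 * N + 1 + j) * ((2 * j + 3) * (2 * j + 3 - x))
      ≤ (1 + j) * ((2 * j + 4 * N + 3) * (2 * (j : ℝ) + 4 * N + 3 - x)) := by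
    have h2 : 0 ≤ 2 * (1 + j) * (2 * j + 3) - (2 * (j : ℝ) + 3 - x) := by nlinarith
    have h3 : 0 ≤ (N : ℝ) * (2 * (1 + j) * (2 * j + 3) - (2 * (j : ℝ) + 3 - x)) :=
      mul_nonneg hN h2
    have h4 : 0 ≤ (N : ℝ) * N * (1 + j) := by positivity
    nlinarith
  have h5 : 0 ≤ (2 * j + 1) * (2 * j + 1 + x) * ((j : ℝ) + 1) := by positivity
  have := mul_le_mul_of_nonneg_left main h5
  nlinarith [this]

lemma wpTerm_le_zero (h0 : 0 ≤ x) (h1 : x ≤ 1 / 2) (N j : ℕ) :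
    wpTerm x N j ≤ wpTerm x 0 j :=
  prod_le_prod (fun i _ => wpRatio_nonneg h0 h1 N i) fun i _ => wpRatio_le_zero h0 h1 N i

lemma wpTerm_zero_sq_le (h0 : 0 ≤ x) (h1 : x ≤ 1 / 2) (j : ℕ) :
    wpTerm x 0 j ^ 2 * ((2 * j + 1) ^ 2 * (j + 1)) ≤ 1 := by
  induction j with
  | zero => simp [wpTerm]
  | succ j ih =>
    have hj := j.cast_nonneg (α := ℝ)
    refine le_trans ?_ ih
    rw [wpTerm_succ_right, mul_pow, mul_assoc]
    refine mul_le_mul_of_nonneg_left ?_ (sq_nonneg _)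
    have e : wpRatio x 0 j = (2 * j + 1) * ((2 * j + 1 + x) / ((2 * j + 3) * (2 * j + 3 - x))) := by
      unfold wpRatio
      have : (2 * j + 3 - x) ≠ 0 := by linarith
      simp only [Nat.cast_zero, mul_zero, add_zero, zero_add]
      field_simp
      ring
    have hle : (2 * j + 1 + x) / ((2 * j + 3) * (2 * j + 3 - x))
        ≤ (2 * j + 3 / 2) / ((2 * j + 3) * (2 * (j : ℝ) + 5 / 2)) := by
      have : 0 < (2 * (j : ℝ) + 3 - x) := by linarith
      refine div_le_div₀ (by positivity) (by linarith) (by positivity) ?_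
      exact mul_le_mul_of_nonneg_left (by linarith) (by positivity)
    have hpos : 0 ≤ (2 * j + 1 + x) / ((2 * j + 3) * (2 * (j : ℝ) + 3 - x)) := by
      have : 0 < (2 * (j : ℝ) + 3 - x) := by linarith
      positivity
    rw [e, mul_pow, mul_assoc]
    refine mul_le_mul_of_nonneg_left ?_ (sq_nonneg _)
    calc _ ≤ ((2 * j + 3 / 2) / ((2 * j + 3) * (2 * (j : ℝ) + 5 / 2))) ^ 2 *
          ((2 * ((j + 1 : ℕ) : ℝ) + 1) ^ 2 * (((j + 1 : ℕ) : ℝ) + 1)) := by gcongr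
      _ ≤ _ := by
        push_cast
        rw [div_pow, div_mul_eq_mul_div, div_le_iff₀ (by positivity)]
        have : 0 ≤ (2 * (j : ℝ) + 3) ^ 2 *
            ((2 * (j : ℝ) + 5 / 2) ^ 2 * (j + 1) - (2 * (j : ℝ) + 3 / 2) ^ 2 * (j + 2)) := by
          apply mul_nonneg (sq_nonneg _)
          nlinarith
        nlinarith [this]

lemma wpTerm_zero_le (h0 : 0 ≤ x) (h1 : x ≤ 1 / 2) (j : ℕ) :
    wpTerm x 0 j ≤ 1 / ((2 * j + 1) * √(j + 1)) := by
  rw [le_div_iff₀ (by positivity)]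
  have h := wpTerm_zero_sq_le h0 h1 j
  refine (abs_le_one_iff_mul_self_le_one.mpr ?_ |> (le_abs_self _).trans)
  have hs := Real.sq_sqrt (show 0 ≤ (j : ℝ) + 1 by positivity)
  calc _ = wpTerm x 0 j ^ 2 * ((2 * j + 1) ^ 2 * (√(j + 1)) ^ 2) := by ring
    _ ≤ 1 := by rw [hs]; exact h

lemma summable_wpTerm_zero (h0 : 0 ≤ x) (h1 : x ≤ 1 / 2) : Summable (wpTerm x 0) := by
  have hs : Summable fun j : ℕ => 1 / |(j : ℝ) + 1| ^ (3 / 2 : ℝ) :=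
    (Real.summable_one_div_nat_add_rpow 1 (3 / 2)).mpr (by norm_num)
  refine Summable.of_nonneg_of_le (wpTerm_nonneg h0 h1 0) (fun j => ?_) hs
  refine (wpTerm_zero_le h0 h1 j).trans ?_
  have hp : (0 : ℝ) < j + 1 := by positivity
  rw [abs_of_pos hp, show (3 / 2 : ℝ) = 1 + 1 / 2 by norm_num, Real.rpow_add hp, Real.rpow_one,
    ← Real.sqrt_eq_rpow]
  gcongr
  linarith [j.cast_nonneg (α := ℝ)]

lemma summable_wpTerm (h0 : 0 ≤ x) (h1 : x ≤ 1 / 2) (N : ℕ) : Summable (wpTerm x N) :=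
  Summable.of_nonneg_of_le (wpTerm_nonneg h0 h1 N) (wpTerm_le_zero h0 h1 N)
    (summable_wpTerm_zero h0 h1)

lemma tendsto_inv_sqrt_succ : Tendsto (fun j : ℕ => 1 / √((j : ℝ) + 1)) atTop (𝓝 0) := by
  have : Tendsto (fun j : ℕ => √((j : ℝ) + 1)) atTop atTop :=
    Real.tendsto_sqrt_atTop.comp (tendsto_natCast_atTop_atTop.atTop_add tendsto_const_nhds)
  simpa [Function.comp_def] using tendsto_inv_atTop_zero.comp this

lemma abs_wpCert_le (h0 : 0 ≤ x) (h1 : x ≤ 1 / 2) (N j : ℕ) :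
    |wpCert x N j| ≤ (20 * (N + 1) ^ 2) * (2 * j + 1) := by
  have hN := N.cast_nonneg (α := ℝ)
  have hj := j.cast_nonneg (α := ℝ)
  have a3 : 1 / 2 ≤ (2 * N + 1 - x) := by linarith
  have b5 : 0 < (2 * j + 4 * N + 3 - x) := by linarith
  have i1 : 1 / (2 * N + 1 - x) ≤ 2 := by
    rw [div_le_iff₀ (by linarith)]; linarith
  have i0 : 0 ≤ 1 / (2 * N + 1 - x) := by positivity
  have i2 : (1 - x) / (4 * (2 * N + 1)) ≤ 1 := by
    rw [div_le_iff₀ (by positivity)]; linarith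
  have i3 : 0 ≤ (1 - x) / (4 * (2 * N + 1)) := div_nonneg (by linarith) (by positivity)
  unfold wpCert
  rw [abs_div, abs_of_pos (mul_pos (by positivity : 0 < (2 * (j : ℝ) + 4 * N + 3)) b5),
    div_le_iff₀ (mul_pos (by positivity) b5), abs_mul, abs_of_nonneg (by positivity : 0 ≤ 4 * (j : ℝ))]
  have hq : |(1 - x) / (4 * (2 * N + 1)) - (1 + 1 / (2 * N + 1 - x)) * (2 * N + 1 + j)
    - (2 * N + 1 + j) ^ 2 / (2 * N + 1 - x)| ≤ 1 + 3 * (2 * (N : ℝ) + 1 + j) + 2 * (2 * N + 1 + j) ^ 2 := by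
    rw [div_eq_mul_one_div ((2 * (N : ℝ) + 1 + j) ^ 2)]
    set u := 1 / (2 * (N : ℝ) + 1 - x)
    set v := (2 * (N : ℝ) + 1 + j)
    have hv : 0 ≤ v := by positivity
    have : u * v ≤ 2 * v := by gcongr
    have : v ^ 2 * u ≤ v ^ 2 * 2 := by gcongr
    have : 0 ≤ u * v := by positivity
    have : 0 ≤ v ^ 2 * u := by positivity
    rw [abs_le]; constructor <;> nlinarith
  refine (mul_le_mul_of_nonneg_left hq (by positivity)).trans ?_
  have hb : (2 * j + 2) * (2 * j + 2) ≤ (2 * j + 4 * N + 3) * (2 * (j : ℝ) + 4 * N + 3 - x) := by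
    gcongr <;> linarith
  calc 4 * (j : ℝ) * (1 + 3 * (2 * N + 1 + j) + 2 * (2 * N + 1 + j) ^ 2)
      ≤ 2 * (2 * j + 1) * (6 * (2 * N + 1 + j) ^ 2) :=
        mul_le_mul (by linarith) (by nlinarith) (by positivity) (by positivity)
    _ ≤ 2 * (2 * j + 1) * (6 * (2 * (N + 1) * (j + 1)) ^ 2) := by
        gcongr; nlinarith
    _ ≤ (20 * (N + 1) ^ 2) * (2 * j + 1) * ((2 * j + 2) * (2 * j + 2)) := by
        have : 0 ≤ ((N : ℝ) + 1) ^ 2 * (2 * j + 1) * (j + 1) ^ 2 := by positivity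
        nlinarith
    _ ≤ _ := by gcongr

lemma tendsto_wpCert_mul_wpTerm (h0 : 0 ≤ x) (h1 : x ≤ 1 / 2) (N : ℕ) :
    Tendsto (fun j => wpCert x N j * wpTerm x N j) atTop (𝓝 0) := by
  refine squeeze_zero_norm (a := fun j : ℕ => (20 * (N + 1) ^ 2) * (1 / √((j : ℝ) + 1))) (fun j => ?_)
    (by simpa using tendsto_inv_sqrt_succ.const_mul (20 * ((N : ℝ) + 1) ^ 2))
  have h := ((wpTerm_le_zero h0 h1 N j).trans (wpTerm_zero_le h0 h1 j))
  rw [Real.norm_eq_abs, abs_mul, abs_of_nonneg (wpTerm_nonneg h0 h1 N j)]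
  calc _ ≤ (20 * ((N : ℝ) + 1) ^ 2) * (2 * j + 1) * (1 / ((2 * j + 1) * √(j + 1))) := by
        gcongr
        · exact wpTerm_nonneg h0 h1 N j
        · exact abs_wpCert_le h0 h1 N j
    _ = _ := by field_simp

lemma tsum_wpTerm_succ (h0 : 0 ≤ x) (h1 : x ≤ 1 / 2) (N : ℕ) :
    ∑' j, wpTerm x N j = wpShift x N * ∑' j, wpTerm x (N + 1) j := by
  have s1 := summable_wpTerm h0 h1 N
  have s2 := (summable_wpTerm h0 h1 (N + 1)).mul_left (wpShift x N)
  rw [← tsum_mul_left, ← sub_eq_zero, ← s1.tsum_sub s2]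
  refine tendsto_nhds_unique (s1.sub s2).hasSum.tendsto_sum_nat ?_
  have : ∀ n, ∑ j ∈ range n, (wpTerm x N j - wpShift x N * wpTerm x (N + 1) j)
      = wpCert x N n * wpTerm x N n := by
    intro n
    rw [sum_congr rfl fun j _ => wpTerm_sub h1 N j,
      sum_range_sub fun j => wpCert x N j * wpTerm x N j]
    simp [wpCert]
  simpa only [this] using tendsto_wpCert_mul_wpTerm h0 h1 N

lemma tsum_wpTerm_zero (h0 : 0 ≤ x) (h1 : x ≤ 1 / 2) (M : ℕ) :
    ∑' j, wpTerm x 0 j = (∏ N ∈ range M, wpShift x N) * ∑' j, wpTerm x M j := by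
  induction M with
  | zero => simp
  | succ M ih => rw [ih, tsum_wpTerm_succ h0 h1, prod_range_succ, mul_assoc]

lemma wpRatio_le_one (h0 : 0 ≤ x) (h1 : x ≤ 1 / 2) (N j : ℕ) : wpRatio x N j ≤ 1 := by
  refine (wpRatio_le_zero h0 h1 N j).trans ?_
  have hj := j.cast_nonneg (α := ℝ)
  unfold wpRatio
  simp only [Nat.cast_zero, mul_zero, add_zero, zero_add]
  have b5 : 0 < (2 * (j : ℝ) + 3 - x) := by linarith
  rw [div_le_one (by positivity), add_comm 1 (j : ℝ), mul_assoc, mul_assoc]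
  refine mul_le_mul_of_nonneg_left ?_ (by positivity)
  refine mul_le_mul ?_ ?_ ?_ ?_ <;> linarith

lemma tendsto_wpTerm (h0 : 0 ≤ x) (h1 : x ≤ 1 / 2) (j : ℕ) :
    Tendsto (fun N => wpTerm x N j) atTop (𝓝 (if j = 0 then 1 else 0)) := by
  rcases j with _ | j
  · simp [wpTerm]
  · have hb : ∀ N : ℕ, wpTerm x N (j + 1) ≤ 1 / ((N : ℝ) + 1) := by
      intro N
      have hN := N.cast_nonneg (α := ℝ)
      unfold wpTerm
      rw [prod_range_succ']
      have := prod_le_one (s := range j) (f := fun i => wpRatio x N (i + 1))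
        (fun i _ => wpRatio_nonneg h0 h1 N _) (fun i _ => wpRatio_le_one h0 h1 N _)
      refine (mul_le_of_le_one_left (wpRatio_nonneg h0 h1 N 0) this).trans ?_
      unfold wpRatio
      push_cast
      have : 0 < (2 * 0 + 4 * N + 3 - x) := by linarith
      rw [div_le_div_iff₀ (by positivity) (by positivity)]
      have : (2 * N + 1) * (1 + x) * (N + 1) ≤ (2 * N + 1) * (3 / 2) * (N + 1 : ℝ) := by
        gcongr; linarith
      nlinarith
    simpa using squeeze_zero (fun N => wpTerm_nonneg h0 h1 N (j + 1)) hb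
      tendsto_one_div_add_atTop_nhds_zero_nat

lemma tendsto_tsum_wpTerm (h0 : 0 ≤ x) (h1 : x ≤ 1 / 2) :
    Tendsto (fun N => ∑' j, wpTerm x N j) atTop (𝓝 1) := by
  have := tendsto_tsum_of_dominated_convergence (summable_wpTerm_zero h0 h1)
    (tendsto_wpTerm h0 h1) (Eventually.of_forall fun N j => by
      rw [Real.norm_eq_abs, abs_of_nonneg (wpTerm_nonneg h0 h1 N j)]
      exact wpTerm_le_zero h0 h1 N j)
  simpa using this

/-- Partial products of `∏ (1 - x/(2i+2)) / (1 - x/(2i+1))`. -/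
noncomputable def altProd (x : ℝ) (M : ℕ) : ℝ :=
  ∏ i ∈ range M, (1 - x / (2 * i + 2)) / (1 - x / (2 * i + 1))

lemma prod_wpShift (h1 : x ≤ 1 / 2) (M : ℕ) :
    (∏ N ∈ range M, wpShift x N) * (1 - x / (4 * M + 1)) =
      (∏ N ∈ range M, wpShift 0 N) * (altProd x M * altProd x (2 * M) * (1 - x)) := by
  induction M with
  | zero => simp [altProd]
  | succ M ih =>
    have hN := M.cast_nonneg (α := ℝ)
    rw [prod_range_succ, prod_range_succ, altProd, altProd, show 2 * (M + 1) = 2 * M + 1 + 1 by ring,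
      prod_range_succ, prod_range_succ, prod_range_succ, ← altProd, ← altProd]
    have c1 : (2 * M + 1 - x) ≠ 0 := by linarith
    have c2 : (4 * M + 1 - x) ≠ 0 := by linarith
    have c3 : (4 * M + 3 - x) ≠ 0 := by linarith
    have c4 : (4 * M + 5 - x) ≠ 0 := by linarith
    have c5 : (4 * M + 2 - x) ≠ 0 := by linarith
    have c6 : (2 * M + 2 - x) ≠ 0 := by linarith
    have hd : (1 - x / (4 * M + 1)) ≠ 0 := by
      have : (4 * (M : ℝ) + 1) ≠ 0 := by positivity
      rw [one_sub_div this]; exact div_ne_zero c2 this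
    have key : wpShift x M * (1 - x / (4 * (M + 1 : ℕ) + 1)) = (1 - x / (4 * M + 1)) *
        (wpShift 0 M * ((1 - x / (2 * M + 2)) / (1 - x / (2 * M + 1)) *
          ((1 - x / (2 * (2 * M : ℕ) + 2)) / (1 - x / (2 * (2 * M : ℕ) + 1)) *
          ((1 - x / (2 * (2 * M + 1 : ℕ) + 2)) / (1 - x / (2 * (2 * M + 1 : ℕ) + 1)))))) := by
      unfold wpShift
      push_cast
      have e1 : (1 - x / (2 * M + 1)) = (2 * M + 1 - x) / (2 * M + 1) := by field_simp
      have e2 : (1 - x / (2 * (2 * M) + 1)) = (4 * M + 1 - x) / (4 * M + 1) := by field_simp; ring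
      have e3 : (1 - x / (2 * (2 * M + 1) + 1)) = (4 * M + 3 - x) / (4 * M + 3) := by
        field_simp; ring
      have e4 : (1 - x / (4 * (M + 1) + 1)) = (4 * M + 5 - x) / (4 * M + 5) := by
        field_simp; ring
      have e5 : (1 - x / (2 * M + 2)) = (2 * M + 2 - x) / (2 * M + 2) := by field_simp
      have e6 : (1 - x / (2 * (2 * M) + 2)) = (4 * M + 2 - x) / (4 * M + 2) := by
        field_simp; ring
      have e7 : (1 - x / (2 * (2 * M + 1) + 2)) = (4 * M + 4 - x) / (4 * M + 4) := by
        field_simp; ring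
      have e8 : (1 - x / (4 * M + 1)) = (4 * M + 1 - x) / (4 * M + 1) := by field_simp
      rw [e1, e2, e3, e4, e5, e6, e7, e8]
      simp only [sub_zero]
      generalize 2 * (M : ℝ) + 1 - x = p1 at *
      generalize 4 * (M : ℝ) + 1 - x = p2 at *
      generalize 4 * (M : ℝ) + 3 - x = p3 at *
      generalize 4 * (M : ℝ) + 5 - x = p4 at *
      generalize 4 * (M : ℝ) + 2 - x = p5 at *
      generalize 2 * (M : ℝ) + 2 - x = p6 at *
      generalize 4 * (M : ℝ) + 4 - x = p7 at *
      field_simp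
    rw [mul_assoc, key]
    linear_combination (wpShift 0 M * ((1 - x / (2 * M + 2)) / (1 - x / (2 * M + 1)) *
          ((1 - x / (2 * (2 * M : ℕ) + 2)) / (1 - x / (2 * (2 * M : ℕ) + 1)) *
          ((1 - x / (2 * (2 * M + 1 : ℕ) + 2)) / (1 - x / (2 * (2 * M + 1 : ℕ) + 1)))))) * ih

/-- The well-poised series at `N = 0` is, up to normalisation, the square of the limit of
`altProd x`. -/
lemma tsum_wpTerm_zero_eq (h0 : 0 ≤ x) (h1 : x ≤ 1 / 2) {E : ℝ}
    (hE : Tendsto (altProd x) atTop (𝓝 E)) :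
    ∑' j, wpTerm x 0 j = (1 - x) * (∑' j, wpTerm 0 0 j) * E ^ 2 := by
  have hA : Tendsto (fun M => ∏ N ∈ range M, wpShift x N) atTop (𝓝 (∑' j, wpTerm x 0 j)) := by
    have h := (tendsto_tsum_wpTerm h0 h1)
    have h' := (tendsto_const_nhds (x := ∑' j, wpTerm x 0 j)).div h one_ne_zero
    rw [div_one] at h'
    refine h'.congr' ?_
    filter_upwards [h.eventually_ne one_ne_zero] with M hM
    simp only [Pi.div_apply]
    rw [tsum_wpTerm_zero h0 h1 M, mul_div_assoc, div_self hM, mul_one]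
  have hB : Tendsto (fun M => ∏ N ∈ range M, wpShift 0 N) atTop (𝓝 (∑' j, wpTerm 0 0 j)) := by
    have h := (tendsto_tsum_wpTerm le_rfl (by norm_num : (0 : ℝ) ≤ 1 / 2))
    have h' := (tendsto_const_nhds (x := ∑' j, wpTerm 0 0 j)).div h one_ne_zero
    rw [div_one] at h'
    refine h'.congr' ?_
    filter_upwards [h.eventually_ne one_ne_zero] with M hM
    simp only [Pi.div_apply]
    rw [tsum_wpTerm_zero le_rfl (by norm_num) M, mul_div_assoc, div_self hM, mul_one]
  have hC : Tendsto (fun M : ℕ => 1 - x / (4 * M + 1)) atTop (𝓝 1) := by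
    have : Tendsto (fun M : ℕ => 4 * (M : ℝ) + 1) atTop atTop :=
      (tendsto_natCast_atTop_atTop.const_mul_atTop (by norm_num)).atTop_add tendsto_const_nhds
    simpa using (tendsto_const_nhds (x := (1 : ℝ))).sub
      ((tendsto_const_nhds (x := x)).div_atTop this)
  have hD : Tendsto (fun M => altProd x (2 * M)) atTop (𝓝 E) :=
    hE.comp (tendsto_id.const_mul_atTop' (by norm_num))
  have h1' := hA.mul hC
  have h2' := hB.mul ((hE.mul hD).mul_const (1 - x))
  simp only [prod_wpShift h1] at h1'
  have := tendsto_nhds_unique h1' h2'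
  rw [mul_one] at this
  rw [this]; ring

end TSum

namespace TSum

open Filter Topology Finset

/-- The alternating sum `∑ (1/(2i+1)^n - 1/(2i+2)^n)`. -/
noncomputable def altZeta (n : ℕ) : ℝ :=
  ∑' i : ℕ, ((1 / (2 * i + 1 : ℝ)) ^ n - (1 / (2 * i + 2 : ℝ)) ^ n)

lemma altZeta_term_nonneg (n i : ℕ) :
    0 ≤ (1 / (2 * i + 1 : ℝ)) ^ n - (1 / (2 * i + 2 : ℝ)) ^ n := by
  rw [sub_nonneg]
  gcongr
  norm_num

lemma sum_range_altZeta_le (n M : ℕ) :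
    ∑ i ∈ range M, ((1 / (2 * i + 1 : ℝ)) ^ n - (1 / (2 * i + 2 : ℝ)) ^ n) ≤ 1 := by
  calc _ ≤ ∑ i ∈ range M, ((1 / (2 * (i : ℕ) + 1 : ℝ)) ^ n - (1 / (2 * ((i + 1 : ℕ) : ℝ) + 1)) ^ n) := by
        refine sum_le_sum fun i _ => ?_
        have : 1 / (2 * ((i + 1 : ℕ) : ℝ) + 1) ≤ 1 / (2 * i + 2) := by
          push_cast
          exact one_div_le_one_div_of_le (by positivity) (by linarith)
        gcongr
    _ = 1 - (1 / (2 * (M : ℝ) + 1)) ^ n := by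
        rw [sum_range_sub' fun i : ℕ => (1 / (2 * (i : ℝ) + 1)) ^ n]
        simp
    _ ≤ 1 := by
        have : 0 ≤ (1 / (2 * (M : ℝ) + 1)) ^ n := by positivity
        linarith

lemma summable_altZeta (n : ℕ) :
    Summable fun i : ℕ => (1 / (2 * i + 1 : ℝ)) ^ n - (1 / (2 * i + 2 : ℝ)) ^ n :=
  summable_of_sum_range_le (altZeta_term_nonneg n) (sum_range_altZeta_le n)

lemma altZeta_nonneg (n : ℕ) : 0 ≤ altZeta n := tsum_nonneg (altZeta_term_nonneg n)

lemma altZeta_le_one (n : ℕ) : altZeta n ≤ 1 :=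
  Real.tsum_le_of_sum_range_le (altZeta_term_nonneg n) (sum_range_altZeta_le n)

lemma altZeta_one : altZeta 1 = Real.log 2 := by
  have h := (summable_altZeta 1).hasSum.tendsto_sum_nat
  refine tendsto_nhds_unique h ?_
  have e : ∀ M : ℕ, ∑ i ∈ range M, ((1 / (2 * i + 1 : ℝ)) ^ 1 - (1 / (2 * i + 2 : ℝ)) ^ 1)
      = (harmonic (2 * M) : ℝ) - harmonic M := by
    intro M
    induction M with
    | zero => simp
    | succ M ih =>
      rw [sum_range_succ, ih, show 2 * (M + 1) = 2 * M + 1 + 1 by ring, harmonic_succ,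
        harmonic_succ, harmonic_succ]
      push_cast
      field_simp
      ring
  have hH := Real.tendsto_harmonic_sub_log
  have hH2 : Tendsto (fun M : ℕ => (harmonic (2 * M) : ℝ) - Real.log ((2 * M : ℕ) : ℝ)) atTop
      (𝓝 Real.eulerMascheroniConstant) :=
    hH.comp (tendsto_id.const_mul_atTop' (by norm_num : 0 < 2))
  have := (hH2.sub hH).add_const (Real.log 2)
  simp only [sub_self, zero_add] at this
  refine this.congr' ?_
  filter_upwards [eventually_gt_atTop 0] with M hM
  have hM' : (M : ℝ) ≠ 0 := by positivity
  rw [e, Nat.cast_mul, Real.log_mul (by norm_num) hM']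
  push_cast
  ring

lemma summable_one_div_odd_pow {n : ℕ} (hn : 2 ≤ n) :
    Summable fun i : ℕ => (1 / (2 * i + 1 : ℝ)) ^ n := by
  have h : Summable fun i : ℕ => (1 / (i : ℝ)) ^ n := by
    simpa [one_div, inv_pow] using Real.summable_nat_pow_inv.mpr (by omega : 1 < n)
  have := h.comp_injective (i := fun i : ℕ => 2 * i + 1) (fun a b h => by simpa using h)
  refine this.congr fun i => ?_
  simp

lemma altZeta_eq {n : ℕ} (hn : 2 ≤ n) :
    altZeta n = 2 * (2 ^ (n - 1) - 1) / (2 ^ n - 1) * ∑' i : ℕ, (1 / (2 * i + 1 : ℝ)) ^ n := by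
  have h : Summable fun i : ℕ => (1 / ((i : ℝ) + 1)) ^ n := by
    have h : Summable fun i : ℕ => (1 / (i : ℝ)) ^ n := by
      simpa [one_div, inv_pow] using Real.summable_nat_pow_inv.mpr (by omega : 1 < n)
    simpa using (summable_nat_add_iff 1).mpr h
  have ho := summable_one_div_odd_pow hn
  have e1 : ∀ i : ℕ, (1 / (((2 * i : ℕ) : ℝ) + 1)) ^ n = (1 / (2 * i + 1 : ℝ)) ^ n := by
    intro i; push_cast; rfl
  have e2 : ∀ i : ℕ, (1 / (((2 * i + 1 : ℕ) : ℝ) + 1)) ^ n = (1 / (2 * i + 2 : ℝ)) ^ n := by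
    intro i; push_cast; ring_nf
  have e3 : ∀ i : ℕ, (1 / (2 * i + 2 : ℝ)) ^ n = (1 / 2) ^ n * (1 / ((i : ℝ) + 1)) ^ n := by
    intro i; rw [← mul_pow]; congr 1; field_simp
  have he : Summable fun i : ℕ => (1 / (2 * i + 2 : ℝ)) ^ n := by
    simp only [e3]; exact h.mul_left _
  have hz := tsum_even_add_odd (f := fun i : ℕ => (1 / ((i : ℝ) + 1)) ^ n)
    (by simpa only [e1] using ho) (by simpa only [e2] using he)
  simp only [e1, e2] at hz
  have hE : ∑' i : ℕ, (1 / (2 * i + 2 : ℝ)) ^ n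
      = (1 / 2) ^ n * ∑' i : ℕ, (1 / ((i : ℝ) + 1)) ^ n := by
    simp only [e3]; exact tsum_mul_left
  rw [altZeta, ho.tsum_sub he]
  rw [← hz] at hE
  obtain ⟨m, rfl⟩ : ∃ m, n = m + 1 := ⟨n - 1, by omega⟩
  have hp : (1 : ℝ) < 2 ^ (m + 1) := one_lt_pow₀ (by norm_num) (by omega)
  generalize ∑' i : ℕ, (1 / (2 * i + 2 : ℝ)) ^ (m + 1) = b at *
  generalize ∑' i : ℕ, (1 / (2 * i + 1 : ℝ)) ^ (m + 1) = a at *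
  have hp' : (2 : ℝ) ^ (m + 1) - 1 ≠ 0 := by linarith
  rw [Nat.add_sub_cancel, div_mul_eq_mul_div, eq_div_iff hp']
  rw [div_pow, one_pow, one_div, eq_inv_mul_iff_mul_eq₀ (by positivity)] at hE
  rw [pow_succ] at *
  linear_combination -hE

variable {x : ℝ}

lemma hasSum_log_altProd_factor (h0 : 0 ≤ x) (h1 : x ≤ 1 / 2) (i : ℕ) :
    HasSum (fun n : ℕ => x ^ (n + 1) / (n + 1) *
        ((1 / (2 * i + 1 : ℝ)) ^ (n + 1) - (1 / (2 * i + 2 : ℝ)) ^ (n + 1)))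
      (Real.log (1 - x / (2 * i + 2)) - Real.log (1 - x / (2 * i + 1))) := by
  have hb : ∀ c : ℝ, 1 ≤ c → |x / c| < 1 := by
    intro c hc
    rw [abs_of_nonneg (by positivity), div_lt_one (by linarith)]
    linarith
  have hi := i.cast_nonneg (α := ℝ)
  have a1 := Real.hasSum_pow_div_log_of_abs_lt_one (hb (2 * i + 1) (by linarith))
  have a2 := Real.hasSum_pow_div_log_of_abs_lt_one (hb (2 * i + 2) (by linarith))
  have h := a1.sub a2
  rw [neg_sub_neg] at h
  refine h.congr_fun fun n => ?_
  simp only [div_pow, one_pow]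
  ring

lemma summable_altZeta_series (h0 : 0 ≤ x) (h1 : x ≤ 1 / 2) :
    Summable fun n : ℕ => x ^ (n + 1) / (n + 1) * altZeta (n + 1) := by
  have hg : Summable fun n : ℕ => x ^ (n + 1) :=
    (summable_nat_add_iff 1).mpr (summable_geometric_of_lt_one h0 (by linarith))
  refine Summable.of_nonneg_of_le (fun n => ?_) (fun n => ?_) hg
  · have := altZeta_nonneg (n + 1); positivity
  · calc x ^ (n + 1) / (n + 1) * altZeta (n + 1) ≤ x ^ (n + 1) / 1 * 1 := by
          gcongr
          · exact altZeta_nonneg _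
          · linarith [n.cast_nonneg (α := ℝ)]
          · exact altZeta_le_one _
      _ = _ := by ring

lemma tendsto_altProd_exp (h0 : 0 ≤ x) (h1 : x ≤ 1 / 2) :
    Tendsto (fun M => ∏ i ∈ range M, (1 - x / (2 * i + 2)) / (1 - x / (2 * i + 1))) atTop
      (𝓝 (Real.exp (∑' n : ℕ, x ^ (n + 1) / (n + 1) * altZeta (n + 1)))) := by
  set f : ℕ → ℕ → ℝ := fun n i => x ^ (n + 1) / (n + 1) *
        ((1 / (2 * i + 1 : ℝ)) ^ (n + 1) - (1 / (2 * i + 2 : ℝ)) ^ (n + 1)) with hf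
  have hn : ∀ n, HasSum (f n) (x ^ (n + 1) / (n + 1) * altZeta (n + 1)) :=
    fun n => (summable_altZeta (n + 1)).hasSum.mul_left _
  have hpos : 0 ≤ Function.uncurry f := fun p =>
    mul_nonneg (by positivity) (altZeta_term_nonneg _ _)
  have hs : Summable (Function.uncurry f) := by
    rw [summable_prod_of_nonneg hpos]
    refine ⟨fun n => (hn n).summable, ?_⟩
    refine (summable_altZeta_series h0 h1).congr fun n => ?_
    exact (hn n).tsum_eq.symm
  have hs' : HasSum (fun p : ℕ × ℕ => f p.2 p.1)
      (∑' n : ℕ, x ^ (n + 1) / (n + 1) * altZeta (n + 1)) := by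
    have h3 : HasSum (Function.uncurry f) (∑' n : ℕ, x ^ (n + 1) / (n + 1) * altZeta (n + 1)) := by
      have := hs.tsum_prod
      rw [← tsum_congr fun n => (hn n).tsum_eq]
      exact this ▸ hs.hasSum
    exact (Equiv.prodComm ℕ ℕ).hasSum_iff.mpr h3
  have hL := (hs'.prod_fiberwise fun i => hasSum_log_altProd_factor h0 h1 i).tendsto_sum_nat
  refine (Real.continuous_exp.tendsto _ |>.comp hL).congr fun M => ?_
  have hi := fun i : ℕ => i.cast_nonneg (α := ℝ)
  simp only [Function.comp_apply, Real.exp_sum]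
  refine prod_congr rfl fun i _ => ?_
  have hb : ∀ c : ℝ, 1 ≤ c → 0 < 1 - x / c := by
    intro c hc
    rw [sub_pos, div_lt_one (by linarith)]
    linarith
  rw [Real.exp_sub, Real.exp_log (hb _ (by linarith [hi i])), Real.exp_log (hb _ (by linarith [hi i]))]

end TSum

namespace TSum

open Finset

/-- Add one to the first entry of an index. -/
def incHead : List ℕ → List ℕ
  | [] => []
  | x :: l => (x + 1) :: l

@[simp] lemma length_incHead (l : List ℕ) : (incHead l).length = l.length := by
  cases l <;> rfl

lemma incHead_injective : Function.Injective incHead := by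
  rintro (_ | ⟨x, l⟩) (_ | ⟨y, l'⟩) h <;> simp_all [incHead]

/-- Compositions of `s + 1`, as a finset of lists. -/
def comps : ℕ → Finset (List ℕ)
  | 0 => {[1]}
  | s + 1 => (comps s).image (List.cons 1) ∪ (comps s).image incHead

lemma mem_comps {s : ℕ} {l : List ℕ} : l ∈ comps s ↔ (∀ i ∈ l, 1 ≤ i) ∧ l.sum = s + 1 := by
  induction s generalizing l with
  | zero =>
    simp only [comps, mem_singleton, zero_add]
    constructor
    · rintro rfl; simp
    · rintro ⟨h, hs⟩
      rcases l with _ | ⟨x, _ | ⟨y, l⟩⟩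
      · simp at hs
      · simpa using hs
      · simp only [List.mem_cons, forall_eq_or_imp, List.sum_cons] at h hs
        omega
  | succ s ih =>
    simp only [comps, mem_union, mem_image, ih]
    constructor
    · rintro (⟨l, ⟨h, hs⟩, rfl⟩ | ⟨l, ⟨h, hs⟩, rfl⟩)
      · simp only [List.mem_cons, forall_eq_or_imp, List.sum_cons]
        exact ⟨⟨le_rfl, h⟩, by omega⟩
      · rcases l with _ | ⟨x, l⟩
        · simp at hs
        · simp only [incHead, List.mem_cons, forall_eq_or_imp, List.sum_cons] at h hs ⊢
          exact ⟨⟨by omega, h.2⟩, by omega⟩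
    · rintro ⟨h, hs⟩
      rcases l with _ | ⟨x, l⟩
      · simp at hs
      · simp only [List.mem_cons, forall_eq_or_imp, List.sum_cons] at h hs
        rcases h.1.eq_or_lt with rfl | hx
        · exact Or.inl ⟨l, ⟨h.2, by omega⟩, rfl⟩
        · refine Or.inr ⟨(x - 1) :: l, ⟨?_, ?_⟩, ?_⟩
          · simp only [List.mem_cons, forall_eq_or_imp]
            exact ⟨by omega, h.2⟩
          · simp only [List.sum_cons]; omega
          · simp only [incHead]; congr 1; omega

lemma sum_comps_succ {M : Type*} [AddCommMonoid M] (s : ℕ) (f : List ℕ → M) :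
    ∑ l ∈ comps (s + 1), f l = ∑ l ∈ comps s, f (1 :: l) + ∑ l ∈ comps s, f (incHead l) := by
  rw [comps, sum_union, sum_image (fun _ _ _ _ h => (List.cons.inj h).2),
    sum_image (fun _ _ _ _ h => incHead_injective h)]
  rw [disjoint_left]
  simp only [mem_image, not_exists, not_and]
  rintro _ ⟨l, -, rfl⟩ l' hl' h
  rcases l' with _ | ⟨x, l'⟩
  · simp [mem_comps] at hl'
  · simp only [incHead, List.cons.injEq] at h
    have := (mem_comps.mp hl').1 x (by simp)
    omega

lemma comps_ne_nil {s : ℕ} {l : List ℕ} (h : l ∈ comps s) : l ≠ [] := by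
  rintro rfl; simp [mem_comps] at h

lemma length_le_of_mem_comps {s : ℕ} {l : List ℕ} (h : l ∈ comps s) : l.length ≤ s + 1 := by
  rw [mem_comps] at h
  rw [← h.2]
  have := List.card_nsmul_le_sum l 1 h.1
  simpa using this

lemma groupings_incHead : ∀ l : List ℕ, groupings (incHead l) = (groupings l).map incHead
  | [] => by simp [incHead, groupings]
  | [x] => by simp [incHead, groupings]
  | x :: y :: rest => by
    have ih := groupings_incHead ((x + y) :: rest)
    simp only [incHead, groupings, List.map_append, List.map_map] at ih ⊢
    rw [show x + 1 + y = x + y + 1 by ring, ih]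
    rfl
termination_by l => l.length

lemma length_le_of_mem_groupings : ∀ {l p : List ℕ}, p ∈ groupings l → p.length ≤ l.length
  | [], p => by simp [groupings]
  | [x], p => by simp only [groupings, List.mem_singleton]; rintro rfl; simp
  | x :: y :: rest, p => by
    simp only [groupings, List.mem_append, List.mem_map]
    rintro (⟨q, hq, rfl⟩ | h)
    · simpa using length_le_of_mem_groupings hq
    · have := length_le_of_mem_groupings h
      simp only [List.length_cons] at this ⊢
      omega
termination_by l => l.length

/-- Interpolation in `r` of a function on indices. -/
def interp (r : ℝ) (T : List ℕ → ℝ) (l : List ℕ) : ℝ :=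
  ((groupings l).map fun p => r ^ (l.length - p.length) * T p).sum

lemma interp_incHead (r : ℝ) (T : List ℕ → ℝ) (l : List ℕ) :
    interp r T (incHead l) = interp r (T ∘ incHead) l := by
  simp only [interp, groupings_incHead, List.map_map, length_incHead]
  congr 1
  simp [Function.comp_def]

lemma interp_one_cons (r : ℝ) (T : List ℕ → ℝ) {l : List ℕ} (hl : l ≠ []) :
    interp r T (1 :: l) = interp r (fun p => T (1 :: p)) l + r * interp r (T ∘ incHead) l := by
  rcases l with _ | ⟨y, rest⟩
  · exact absurd rfl hl
  have h : groupings (1 :: y :: rest) = (groupings (y :: rest)).map (1 :: ·) ++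
      (groupings (y :: rest)).map incHead := by
    rw [groupings, ← groupings_incHead, incHead, add_comm 1 y]
  rw [interp, h, List.map_append, List.sum_append, List.map_map, List.map_map, interp, interp,
    ← List.sum_map_mul_left]
  congr 2
  · refine List.map_congr_left fun p _ => ?_
    simp
  · refine List.map_congr_left fun p hp => ?_
    have := length_le_of_mem_groupings hp
    simp only [Function.comp_apply, length_incHead]
    rw [List.length_cons, Nat.sub_add_comm this, pow_succ]
    ring

lemma sum_interp (r : ℝ) (s : ℕ) (T : List ℕ → ℝ) :
    ∑ l ∈ comps s, (1 - 2 * r) ^ (s + 1 - l.length) * 2 ^ l.length * interp r T l =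
      ∑ p ∈ comps s, 2 ^ p.length * T p := by
  induction s generalizing T with
  | zero => simp [comps, interp, groupings]
  | succ s ih =>
    rw [sum_comps_succ, sum_comps_succ]
    have e1 : ∑ p ∈ comps s, 2 ^ (1 :: p).length * T (1 :: p) =
        2 * ∑ p ∈ comps s, 2 ^ p.length * T (1 :: p) := by
      rw [mul_sum]
      refine sum_congr rfl fun p _ => ?_
      rw [List.length_cons, pow_succ]; ring
    have e2 : ∑ p ∈ comps s, 2 ^ (incHead p).length * T (incHead p) =
        ∑ p ∈ comps s, 2 ^ p.length * (T ∘ incHead) p := by simp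
    rw [e1, e2, ← ih fun p => T (1 :: p), ← ih (T ∘ incHead), mul_sum, ← sum_add_distrib,
      ← sum_add_distrib]
    refine sum_congr rfl fun l hl => ?_
    have h1 := length_le_of_mem_comps hl
    rw [interp_incHead, interp_one_cons r T (comps_ne_nil hl), length_incHead, List.length_cons,
      show s + 1 + 1 - (l.length + 1) = s + 1 - l.length by omega,
      show s + 1 + 1 - l.length = s + 1 - l.length + 1 by omega, pow_succ, pow_succ]
    ring

lemma isAdmissible_iff {s n : ℕ} {l : List ℕ} :
    IsAdmissible l ∧ l.sum = s + 2 ∧ l.length = n ↔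
      l ∈ {l ∈ (comps s).image incHead | l.length = n} := by
  simp only [mem_filter, mem_image, mem_comps, IsAdmissible, ← and_assoc]
  refine and_congr_left fun _ => ?_
  constructor
  · rintro ⟨⟨h, h2⟩, hs⟩
    rcases l with _ | ⟨x, l⟩
    · simp at hs
    · simp only [List.mem_cons, forall_eq_or_imp, List.sum_cons, List.headI_cons] at h hs h2
      refine ⟨(x - 1) :: l, ⟨?_, ?_⟩, ?_⟩
      · simp only [List.mem_cons, forall_eq_or_imp]
        exact ⟨by omega, h.2⟩
      · simp only [List.sum_cons]; omega
      · simp only [incHead]; congr 1; omega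
  · rintro ⟨l', ⟨h, hs⟩, rfl⟩
    rcases l' with _ | ⟨x, l'⟩
    · simp at hs
    · simp only [incHead, List.mem_cons, forall_eq_or_imp, List.sum_cons, List.headI_cons] at h hs ⊢
      exact ⟨⟨⟨by omega, h.2⟩, by omega⟩, by omega⟩

lemma X0d_eq (a : ℕ) (r : ℝ) (s n : ℕ) :
    X0d a r (s + 2) n = ∑ l ∈ comps s with l.length = n, interp r (tv (2 * a) a ∘ incHead) l := by
  have hset : {l : List ℕ | IsAdmissible l ∧ l.sum = s + 2 ∧ l.length = n} =
      ↑({l ∈ (comps s).image incHead | l.length = n}) := by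
    ext l; exact isAdmissible_iff
  have : X0d a r (s + 2) n =
      ∑' l : {l : List ℕ | IsAdmissible l ∧ l.sum = s + 2 ∧ l.length = n}, itv (2 * a) a r l := rfl
  rw [this, hset, Finset.tsum_subtype', filter_image, sum_image fun _ _ _ _ h => incHead_injective h]
  simp only [length_incHead]
  refine sum_congr rfl fun l _ => ?_
  rw [← interp_incHead]
  rfl

/-- The weighted sum over depths does not depend on the interpolation parameter. -/
lemma sum_X0d (a : ℕ) (r : ℝ) (s : ℕ) :
    ∑ n ∈ Icc 1 (s + 1), (1 - 2 * r) ^ (s + 2 - n - 1) * 2 ^ (n - 1) * X0d a r (s + 2) n =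
      ∑ p ∈ comps s, 2 ^ (p.length - 1) * tv (2 * a) a (incHead p) := by
  have hmaps : ∀ l ∈ comps s, l.length ∈ Icc 1 (s + 1) := fun l hl =>
    mem_Icc.mpr ⟨List.length_pos_of_ne_nil (comps_ne_nil hl), length_le_of_mem_comps hl⟩
  have hpow : ∀ l ∈ comps s, (2 : ℝ) ^ (l.length - 1) = 2 ^ l.length / 2 := fun l hl => by
    rw [pow_sub₀ _ two_ne_zero (mem_Icc.mp (hmaps l hl)).1]; ring
  have h := sum_interp r s (tv (2 * a) a ∘ incHead)
  have e : ∑ p ∈ comps s, 2 ^ (p.length - 1) * tv (2 * a) a (incHead p) =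
      (∑ p ∈ comps s, 2 ^ p.length * (tv (2 * a) a ∘ incHead) p) / 2 := by
    rw [sum_div]
    exact sum_congr rfl fun p hp => by rw [hpow p hp, Function.comp_apply]; ring
  rw [e, ← h, sum_div, ← sum_fiberwise_of_maps_to hmaps]
  refine sum_congr rfl fun n _ => ?_
  rw [X0d_eq, mul_sum]
  refine sum_congr rfl fun l hl => ?_
  obtain ⟨hl', rfl⟩ := mem_filter.mp hl
  rw [hpow l hl', show s + 2 - l.length - 1 = s + 1 - l.length by omega]
  ring

end TSum

namespace TSum

open Finset
open scoped ENNReal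

/-- The reciprocal of the `k`-th power of the `i`-th odd number. -/
noncomputable def oddInv (k i : ℕ) : ℝ≥0∞ := (((2 * i + 1 : ℕ) : ℝ≥0∞) ^ k)⁻¹

/-- Truncated multiple `t`-sum over decreasing sequences of odd numbers `2 * i + 1` with `i < m`. -/
noncomputable def truncT : ℕ → List ℕ → ℝ≥0∞
  | _, [] => 1
  | m, k :: ks => ∑ j ∈ range m, oddInv k j * truncT j ks

/-- The multiple `t`-sum over all odd numbers, with values in `[0, ∞]`. -/
noncomputable def fullT : List ℕ → ℝ≥0∞
  | [] => 1
  | k :: ks => ∑' m, oddInv k m * truncT m ks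

lemma strictAnti_cons {n m : ℕ} {g : Fin n → ℕ} :
    StrictAnti (Fin.cons m g : Fin (n + 1) → ℕ) ↔ StrictAnti g ∧ ∀ i, g i < m := by
  constructor
  · intro h
    refine ⟨fun i j hij => ?_, fun i => ?_⟩
    · simpa using h (Fin.succ_lt_succ_iff.mpr hij)
    · simpa using h (Fin.succ_pos i)
  · rintro ⟨h, hm⟩ i j hij
    rcases Fin.eq_zero_or_eq_succ j with rfl | ⟨j, rfl⟩
    · exact absurd hij (Fin.not_lt_zero _)
    · rcases Fin.eq_zero_or_eq_succ i with rfl | ⟨i, rfl⟩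
      · simpa using hm j
      · simpa using h (Fin.succ_lt_succ_iff.mp hij)

open Classical in
lemma tsum_strictAnti_cons (k : ℕ) (ks : List ℕ) (Q : ℕ → Prop) :
    (∑' g : Fin (k :: ks).length → ℕ, if StrictAnti g ∧ ∀ i, Q (g i) then
        ∏ i, oddInv ((k :: ks).get i) (g i) else 0) =
      ∑' m, if Q m then oddInv k m * ∑' g : Fin ks.length → ℕ,
        (if StrictAnti g ∧ ∀ i, g i < m ∧ Q (g i) then ∏ i, oddInv (ks.get i) (g i) else 0)
        else 0 := by
  refine ((Fin.consEquiv fun _ : Fin (ks.length + 1) => ℕ).tsum_eq _).symm.trans ?_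
  rw [ENNReal.tsum_prod']
  refine tsum_congr fun m => ?_
  split_ifs with hm
  · rw [← ENNReal.tsum_mul_left]
    refine tsum_congr fun g => ?_
    have hiff : (StrictAnti (Fin.cons m g : Fin (ks.length + 1) → ℕ) ∧
        ∀ i, Q ((Fin.cons m g : Fin (ks.length + 1) → ℕ) i)) ↔
        (StrictAnti g ∧ ∀ i, g i < m ∧ Q (g i)) := by
      rw [strictAnti_cons, Fin.forall_fin_succ]
      simp only [Fin.cons_zero, Fin.cons_succ, forall_and]
      tauto
    rw [mul_ite, mul_zero]
    refine if_congr hiff ?_ rfl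
    exact (Fin.prod_univ_succ _).trans (by simp [Fin.consEquiv])
  · rw [ENNReal.tsum_eq_zero]
    intro g
    refine if_neg fun h => hm ?_
    simpa [Fin.consEquiv] using h.2 0

open Classical in
lemma tsum_strictAnti_lt (ks : List ℕ) (m : ℕ) :
    (∑' g : Fin ks.length → ℕ, if StrictAnti g ∧ ∀ i, g i < m then
        ∏ i, oddInv (ks.get i) (g i) else 0) = truncT m ks := by
  induction ks generalizing m with
  | nil =>
    have h : ∀ g : Fin ([] : List ℕ).length → ℕ, StrictAnti g ∧ ∀ i, g i < m :=
      fun g => ⟨fun i => i.elim0, fun i => i.elim0⟩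
    simp only [h, truncT]
    exact (tsum_eq_single (Fin.elim0 : Fin 0 → ℕ)
      fun g hg => absurd (Subsingleton.elim _ _) hg).trans (by simp)
  | cons k ks ih =>
    have h := tsum_strictAnti_cons k ks (· < m)
    rw [tsum_eq_sum (s := range m)] at h
    · refine Eq.trans (by congr!) (h.trans ?_)
      rw [truncT]
      refine sum_congr rfl fun j hj => ?_
      have hj := mem_range.mp hj
      rw [if_pos hj, ← ih j]
      congr 2 with g
      have hiff : (StrictAnti g ∧ ∀ i, g i < j ∧ g i < m) ↔ (StrictAnti g ∧ ∀ i, g i < j) :=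
        and_congr_right fun _ => forall_congr' fun i => ⟨fun h => h.1, fun h => ⟨h, h.trans hj⟩⟩
      simp only [hiff]
    · intro j hj
      rw [if_neg]
      simpa using hj

open Classical in
lemma tsum_strictAnti (ks : List ℕ) :
    (∑' g : Fin ks.length → ℕ, if StrictAnti g then
        ∏ i, oddInv (ks.get i) (g i) else 0) = fullT ks := by
  rcases ks with _ | ⟨k, ks⟩
  · have h : ∀ g : Fin ([] : List ℕ).length → ℕ, StrictAnti g := fun g i => i.elim0
    simp only [h, fullT]
    exact (tsum_eq_single (Fin.elim0 : Fin 0 → ℕ)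
      fun g hg => absurd (Subsingleton.elim _ _) hg).trans (by simp)
  · have := tsum_strictAnti_cons k ks fun _ => True
    simp only [and_true, implies_true, if_true] at this
    rw [this, fullT]
    simp only [tsum_strictAnti_lt]

/-- Positive integers congruent to `a` modulo `2 * a` are the odd multiples of `a`. -/
lemma mod_two_mul_iff {a m : ℕ} (ha : 1 ≤ a) :
    0 < m ∧ m % (2 * a) = a % (2 * a) ↔ ∃ i, m = a * (2 * i + 1) := by
  rw [Nat.mod_eq_of_lt (show a < 2 * a by omega)]
  constructor
  · rintro ⟨-, h⟩
    refine ⟨m / (2 * a), ?_⟩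
    conv_lhs => rw [← Nat.div_add_mod m (2 * a), h]
    ring
  · rintro ⟨i, rfl⟩
    refine ⟨by positivity, ?_⟩
    rw [show a * (2 * i + 1) = a + 2 * a * i by ring, Nat.add_mul_mod_self_left,
      Nat.mod_eq_of_lt (by omega)]

/-- Strictly decreasing sequences in the residue class of `a` modulo `2 * a`. -/
noncomputable def residueEquiv {a : ℕ} (ha : 1 ≤ a) (n : ℕ) :
    {g : Fin n → ℕ // StrictAnti g} ≃
      {f : Fin n → ℕ // StrictAnti f ∧ ∀ i, 0 < f i ∧ f i % (2 * a) = a % (2 * a)} where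
  toFun g := ⟨fun i => a * (2 * g.1 i + 1), fun i j hij => by
    have h : g.1 j < g.1 i := g.2 hij
    exact Nat.mul_lt_mul_of_pos_left (by omega) ha, fun i => (mod_two_mul_iff ha).mpr ⟨_, rfl⟩⟩
  invFun f := ⟨fun i => ((mod_two_mul_iff ha).mp (f.2.2 i)).choose, fun i j hij => by
    have h := f.2.1 hij
    rw [((mod_two_mul_iff ha).mp (f.2.2 i)).choose_spec,
      ((mod_two_mul_iff ha).mp (f.2.2 j)).choose_spec] at h
    have := lt_of_mul_lt_mul_left h (Nat.zero_le a)
    dsimp only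
    omega⟩
  left_inv g := by
    ext i
    have h := ((mod_two_mul_iff ha).mp ((mod_two_mul_iff ha).mpr ⟨g.1 i, rfl⟩)).choose_spec
    have := Nat.eq_of_mul_eq_mul_left ha h
    show Exists.choose _ = _
    omega
  right_inv f := by
    ext i
    exact ((mod_two_mul_iff ha).mp (f.2.2 i)).choose_spec.symm

lemma prod_pow_get (c : ℝ) (p : List ℕ) : ∏ i : Fin p.length, c ^ p.get i = c ^ p.sum := by
  rw [prod_pow_eq_pow_sum, ← List.sum_ofFn, List.ofFn_get]

lemma tv_eq {a : ℕ} (ha : 1 ≤ a) (p : List ℕ) :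
    tv (2 * a) a p = ((a : ℝ) ^ p.sum)⁻¹ * (fullT p).toReal := by
  classical
  have hne : ∀ k i, oddInv k i ≠ ∞ := fun k i => by
    rw [oddInv, ENNReal.inv_ne_top]
    exact pow_ne_zero _ (by simp)
  have hterm : ∀ c : {g : Fin p.length → ℕ // StrictAnti g},
      ∏ i, (((residueEquiv ha p.length c).1 i : ℝ) ^ p.get i)⁻¹ =
        ((a : ℝ) ^ p.sum)⁻¹ * (∏ i, oddInv (p.get i) (c.1 i)).toReal := fun c => by
    rw [← prod_pow_get, ← prod_inv_distrib, ENNReal.toReal_prod, ← prod_mul_distrib]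
    refine prod_congr rfl fun i _ => ?_
    rw [oddInv, ENNReal.toReal_inv, ENNReal.toReal_pow, ENNReal.toReal_natCast, ← mul_inv,
      ← mul_pow, ← Nat.cast_mul]
    rfl
  rw [tv, ← (residueEquiv ha _).tsum_eq]
  simp only [hterm]
  rw [tsum_mul_left, ← ENNReal.tsum_toReal_eq fun c => ENNReal.prod_ne_top fun i _ => hne _ _,
    ← tsum_strictAnti]
  congr 2
  refine (tsum_subtype {g : Fin p.length → ℕ | StrictAnti g}
    fun g => ∏ i, oddInv (p.get i) (g i)).trans ?_
  refine tsum_congr fun g => ?_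
  simp [Set.indicator_apply]

end TSum

namespace TSum

open Finset
open scoped ENNReal

lemma tsum_list (f : List ℕ → ℝ≥0∞) : ∑' l, f l = f [] + ∑' k, ∑' ks, f (k :: ks) := by
  let e : Unit ⊕ ℕ × List ℕ ≃ List ℕ :=
    { toFun := Sum.elim (fun _ => []) fun p => p.1 :: p.2
      invFun := fun l => match l with
        | [] => Sum.inl ()
        | k :: ks => Sum.inr (k, ks)
      left_inv := by rintro (_ | _) <;> rfl
      right_inv := by rintro (_ | _) <;> rfl }
  rw [← e.tsum_eq, Summable.tsum_sum ENNReal.summable ENNReal.summable, ENNReal.tsum_prod']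
  simp [e]

/-- Generating function of truncated sums. -/
noncomputable def truncGen (w : ℕ → ℝ≥0∞) (M : ℕ) : ℝ≥0∞ :=
  ∑' l : List ℕ, (l.map w).prod * truncT M l

lemma truncGen_zero (w : ℕ → ℝ≥0∞) : truncGen w 0 = 1 := by
  rw [truncGen, tsum_list]
  simp [truncT]

lemma truncGen_succ (w : ℕ → ℝ≥0∞) (M : ℕ) :
    truncGen w (M + 1) = truncGen w M * (1 + ∑' k, w k * oddInv k M) := by
  have h : ∀ k, ∑' ks, ((k :: ks).map w).prod * truncT (M + 1) (k :: ks) =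
      ∑' ks, ((k :: ks).map w).prod * truncT M (k :: ks) + truncGen w M * (w k * oddInv k M) := by
    intro k
    rw [truncGen, ← ENNReal.tsum_mul_right, ← ENNReal.tsum_add]
    refine tsum_congr fun ks => ?_
    rw [truncT, truncT, sum_range_succ, List.map_cons, List.prod_cons]
    ring
  rw [mul_add, mul_one, ← ENNReal.tsum_mul_left]
  conv_lhs => rw [truncGen, tsum_list]
  simp only [h]
  rw [ENNReal.tsum_add, ← add_assoc]
  congr 1
  conv_rhs => rw [truncGen, tsum_list]
  simp [truncT]

lemma oddInv_eq (k i : ℕ) : oddInv k i = ENNReal.ofReal ((1 / (2 * i + 1 : ℝ)) ^ k) := by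
  rw [oddInv, one_div, inv_pow, ENNReal.ofReal_inv_of_pos (by positivity),
    ENNReal.ofReal_pow (by positivity)]
  norm_cast

/-- Weight of a non-leading entry. -/
noncomputable def tailWeight (x : ℝ) (i : ℕ) : ℝ≥0∞ :=
  if 1 ≤ i then ENNReal.ofReal (2 * x ^ i) else 0

/-- Weight of the leading entry. -/
noncomputable def headWeight (x : ℝ) (i : ℕ) : ℝ≥0∞ :=
  if 1 ≤ i then ENNReal.ofReal (x ^ (i - 1)) else 0

lemma tsum_ofReal_geometric {c q : ℝ} (hc : 0 ≤ c) (h0 : 0 ≤ q) (h1 : q < 1) :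
    ∑' k : ℕ, ENNReal.ofReal (c * q ^ k) = ENNReal.ofReal (c / (1 - q)) := by
  rw [← ENNReal.ofReal_tsum_of_nonneg (fun k => by positivity)
    ((summable_geometric_of_lt_one h0 h1).mul_left c), tsum_mul_left,
    tsum_geometric_of_lt_one h0 h1, div_eq_mul_inv]

lemma tsum_tailWeight {x : ℝ} (h0 : 0 ≤ x) (h1 : x ≤ 1 / 2) (M : ℕ) :
    ∑' k, tailWeight x k * oddInv k M = ENNReal.ofReal (2 * x / (2 * M + 1 - x)) := by
  have hM : (0 : ℝ) ≤ M := M.cast_nonneg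
  have hq : x / (2 * M + 1) < 1 := by rw [div_lt_one (by positivity)]; linarith
  rw [tsum_eq_zero_add' ENNReal.summable]
  have : ∀ k, tailWeight x (k + 1) * oddInv (k + 1) M =
      ENNReal.ofReal (2 * (x / (2 * M + 1)) * (x / (2 * M + 1)) ^ k) := fun k => by
    rw [tailWeight, if_pos (by omega), oddInv_eq, ← ENNReal.ofReal_mul (by positivity)]
    congr 1
    rw [one_div, div_eq_mul_inv, mul_pow, pow_succ, pow_succ]
    ring
  simp only [this]
  rw [tsum_ofReal_geometric (by positivity) (by positivity) hq, tailWeight, if_neg (by omega),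
    zero_mul, zero_add]
  congr 1
  have h2 : 2 * (M : ℝ) + 1 - x ≠ 0 := by linarith
  have h3 : 2 * (M : ℝ) + 1 ≠ 0 := by positivity
  rw [one_sub_div h3, mul_div_assoc', div_div_div_cancel_right₀ h3]

lemma tsum_headWeight {x : ℝ} (h0 : 0 ≤ x) (h1 : x ≤ 1 / 2) (M : ℕ) :
    ∑' k, headWeight x k * oddInv (k + 1) M =
      ENNReal.ofReal (1 / ((2 * M + 1) * (2 * M + 1 - x))) := by
  have hM : (0 : ℝ) ≤ M := M.cast_nonneg
  have hq : x / (2 * M + 1) < 1 := by rw [div_lt_one (by positivity)]; linarith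
  rw [tsum_eq_zero_add' ENNReal.summable]
  have : ∀ k, headWeight x (k + 1) * oddInv (k + 1 + 1) M =
      ENNReal.ofReal ((1 / (2 * M + 1)) ^ 2 * (x / (2 * M + 1)) ^ k) := fun k => by
    rw [headWeight, if_pos (by omega), oddInv_eq, ← ENNReal.ofReal_mul (by positivity)]
    congr 1
    rw [one_div, div_eq_mul_inv, mul_pow, Nat.add_sub_cancel]
    ring
  simp only [this]
  rw [tsum_ofReal_geometric (by positivity) (by positivity) hq, headWeight, if_neg (by omega),
    zero_mul, zero_add]
  congr 1
  have h3 : 2 * (M : ℝ) + 1 ≠ 0 := by positivity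
  have h2 : 2 * (M : ℝ) + 1 - x ≠ 0 := by linarith
  rw [one_sub_div h3]
  generalize 2 * (M : ℝ) + 1 - x = y at *
  field_simp

lemma truncGen_tailWeight {x : ℝ} (h0 : 0 ≤ x) (h1 : x ≤ 1 / 2) (M : ℕ) :
    truncGen (tailWeight x) M =
      ENNReal.ofReal (∏ l ∈ range M, (2 * l + 1 + x) / (2 * l + 1 - x)) := by
  induction M with
  | zero => simp [truncGen_zero]
  | succ M ih =>
    have hM : (0 : ℝ) ≤ M := M.cast_nonneg
    have h2 : 0 < 2 * (M : ℝ) + 1 - x := by linarith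
    rw [truncGen_succ, ih, tsum_tailWeight h0 h1, prod_range_succ, ← ENNReal.ofReal_one,
      ← ENNReal.ofReal_add zero_le_one (by positivity), ENNReal.ofReal_mul]
    · congr 2
      rw [one_add_div h2.ne']
      congr 1; ring
    · refine prod_nonneg fun l _ => ?_
      have hl : (0 : ℝ) ≤ l := l.cast_nonneg
      exact div_nonneg (by positivity) (by linarith)

lemma prod_div_eq_wpTerm {x : ℝ} (h1 : x ≤ 1 / 2) (m : ℕ) :
    1 / ((2 * m + 1) * (2 * m + 1 - x)) * ∏ l ∈ range m, (2 * l + 1 + x) / (2 * l + 1 - x) =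
      wpTerm x 0 m / (1 - x) := by
  induction m with
  | zero => simp [wpTerm]
  | succ m ih =>
    have hM : (0 : ℝ) ≤ m := m.cast_nonneg
    have h2 : 2 * (m : ℝ) + 1 - x ≠ 0 := by linarith
    have h3 : 2 * (m : ℝ) + 3 - x ≠ 0 := by linarith
    rw [wpTerm_succ_right, mul_div_right_comm, ← ih, prod_range_succ, wpRatio]
    generalize ∏ l ∈ range m, (2 * (l : ℝ) + 1 + x) / (2 * l + 1 - x) = P
    push_cast
    rw [show 2 * ((m : ℝ) + 1) + 1 - x = 2 * m + 3 - x by ring,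
      show 2 * (m : ℝ) + 4 * 0 + 3 - x = 2 * m + 3 - x by ring]
    generalize 2 * (m : ℝ) + 3 - x = z at *
    generalize 2 * (m : ℝ) + 1 - x = y at *
    have h4 : 2 * ((m : ℝ) + 1) + 1 ≠ 0 := by positivity
    have h5 : 2 * (m : ℝ) + 4 * 0 + 3 ≠ 0 := by positivity
    field_simp
    ring

lemma prod_map_ite (b : ℕ) (w : ℕ → ℝ≥0∞) (l : List ℕ) :
    (l.map fun i => if b ≤ i then w i else 0).prod =
      if ∀ i ∈ l, b ≤ i then (l.map w).prod else 0 := by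
  induction l with
  | nil => simp
  | cons k ks ih =>
    rw [List.map_cons, List.prod_cons, ih]
    by_cases h : b ≤ k <;> by_cases h' : ∀ i ∈ ks, b ≤ i <;> simp [h, h']

lemma prod_map_two_mul_pow {x : ℝ} (h0 : 0 ≤ x) (l : List ℕ) :
    (l.map fun i => ENNReal.ofReal (2 * x ^ i)).prod = ENNReal.ofReal x ^ l.sum * 2 ^ l.length := by
  induction l with
  | nil => simp
  | cons k ks ih =>
    rw [List.map_cons, List.prod_cons, ih, ENNReal.ofReal_mul zero_le_two, ENNReal.ofReal_pow h0,
      List.sum_cons, List.length_cons, pow_add, pow_succ, ENNReal.ofReal_ofNat]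
    ring

/-- Coefficients of the generating function of weighted sums of multiple `t`-sums. -/
noncomputable def compCoeff (s : ℕ) : ℝ≥0∞ :=
  ∑ l ∈ comps s, 2 ^ (l.length - 1) * fullT (incHead l)

lemma tsum_pow_comps_cons {x : ℝ} (h0 : 0 ≤ x) (k : ℕ) (ks : List ℕ) :
    (∑' s, if k :: ks ∈ comps s then ENNReal.ofReal x ^ s * 2 ^ ks.length else 0) =
      headWeight x k * (ks.map (tailWeight x)).prod := by
  have hw : (ks.map (tailWeight x)).prod =
      if ∀ i ∈ ks, 1 ≤ i then ENNReal.ofReal x ^ ks.sum * 2 ^ ks.length else 0 := by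
    rw [← prod_map_two_mul_pow h0, ← prod_map_ite]
    rfl
  rw [hw, headWeight]
  by_cases hk : 1 ≤ k
  · by_cases hks : ∀ i ∈ ks, 1 ≤ i
    · rw [tsum_eq_single (k - 1 + ks.sum), if_pos, if_pos hk, if_pos hks, pow_add,
        ENNReal.ofReal_pow h0, mul_assoc]
      · rw [mem_comps]
        simp only [List.mem_cons, forall_eq_or_imp, List.sum_cons]
        exact ⟨⟨hk, hks⟩, by omega⟩
      · intro s hs
        rw [if_neg]
        simp only [mem_comps, List.sum_cons]
        rintro ⟨-, h⟩
        omega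
    · rw [if_neg hks, mul_zero, ENNReal.tsum_eq_zero]
      intro s
      rw [if_neg]
      exact fun h => hks fun i hi => (mem_comps.mp h).1 i (List.mem_cons_of_mem _ hi)
  · rw [if_neg hk, zero_mul, ENNReal.tsum_eq_zero]
    intro s
    rw [if_neg]
    exact fun h => hk ((mem_comps.mp h).1 k List.mem_cons_self)

lemma tsum_compCoeff {x : ℝ} (h0 : 0 ≤ x) (h1 : x ≤ 1 / 2) :
    ∑' s, ENNReal.ofReal x ^ s * compCoeff s = ENNReal.ofReal ((∑' j, wpTerm x 0 j) / (1 - x)) := by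
  have e : ∀ s, ENNReal.ofReal x ^ s * compCoeff s =
      ∑' l : List ℕ, (if l ∈ comps s then ENNReal.ofReal x ^ s * 2 ^ (l.length - 1) else 0) *
        fullT (incHead l) := fun s => by
    rw [tsum_eq_sum (s := comps s), compCoeff, mul_sum]
    · refine sum_congr rfl fun l hl => ?_
      rw [if_pos hl, mul_assoc]
    · intro l hl
      rw [if_neg hl, zero_mul]
  have hnil : ∀ s, [] ∉ comps s := fun s h => comps_ne_nil h rfl
  simp only [e]
  rw [ENNReal.tsum_comm, tsum_list]
  simp only [hnil, if_false, zero_mul, tsum_zero, zero_add, ENNReal.tsum_mul_right,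
    List.length_cons, Nat.add_sub_cancel, tsum_pow_comps_cons h0, incHead, fullT]
  have e2 : ∀ k, ∑' ks : List ℕ, headWeight x k * (ks.map (tailWeight x)).prod *
      ∑' m, oddInv (k + 1) m * truncT m ks =
      ∑' m, headWeight x k * oddInv (k + 1) m * truncGen (tailWeight x) m := fun k => by
    simp only [truncGen, ← ENNReal.tsum_mul_left]
    rw [ENNReal.tsum_comm]
    refine tsum_congr fun m => tsum_congr fun ks => ?_
    ring
  simp only [e2]
  rw [ENNReal.tsum_comm, ← tsum_div_const, ENNReal.ofReal_tsum_of_nonneg]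
  · refine tsum_congr fun m => ?_
    have hm : (0 : ℝ) ≤ m := m.cast_nonneg
    rw [ENNReal.tsum_mul_right, tsum_headWeight h0 h1, truncGen_tailWeight h0 h1,
      ← ENNReal.ofReal_mul, prod_div_eq_wpTerm h1]
    exact div_nonneg zero_le_one (mul_nonneg (by positivity) (by linarith))
  · exact fun m => div_nonneg (wpTerm_nonneg h0 h1 0 m) (by linarith)
  · exact (summable_wpTerm_zero h0 h1).div_const _

end TSum

namespace TSum

open Finset Filter Topology
open scoped ENNReal Nat

lemma tsum_length_eq (w : ℕ → ℝ≥0∞) (m : ℕ) :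
    (∑' l : List ℕ, if l.length = m then (l.map w).prod else 0) = (∑' i, w i) ^ m := by
  induction m with
  | zero => rw [tsum_list]; simp
  | succ m ih =>
    rw [tsum_list, pow_succ', ← ih, ← ENNReal.tsum_mul_right]
    simp [← ENNReal.tsum_mul_left]

lemma tsum_list_factorial (w : ℕ → ℝ≥0∞) :
    ∑' l : List ℕ, (l.length ! : ℝ≥0∞)⁻¹ * (l.map w).prod =
      ∑' m : ℕ, (m ! : ℝ≥0∞)⁻¹ * (∑' i, w i) ^ m := by
  simp only [← tsum_length_eq, ← ENNReal.tsum_mul_left]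
  rw [ENNReal.tsum_comm]
  refine tsum_congr fun l => ?_
  rw [tsum_eq_single l.length]
  · simp
  · intro m hm
    rw [if_neg hm.symm, mul_zero]

lemma tsum_pow_div_factorial {y : ℝ} (hy : 0 ≤ y) :
    ∑' m : ℕ, (m ! : ℝ≥0∞)⁻¹ * ENNReal.ofReal y ^ m = ENNReal.ofReal (Real.exp y) := by
  rw [Real.exp_eq_exp_ℝ, NormedSpace.exp_eq_tsum_div,
    ENNReal.ofReal_tsum_of_nonneg (fun m => by positivity) (Real.summable_pow_div_factorial y)]
  refine tsum_congr fun m => ?_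
  rw [ENNReal.ofReal_div_of_pos (by positivity), ENNReal.ofReal_pow hy, ENNReal.ofReal_natCast,
    div_eq_mul_inv, mul_comm]

/-- Summand of the coefficients of the exponential generating function. -/
noncomputable def expTerm (q : ℕ × List ℕ) : ℝ≥0∞ :=
  (q.1 ! : ℝ≥0∞)⁻¹ * ENNReal.ofReal (2 * Real.log 2) ^ q.1 *
    ((q.2.length ! : ℝ≥0∞)⁻¹ * (q.2.map fun i => ENNReal.ofReal (2 / i * altZeta i)).prod)

/-- Coefficients of the exponential generating function. -/
noncomputable def expCoeff (s : ℕ) : ℝ≥0∞ :=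
  ∑' q : {p : ℕ × List ℕ // (∀ i ∈ p.2, 2 ≤ i) ∧ p.1 + p.2.sum = s}, expTerm q.1

lemma tsum_altZeta_weight {x : ℝ} (h0 : 0 ≤ x) (h1 : x ≤ 1 / 2) :
    (∑' i, if 2 ≤ i then ENNReal.ofReal x ^ i * ENNReal.ofReal (2 / i * altZeta i) else 0) =
      ENNReal.ofReal (∑' n : ℕ, 2 * (x ^ (n + 2) / (n + 2) * altZeta (n + 2))) := by
  have hs : Summable fun n : ℕ => x ^ (n + 2) / (n + 2) * altZeta (n + 2) := by
    refine ((summable_nat_add_iff 1).mpr (summable_altZeta_series h0 h1)).congr fun n => ?_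
    push_cast
    ring_nf
  have hnn : ∀ n : ℕ, 0 ≤ 2 * (x ^ (n + 2) / (n + 2) * altZeta (n + 2)) := fun n =>
    mul_nonneg zero_le_two (mul_nonneg (by positivity) (altZeta_nonneg _))
  rw [tsum_eq_zero_add' ENNReal.summable, tsum_eq_zero_add' ENNReal.summable,
    ENNReal.ofReal_tsum_of_nonneg hnn (hs.mul_left 2)]
  simp only [Nat.not_ofNat_le_one, nonpos_iff_eq_zero, OfNat.ofNat_ne_zero, if_false, zero_add]
  refine tsum_congr fun n => ?_
  rw [if_pos (by omega), ← ENNReal.ofReal_pow h0, ← ENNReal.ofReal_mul (by positivity)]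
  congr 1
  push_cast
  ring

lemma prod_map_pow_mul (X : ℝ≥0∞) (v : ℕ → ℝ≥0∞) (l : List ℕ) :
    (l.map fun i => X ^ i * v i).prod = X ^ l.sum * (l.map v).prod := by
  induction l with
  | nil => simp
  | cons k ks ih =>
    rw [List.map_cons, List.prod_cons, ih, List.sum_cons, List.map_cons, List.prod_cons, pow_add]
    ring

lemma tsum_expCoeff {x : ℝ} (h0 : 0 ≤ x) (h1 : x ≤ 1 / 2) :
    ∑' s, ENNReal.ofReal x ^ s * expCoeff s =
      ENNReal.ofReal (Real.exp (∑' n : ℕ, x ^ (n + 1) / (n + 1) * altZeta (n + 1)) ^ 2) := by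
  classical
  have hlog : 0 ≤ Real.log 2 := Real.log_nonneg one_le_two
  have e : ∀ s, ENNReal.ofReal x ^ s * expCoeff s = ∑' q : ℕ × List ℕ,
      if (∀ i ∈ q.2, 2 ≤ i) ∧ q.1 + q.2.sum = s then ENNReal.ofReal x ^ s * expTerm q else 0 :=
    fun s => by
    have h := tsum_subtype {p : ℕ × List ℕ | (∀ i ∈ p.2, 2 ≤ i) ∧ p.1 + p.2.sum = s} expTerm
    rw [expCoeff]
    refine (congrArg _ h).trans ?_
    rw [← ENNReal.tsum_mul_left]
    refine tsum_congr fun q => ?_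
    simp [Set.indicator_apply]
  have e2 : ∀ q : ℕ × List ℕ, (∑' s, if (∀ i ∈ q.2, 2 ≤ i) ∧ q.1 + q.2.sum = s then
      ENNReal.ofReal x ^ s * expTerm q else 0) =
      (q.1 ! : ℝ≥0∞)⁻¹ * ENNReal.ofReal (2 * x * Real.log 2) ^ q.1 *
        ((q.2.length ! : ℝ≥0∞)⁻¹ * (q.2.map fun i => if 2 ≤ i then
          ENNReal.ofReal x ^ i * ENNReal.ofReal (2 / i * altZeta i) else 0).prod) := fun q => by
    rw [tsum_eq_single (q.1 + q.2.sum) fun s hs => if_neg fun h => hs h.2.symm, prod_map_ite,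
      prod_map_pow_mul]
    by_cases h : ∀ i ∈ q.2, 2 ≤ i
    · rw [if_pos ⟨h, rfl⟩, if_pos h, expTerm, show 2 * x * Real.log 2 = x * (2 * Real.log 2) by ring,
        ENNReal.ofReal_mul h0, mul_pow, pow_add]
      ring
    · rw [if_neg fun h' => h h'.1, if_neg h, mul_zero, mul_zero]
  simp only [e]
  rw [ENNReal.tsum_comm]
  simp only [e2]
  rw [ENNReal.tsum_prod']
  simp only [ENNReal.tsum_mul_left, ENNReal.tsum_mul_right]
  have hnn : 0 ≤ ∑' n : ℕ, 2 * (x ^ (n + 2) / (n + 2) * altZeta (n + 2)) := tsum_nonneg fun n =>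
    mul_nonneg zero_le_two (mul_nonneg (by positivity) (altZeta_nonneg _))
  rw [tsum_list_factorial, tsum_altZeta_weight h0 h1, tsum_pow_div_factorial hnn,
    tsum_pow_div_factorial (by positivity), ← ENNReal.ofReal_mul (Real.exp_nonneg _),
    ← Real.exp_add, sq, ← Real.exp_add, (summable_altZeta_series h0 h1).tsum_eq_zero_add,
    tsum_mul_left]
  congr 2
  have : ∀ n : ℕ, x ^ (n + 1 + 1) / (((n + 1 : ℕ) : ℝ) + 1) * altZeta (n + 1 + 1) =
      x ^ (n + 2) / (n + 2) * altZeta (n + 2) := fun n => by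
    push_cast
    ring_nf
  simp only [this, zero_add, altZeta_one]
  norm_num
  ring

lemma tsum_pow_mul_succ (X : ℝ≥0∞) (c : ℕ → ℝ≥0∞) :
    ∑' s, X ^ s * c s = c 0 + X * ∑' s, X ^ s * c (s + 1) := by
  rw [tsum_eq_zero_add' ENNReal.summable, ← ENNReal.tsum_mul_left]
  simp only [pow_zero, one_mul, pow_succ', mul_assoc]

lemma coeff_zero_le {c d : ℕ → ℝ≥0∞}
    (h : ∀ X : ℝ≥0∞, X ≠ 0 → X ≤ 2⁻¹ → ∑' s, X ^ s * c s = ∑' s, X ^ s * d s)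
    (hd : ∑' s, (2⁻¹ : ℝ≥0∞) ^ s * d s ≠ ∞) : c 0 ≤ d 0 := by
  set D := ∑' s, (2⁻¹ : ℝ≥0∞) ^ s * d (s + 1) with hD
  have hDfin : D ≠ ∞ := by
    intro hD'
    rw [tsum_pow_mul_succ, ← hD, hD', ENNReal.mul_top (by simp), add_top] at hd
    exact hd rfl
  have hlim : Tendsto (fun n : ℕ => d 0 + (2⁻¹ : ℝ≥0∞) ^ (n + 1) * D) atTop (𝓝 (d 0 + 0 * D)) := by
    refine tendsto_const_nhds.add (ENNReal.Tendsto.mul_const ?_ (Or.inr hDfin))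
    exact (ENNReal.tendsto_pow_atTop_nhds_zero_of_lt_one (by simp)).comp (tendsto_add_atTop_nat 1)
  rw [zero_mul, add_zero] at hlim
  refine ge_of_tendsto' hlim fun n => ?_
  have hle : (2⁻¹ : ℝ≥0∞) ^ (n + 1) ≤ 2⁻¹ := by
    rw [pow_succ]
    exact mul_le_of_le_one_left' (pow_le_one₀ zero_le (by simp))
  calc c 0 ≤ ∑' s, ((2⁻¹ : ℝ≥0∞) ^ (n + 1)) ^ s * c s := by
        rw [tsum_pow_mul_succ]; exact le_self_add
    _ = d 0 + (2⁻¹ : ℝ≥0∞) ^ (n + 1) * ∑' s, ((2⁻¹ : ℝ≥0∞) ^ (n + 1)) ^ s * d (s + 1) := by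
        rw [h _ (by simp) hle, tsum_pow_mul_succ]
    _ ≤ _ := by
        rw [hD]
        gcongr

/-- Power series with coefficients in `[0, ∞]` that agree near zero have equal coefficients. -/
lemma coeff_eq_of_tsum_eq {c d : ℕ → ℝ≥0∞}
    (h : ∀ X : ℝ≥0∞, X ≠ 0 → X ≤ 2⁻¹ → ∑' s, X ^ s * c s = ∑' s, X ^ s * d s)
    (hd : ∑' s, (2⁻¹ : ℝ≥0∞) ^ s * d s ≠ ∞) (n : ℕ) : c n = d n := by
  induction n generalizing c d with
  | zero =>
    exact (coeff_zero_le h hd).antisymm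
      (coeff_zero_le (fun X h0 h1 => (h X h0 h1).symm) (by rwa [h _ (by simp) le_rfl]))
  | succ n ih =>
    have h0 : c 0 = d 0 := (coeff_zero_le h hd).antisymm
      (coeff_zero_le (fun X h0 h1 => (h X h0 h1).symm) (by rwa [h _ (by simp) le_rfl]))
    rw [tsum_pow_mul_succ] at hd
    have hd' := ENNReal.add_ne_top.mp hd
    refine ih (c := fun s => c (s + 1)) (d := fun s => d (s + 1)) (fun X hX0 hX1 => ?_) ?_
    · have := h X hX0 hX1
      rw [tsum_pow_mul_succ X c, tsum_pow_mul_succ X d, h0, ENNReal.add_right_inj hd'.1] at this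
      exact (ENNReal.mul_right_inj hX0 (ne_top_of_le_ne_top (by simp) hX1)).mp this
    · intro htop
      rw [htop, ENNReal.mul_top (by simp)] at hd'
      exact hd'.2 rfl

lemma fullT_two : fullT [2] = ENNReal.ofReal (∑' j, wpTerm 0 0 j) := by
  rw [ENNReal.ofReal_tsum_of_nonneg (wpTerm_nonneg le_rfl (by norm_num) 0)
    (summable_wpTerm_zero le_rfl (by norm_num)), fullT]
  refine tsum_congr fun m => ?_
  have h := prod_div_eq_wpTerm (x := 0) (by norm_num) m
  have hprod : ∏ l ∈ range m, (2 * (l : ℝ) + 1 + 0) / (2 * l + 1 - 0) = 1 :=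
    prod_eq_one fun l _ => by rw [add_zero, sub_zero, div_self (by positivity)]
  rw [hprod] at h
  rw [truncT, mul_one, oddInv_eq]
  congr 1
  rw [sub_zero, sub_zero, div_one, mul_one] at h
  rw [← h, div_pow, one_pow, sq]

lemma tsum_compCoeff_eq {x : ℝ} (h0 : 0 ≤ x) (h1 : x ≤ 1 / 2) :
    ∑' s, ENNReal.ofReal x ^ s * compCoeff s =
      ∑' s, ENNReal.ofReal x ^ s * (fullT [2] * expCoeff s) := by
  have hx : 1 - x ≠ 0 := by linarith
  simp only [mul_left_comm _ (fullT [2])]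
  rw [tsum_compCoeff h0 h1, ENNReal.tsum_mul_left, tsum_expCoeff h0 h1, fullT_two,
    ← ENNReal.ofReal_mul (tsum_nonneg (wpTerm_nonneg le_rfl (by norm_num) 0)),
    tsum_wpTerm_zero_eq h0 h1 (tendsto_altProd_exp h0 h1), mul_assoc, mul_div_cancel_left₀ _ hx]

lemma tsum_compCoeff_ne_top : ∑' s, (2⁻¹ : ℝ≥0∞) ^ s * compCoeff s ≠ ∞ := by
  have h := tsum_compCoeff (x := 1 / 2) (by norm_num) le_rfl
  rw [one_div, ENNReal.ofReal_inv_of_pos two_pos, ENNReal.ofReal_ofNat] at h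
  rw [h]
  exact ENNReal.ofReal_ne_top

lemma compCoeff_eq (s : ℕ) : compCoeff s = fullT [2] * expCoeff s := by
  have h : ∀ X : ℝ≥0∞, X ≠ 0 → X ≤ 2⁻¹ →
      ∑' s, X ^ s * (fullT [2] * expCoeff s) = ∑' s, X ^ s * compCoeff s := fun X _ hX => by
    have hX' : X ≠ ∞ := ne_top_of_le_ne_top (by simp) hX
    have := tsum_compCoeff_eq (x := X.toReal) ENNReal.toReal_nonneg (by
      rw [one_div, ← ENNReal.toReal_ofNat 2, ← ENNReal.toReal_inv]
      exact ENNReal.toReal_mono (by simp) hX)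
    rw [ENNReal.ofReal_toReal hX'] at this
    exact this.symm
  exact (coeff_eq_of_tsum_eq h tsum_compCoeff_ne_top s).symm

lemma compCoeff_ne_top (s : ℕ) : compCoeff s ≠ ∞ := by
  have h := ENNReal.ne_top_of_tsum_ne_top tsum_compCoeff_ne_top s
  intro htop
  rw [htop, ENNReal.mul_top (pow_ne_zero _ (by simp))] at h
  exact h rfl

lemma sum_incHead {l : List ℕ} (h : l ≠ []) : (incHead l).sum = l.sum + 1 := by
  rcases l with _ | ⟨x, l⟩
  · exact absurd rfl h
  · simp only [incHead, List.sum_cons]; ring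

lemma sum_comps_tv {a : ℕ} (ha : 1 ≤ a) (s : ℕ) :
    ∑ p ∈ comps s, 2 ^ (p.length - 1) * tv (2 * a) a (incHead p) =
      ((a : ℝ) ^ (s + 2))⁻¹ * (compCoeff s).toReal := by
  rw [compCoeff, ENNReal.toReal_sum (ENNReal.sum_ne_top.mp (compCoeff_ne_top s)), mul_sum]
  refine sum_congr rfl fun p hp => ?_
  rw [tv_eq ha, sum_incHead (comps_ne_nil hp), (mem_comps.mp hp).2, ENNReal.toReal_mul,
    ENNReal.toReal_pow, ENNReal.toReal_ofNat]
  ring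

lemma tv_singleton (i : ℕ) : tv 2 1 [i] = ∑' j : ℕ, (1 / (2 * j + 1 : ℝ)) ^ i := by
  have h := tv_eq le_rfl [i]
  rw [mul_one] at h
  rw [h, fullT, ENNReal.tsum_toReal_eq]
  · simp only [Nat.cast_one, one_pow, inv_one, one_mul]
    refine tsum_congr fun j => ?_
    rw [truncT, mul_one, oddInv_eq, ENNReal.toReal_ofReal (by positivity)]
  · intro j
    rw [truncT, mul_one, oddInv_eq]
    exact ENNReal.ofReal_ne_top

lemma prod_altZeta {l : List ℕ} (h : ∀ i ∈ l, 2 ≤ i) :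
    (l.map fun i : ℕ => 2 / (i : ℝ) * altZeta i).prod =
      2 ^ (2 * l.length) * (l.map fun i => (2 : ℝ) ^ (i - 1) - 1).prod /
        ((l.map fun i : ℕ => (i : ℝ)).prod * (l.map fun i => (2 : ℝ) ^ i - 1).prod) *
          (l.map fun i => tv 2 1 [i]).prod := by
  induction l with
  | nil => simp
  | cons k ks ih =>
    simp only [List.mem_cons, forall_eq_or_imp] at h
    simp only [List.map_cons, List.prod_cons, ih h.2, List.length_cons, altZeta_eq h.1,
      ← tv_singleton]
    rw [mul_add, pow_add, div_eq_mul_inv _ (_ * _), div_eq_mul_inv _ (_ * _)]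
    simp only [mul_inv, div_eq_mul_inv]
    ring

lemma expTerm_toReal {q : ℕ × List ℕ} (h : ∀ i ∈ q.2, 2 ≤ i) (A t : ℝ) :
    (2 : ℝ) ^ (q.1 + 2 * q.2.length) * (q.2.map fun i => (2 : ℝ) ^ (i - 1) - 1).prod /
        (A * q.1 ! * q.2.length ! * (q.2.map fun i : ℕ => (i : ℝ)).prod *
          (q.2.map fun i => (2 : ℝ) ^ i - 1).prod) *
        t * (q.2.map fun i => tv 2 1 [i]).prod * Real.log 2 ^ q.1 =
      A⁻¹ * t * (expTerm q).toReal := by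
  have hlog : 0 ≤ Real.log 2 := Real.log_nonneg one_le_two
  have hprod : ((q.2.map fun i => ENNReal.ofReal (2 / i * altZeta i)).prod).toReal =
      (q.2.map fun i : ℕ => 2 / (i : ℝ) * altZeta i).prod := by
    induction q.2 with
    | nil => simp
    | cons k ks ih =>
      rw [List.map_cons, List.prod_cons, ENNReal.toReal_mul, ih, List.map_cons, List.prod_cons,
        ENNReal.toReal_ofReal (mul_nonneg (by positivity) (altZeta_nonneg _))]
  rw [expTerm, ENNReal.toReal_mul, ENNReal.toReal_mul, ENNReal.toReal_mul, hprod, prod_altZeta h,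
    ENNReal.toReal_pow, ENNReal.toReal_ofReal (by positivity), ENNReal.toReal_inv,
    ENNReal.toReal_inv, ENNReal.toReal_natCast, ENNReal.toReal_natCast, pow_add, mul_pow]
  simp only [mul_inv, div_eq_mul_inv]
  ring

lemma expTerm_ne_top (q : ℕ × List ℕ) : expTerm q ≠ ∞ := by
  refine ENNReal.mul_ne_top (ENNReal.mul_ne_top ?_ (ENNReal.pow_ne_top ENNReal.ofReal_ne_top)) (ENNReal.mul_ne_top ?_ ?_)
  · simp [Nat.factorial_ne_zero]
  · simp [Nat.factorial_ne_zero]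
  · induction q.2 with
    | nil => simp
    | cons k ks ih =>
      rw [List.map_cons, List.prod_cons]
      exact ENNReal.mul_ne_top ENNReal.ofReal_ne_top ih

end TSum

/-- Weighted sum formula: for `k ≥ 2`,
`Σ_{n=1}^{k-1} (1-2r)^{k-n-1} 2^{n-1} Σ_{k∈I₀(k,n)} t^r_{2a,a}(k)` equals the sum over
all `n, m ≥ 0` and `n₁,…,n_m ≥ 2` with `n + n₁ + ⋯ + n_m = k - 2` of
`2^{n+2m}(2^{n₁-1}-1)⋯(2^{n_m-1}-1)/(a^k n! m! n₁⋯n_m (2^{n₁}-1)⋯(2^{n_m}-1))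
  · t(2) t(n₁)⋯t(n_m) logⁿ(2)`,
where `t(n) = t_{2,1}(n)` is the classical t-value. -/
theorem stmt8 (a : ℕ) (ha : 1 ≤ a) (r : ℝ) (k : ℕ) (hk : 2 ≤ k) :
    ∑ n ∈ Finset.Icc 1 (k - 1),
        (1 - 2 * r) ^ (k - n - 1) * 2 ^ (n - 1) * X0d a r k n =
      ∑' q : {p : ℕ × List ℕ // (∀ i ∈ p.2, 2 ≤ i) ∧ p.1 + p.2.sum = k - 2},
        (2 : ℝ) ^ (q.1.1 + 2 * q.1.2.length)
            * (q.1.2.map (fun i => (2 : ℝ) ^ (i - 1) - 1)).prod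
          / ((a : ℝ) ^ k * (q.1.1.factorial : ℝ) * (q.1.2.length.factorial : ℝ)
              * (q.1.2.map (fun i => (i : ℝ))).prod
              * (q.1.2.map (fun i => (2 : ℝ) ^ i - 1)).prod)
          * tv 2 1 [2] * (q.1.2.map (fun i => tv 2 1 [i])).prod
          * Real.log 2 ^ q.1.1 := by
  obtain ⟨s, rfl⟩ := Nat.exists_eq_add_of_le' hk
  have h2 : tv 2 1 [2] = (TSum.fullT [2]).toReal := by
    have h := TSum.tv_eq le_rfl [2]
    simpa using h
  rw [show s + 2 - 1 = s + 1 by omega, TSum.sum_X0d, TSum.sum_comps_tv ha, TSum.compCoeff_eq,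
    ENNReal.toReal_mul, ← h2, ← mul_assoc, TSum.expCoeff,
    ENNReal.tsum_toReal_eq fun q => TSum.expTerm_ne_top _, ← tsum_mul_left,
    show s + 2 - 2 = s by omega]
  refine tsum_congr fun q =>
    (TSum.expTerm_toReal q.2.1 ((a : ℝ) ^ (s + 2)) (tv 2 1 [2])).symm.trans ?_
  simp only [List.map_id', List.bind_eq_flatMap, List.pure_def, ← List.map_eq_flatMap]
end
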